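/- Fix σ > 0 independent of n and 0 < κ < (α−1−2τ)/(2α²), and for each n set R = R(n) = ⌈n^{1/α+κ}⌉. For x ∈ Ωⁿ define T_{1,R}(x) = ½ log det(Iₙ + Φ_R(x) Λ_R Φ_R(x)ᵀ/σ²) − ½ Tr(Iₙ − (Iₙ + Φ_R(x) Λ_R Φ_R(x)ᵀ/σ²)^{−1}) and T_{2,R}(x) = (1/(2σ²)) f_R(x)ᵀ (Iₙ + Φ_R(x) Λ_R Φ_R(x)ᵀ/σ²)^{−1} f_R(x), where f_R(x) ∈ ℝⁿ has entries Σ_{p=1}^{R} μ_p φ_p(x_i). Then there exist constants c, C > 0 (independent of δ) such that for every δ ∈ (0,1) there exists N(δ) ∈ ℕ with: for all n ≥ N(δ), the set of x ∈ Ωⁿ satisfying both (i) c n^{1/α} ≤ T_{1,R}(x) ≤ C n^{1/α}, and (ii) in case μ₀ = 0, c a_n ≤ T_{2,R}(x) ≤ C a_n, where a_n = n^{max{0, 1+(1−2β)/α}} if α ≠ 2β−1 and a_n = log n if α = 2β−1, has ρ^{⊗n}-measure at least 1 − δ. -/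

import Mathlib

open Matrix MeasureTheory

/-- The eigenvalue sequence (0, λ₁, …, λ_R) indexed by Fin (R+1). -/
noncomputable def lamR (lam : ℕ → ℝ) {R : ℕ} (p : Fin (R + 1)) : ℝ :=
  if (p : ℕ) = 0 then 0 else lam p

/-- The matrix of the first R+1 eigenfunctions evaluated at the sample points. -/
noncomputable def PhiR {Ω : Type*} (φ : ℕ → Ω → ℝ) {n : ℕ} (x : Fin n → Ω) (R : ℕ) :
    Matrix (Fin n) (Fin (R + 1)) ℝ :=
  Matrix.of fun j p => φ (p : ℕ) (x j)

/-- The truncated kernel matrix Φ_R Λ_R Φ_Rᵀ. -/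
noncomputable def KR {Ω : Type*} (lam : ℕ → ℝ) (φ : ℕ → Ω → ℝ) {n : ℕ}
    (x : Fin n → Ω) (R : ℕ) : Matrix (Fin n) (Fin n) ℝ :=
  PhiR φ x R * Matrix.diagonal (fun p : Fin (R + 1) => lamR lam p) * (PhiR φ x R)ᵀ

/-- The noise part T_{1,R} of the truncated expected normalized stochastic complexity. -/
noncomputable def T1R {Ω : Type*} (lam : ℕ → ℝ) (φ : ℕ → Ω → ℝ) {n : ℕ}
    (x : Fin n → Ω) (R : ℕ) (s2 : ℝ) : ℝ :=
  (1 / 2) * Real.log ((1 + s2⁻¹ • KR lam φ x R).det)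
    - (1 / 2) * Matrix.trace ((1 : Matrix (Fin n) (Fin n) ℝ) - (1 + s2⁻¹ • KR lam φ x R)⁻¹)

/-- The truncated target function values f_R(x)_i = Σ_{p=1}^R μ_p φ_p(x_i). -/
noncomputable def fR {Ω : Type*} (μ : ℕ → ℝ) (φ : ℕ → Ω → ℝ) {n : ℕ}
    (x : Fin n → Ω) (R : ℕ) : Fin n → ℝ :=
  fun i => ∑ p ∈ Finset.Icc 1 R, μ p * φ p (x i)

/-- The data-fit part T_{2,R} of the truncated expected normalized stochastic
complexity. -/
noncomputable def T2R {Ω : Type*} (lam μ : ℕ → ℝ) (φ : ℕ → Ω → ℝ) {n : ℕ}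
    (x : Fin n → Ω) (R : ℕ) (s2 : ℝ) : ℝ :=
  (1 / (2 * s2)) * (fR μ φ x R ⬝ᵥ ((1 + s2⁻¹ • KR lam φ x R)⁻¹ *ᵥ fR μ φ x R))

/-! ### Regularized sums of rank-one matrices -/

section RankOne

variable {ι : Type*} {n : ℕ}

/-- The matrix `1 + ∑ p ∈ s, η p • b p (b p)ᵀ`. -/
noncomputable def regGram (s : Finset ι) (η : ι → ℝ) (b : ι → Fin n → ℝ) :
    Matrix (Fin n) (Fin n) ℝ :=
  1 + ∑ p ∈ s, η p • vecMulVec (b p) (b p)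

lemma regGram_mulVec (s : Finset ι) (η : ι → ℝ) (b : ι → Fin n → ℝ) (v : Fin n → ℝ) :
    regGram s η b *ᵥ v = v + ∑ p ∈ s, (η p * (b p ⬝ᵥ v)) • b p := by
  rw [regGram, add_mulVec, one_mulVec, sum_mulVec]
  congr 1
  refine Finset.sum_congr rfl fun p _ => ?_
  rw [smul_mulVec, vecMulVec_mulVec, mul_smul]
  simp

lemma dotProduct_regGram_mulVec (s : Finset ι) (η : ι → ℝ) (b : ι → Fin n → ℝ)
    (u v : Fin n → ℝ) :
    u ⬝ᵥ (regGram s η b *ᵥ v) = u ⬝ᵥ v + ∑ p ∈ s, η p * (b p ⬝ᵥ u) * (b p ⬝ᵥ v) := by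
  rw [regGram_mulVec, dotProduct_add, dotProduct_sum]
  congr 1
  refine Finset.sum_congr rfl fun p _ => ?_
  rw [dotProduct_smul, dotProduct_comm u, smul_eq_mul]
  ring

lemma regGram_isHermitian (s : Finset ι) (η : ι → ℝ) (b : ι → Fin n → ℝ) :
    (regGram s η b).IsHermitian := by
  ext i j
  simp [regGram, Matrix.sum_apply, vecMulVec_apply, Matrix.one_apply, eq_comm, mul_comm]

lemma regGram_posDef {s : Finset ι} {η : ι → ℝ} (hη : ∀ p ∈ s, 0 ≤ η p) (b : ι → Fin n → ℝ) :
    (regGram s η b).PosDef := by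
  refine PosDef.of_dotProduct_mulVec_pos (regGram_isHermitian s η b) fun v hv => ?_
  rw [star_trivial, dotProduct_regGram_mulVec]
  have h1 : 0 < v ⬝ᵥ v := by
    have := dotProduct_star_self_pos_iff.2 hv
    simpa using this
  have h2 : 0 ≤ ∑ p ∈ s, η p * (b p ⬝ᵥ v) * (b p ⬝ᵥ v) :=
    Finset.sum_nonneg fun p hp => by
      rw [mul_assoc]; exact mul_nonneg (hη p hp) (mul_self_nonneg _)
  linarith

lemma regGram_mulVec_inv {s : Finset ι} {η : ι → ℝ} (hη : ∀ p ∈ s, 0 ≤ η p)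
    (b : ι → Fin n → ℝ) (f : Fin n → ℝ) :
    regGram s η b *ᵥ ((regGram s η b)⁻¹ *ᵥ f) = f := by
  have hu : IsUnit (regGram s η b).det :=
    (Matrix.isUnit_iff_isUnit_det _).1 (regGram_posDef hη b).isUnit
  rw [mulVec_mulVec, Matrix.mul_nonsing_inv _ hu, one_mulVec]

lemma dotProduct_regGram_inv_eq {s : Finset ι} {η : ι → ℝ} (hη : ∀ p ∈ s, 0 ≤ η p)
    (b : ι → Fin n → ℝ) (f u : Fin n → ℝ) :
    f ⬝ᵥ u = u ⬝ᵥ ((regGram s η b)⁻¹ *ᵥ f) +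
      ∑ p ∈ s, η p * (b p ⬝ᵥ u) * (b p ⬝ᵥ ((regGram s η b)⁻¹ *ᵥ f)) := by
  rw [← dotProduct_regGram_mulVec, regGram_mulVec_inv hη, dotProduct_comm]

lemma two_mul_dotProduct_le (u v : Fin n → ℝ) : 2 * (u ⬝ᵥ v) ≤ u ⬝ᵥ u + v ⬝ᵥ v := by
  simp only [dotProduct, Finset.mul_sum, ← Finset.sum_add_distrib]
  exact Finset.sum_le_sum fun i _ => by nlinarith [sq_nonneg (u i - v i)]

/-- The variational upper bound for ridge regression. -/
lemma dotProduct_regGram_inv_le {s : Finset ι} {η : ι → ℝ} (hη : ∀ p ∈ s, 0 < η p)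
    (b : ι → Fin n → ℝ) (f : Fin n → ℝ) (ν : ι → ℝ) :
    f ⬝ᵥ ((regGram s η b)⁻¹ *ᵥ f) ≤
      (f - ∑ p ∈ s, ν p • b p) ⬝ᵥ (f - ∑ p ∈ s, ν p • b p) + ∑ p ∈ s, ν p ^ 2 / η p := by
  set v := (regGram s η b)⁻¹ *ᵥ f with hv
  have h1 := dotProduct_regGram_inv_eq (fun p hp => (hη p hp).le) b f v
  rw [← hv] at h1
  set r := f - ∑ p ∈ s, ν p • b p with hr
  have h2 : f ⬝ᵥ v = r ⬝ᵥ v + ∑ p ∈ s, ν p * (b p ⬝ᵥ v) := by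
    have : f = r + ∑ p ∈ s, ν p • b p := by simp [hr]
    conv_lhs => rw [this, add_dotProduct, sum_dotProduct]
    simp
  have h3 : 2 * (r ⬝ᵥ v) ≤ r ⬝ᵥ r + v ⬝ᵥ v :=
    two_mul_dotProduct_le r v
  have h4 : 2 * ∑ p ∈ s, ν p * (b p ⬝ᵥ v) ≤
      ∑ p ∈ s, ν p ^ 2 / η p + ∑ p ∈ s, η p * (b p ⬝ᵥ v) * (b p ⬝ᵥ v) := by
    rw [Finset.mul_sum, ← Finset.sum_add_distrib]
    refine Finset.sum_le_sum fun p hp => ?_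
    have hp' := hη p hp
    have : ν p ^ 2 / η p + η p * (b p ⬝ᵥ v) * (b p ⬝ᵥ v) - 2 * (ν p * (b p ⬝ᵥ v))
        = (ν p - η p * (b p ⬝ᵥ v)) ^ 2 / η p := by
      field_simp
      ring
    have h5 : 0 ≤ (ν p - η p * (b p ⬝ᵥ v)) ^ 2 / η p := by positivity
    linarith
  linarith

/-- The dual lower bound for ridge regression. -/
lemma le_dotProduct_regGram_inv {s : Finset ι} {η : ι → ℝ} (hη : ∀ p ∈ s, 0 ≤ η p)
    (b : ι → Fin n → ℝ) (f u : Fin n → ℝ) :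
    2 * (f ⬝ᵥ u) - (u ⬝ᵥ u + ∑ p ∈ s, η p * (b p ⬝ᵥ u) ^ 2) ≤
      f ⬝ᵥ ((regGram s η b)⁻¹ *ᵥ f) := by
  set v := (regGram s η b)⁻¹ *ᵥ f with hv
  have h1 := dotProduct_regGram_inv_eq hη b f v
  have h2 := dotProduct_regGram_inv_eq hη b f u
  rw [← hv] at h1 h2
  have h3 := two_mul_dotProduct_le u v
  have h4 : 2 * ∑ p ∈ s, η p * (b p ⬝ᵥ u) * (b p ⬝ᵥ v) ≤
      ∑ p ∈ s, η p * (b p ⬝ᵥ u) ^ 2 + ∑ p ∈ s, η p * (b p ⬝ᵥ v) * (b p ⬝ᵥ v) := by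
    rw [Finset.mul_sum, ← Finset.sum_add_distrib]
    refine Finset.sum_le_sum fun p hp => ?_
    nlinarith [mul_nonneg (hη p hp) (sq_nonneg (b p ⬝ᵥ u - b p ⬝ᵥ v))]
  linarith

/-- The quotient form of the dual lower bound. -/
lemma div_le_dotProduct_regGram_inv {s : Finset ι} {η : ι → ℝ} (hη : ∀ p ∈ s, 0 ≤ η p)
    (b : ι → Fin n → ℝ) (f u : Fin n → ℝ) {A B : ℝ} (hA : 0 ≤ A) (hB : 0 < B)
    (hfu : A ≤ f ⬝ᵥ u) (hu : u ⬝ᵥ u + ∑ p ∈ s, η p * (b p ⬝ᵥ u) ^ 2 ≤ B) :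
    A ^ 2 / B ≤ f ⬝ᵥ ((regGram s η b)⁻¹ *ᵥ f) := by
  have h := le_dotProduct_regGram_inv hη b f ((A / B) • u)
  have h1 : ∑ p ∈ s, η p * (b p ⬝ᵥ ((A / B) • u)) ^ 2 =
      (A / B) ^ 2 * ∑ p ∈ s, η p * (b p ⬝ᵥ u) ^ 2 := by
    rw [Finset.mul_sum]
    refine Finset.sum_congr rfl fun p _ => ?_
    rw [dotProduct_smul, smul_eq_mul]; ring
  rw [h1, dotProduct_smul, smul_dotProduct, dotProduct_smul] at h
  simp only [smul_eq_mul] at h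
  have h2 : (A / B) ^ 2 * (u ⬝ᵥ u + ∑ p ∈ s, η p * (b p ⬝ᵥ u) ^ 2) ≤ (A / B) ^ 2 * B :=
    mul_le_mul_of_nonneg_left hu (sq_nonneg _)
  have h3 : A / B * A ≤ A / B * (f ⬝ᵥ u) := mul_le_mul_of_nonneg_left hfu (by positivity)
  have h4 : A ^ 2 / B = 2 * (A / B * A) - (A / B) ^ 2 * B := by
    field_simp
    ring
  nlinarith

lemma regGram_det_pos {s : Finset ι} {η : ι → ℝ} (hη : ∀ p ∈ s, 0 ≤ η p)
    (b : ι → Fin n → ℝ) : 0 < (regGram s η b).det :=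
  (regGram_posDef hη b).det_pos

lemma dotProduct_regGram_inv_le_self {s : Finset ι} {η : ι → ℝ} (hη : ∀ p ∈ s, 0 < η p)
    (b : ι → Fin n → ℝ) (f : Fin n → ℝ) :
    f ⬝ᵥ ((regGram s η b)⁻¹ *ᵥ f) ≤ f ⬝ᵥ f := by
  simpa using dotProduct_regGram_inv_le hη b f 0

lemma dotProduct_regGram_inv_nonneg {s : Finset ι} {η : ι → ℝ} (hη : ∀ p ∈ s, 0 ≤ η p)
    (b : ι → Fin n → ℝ) (f : Fin n → ℝ) :
    0 ≤ f ⬝ᵥ ((regGram s η b)⁻¹ *ᵥ f) := by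
  simpa using (regGram_posDef hη b).inv.posSemidef.dotProduct_mulVec_nonneg f

/-- Hadamard-type bound for the log-determinant. -/
lemma log_det_regGram_le {s : Finset ι} {η : ι → ℝ} (hη : ∀ p ∈ s, 0 < η p)
    (b : ι → Fin n → ℝ) :
    Real.log (regGram s η b).det ≤ ∑ p ∈ s, Real.log (1 + η p * (b p ⬝ᵥ b p)) := by
  classical
  induction s using Finset.induction_on with
  | empty => simp [regGram]
  | insert a s ha ih =>
    have hηs : ∀ p ∈ s, 0 < η p := fun p hp => hη p (Finset.mem_insert_of_mem hp)
    have hηs' : ∀ p ∈ s, 0 ≤ η p := fun p hp => (hηs p hp).le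
    have hηa : 0 < η a := hη a (Finset.mem_insert_self _ _)
    have hu : IsUnit (regGram s η b).det := (regGram_det_pos hηs' b).ne'.isUnit
    have hdet : (regGram (insert a s) η b).det =
        (regGram s η b).det * (1 + η a * (b a ⬝ᵥ ((regGram s η b)⁻¹ *ᵥ b a))) := by
      have h1 : regGram (insert a s) η b =
          regGram s η b + replicateCol Unit (η a • b a) * replicateRow Unit (b a) := by
        rw [regGram, regGram, Finset.sum_insert ha, ← vecMulVec_eq, smul_vecMulVec]
        abel
      rw [h1, det_add_replicateCol_mul_replicateRow hu]
      congr 1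
      rw [Matrix.det_unique, ← replicateRow_vecMul, dotProduct_mulVec, ← smul_eq_mul (η a),
        ← dotProduct_smul]
      simp [Matrix.mul_apply, dotProduct, Finset.mul_sum, mul_left_comm]
    have hq := dotProduct_regGram_inv_le_self hηs b (b a)
    have hq0 := dotProduct_regGram_inv_nonneg hηs' b (b a)
    have hpos : 0 < 1 + η a * (b a ⬝ᵥ ((regGram s η b)⁻¹ *ᵥ b a)) := by positivity
    rw [hdet, Finset.sum_insert ha, Real.log_mul (regGram_det_pos hηs' b).ne' hpos.ne', add_comm]
    refine add_le_add (Real.log_le_log hpos ?_) (ih hηs)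
    gcongr

lemma trace_one_sub_regGram_inv_nonneg {s : Finset ι} {η : ι → ℝ} (hη : ∀ p ∈ s, 0 < η p)
    (b : ι → Fin n → ℝ) :
    0 ≤ trace ((1 : Matrix (Fin n) (Fin n) ℝ) - (regGram s η b)⁻¹) := by
  refine Finset.sum_nonneg fun i _ => ?_
  have := dotProduct_regGram_inv_le_self hη b (Pi.single i 1)
  simp at this
  simp [this]

end RankOne

/-! ### A lower bound for `log det X - tr (1 - X⁻¹)` -/

lemma half_sq_le_neg_log_sub {t : ℝ} (ht0 : 0 < t) (ht1 : t ≤ 1) :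
    (1 - t) ^ 2 / 2 ≤ -Real.log t - (1 - t) := by
  have key : Real.log t ≤ (t - 1) - (1 - t) ^ 2 / 2 := by
    have h1 : ∀ y : ℝ, 0 ≤ y → y < 1 → Real.log (1 - y) ≤ -y - y ^ 2 / 2 := by
      intro y hy0 hy1
      have hs := Real.hasSum_pow_div_log_of_abs_lt_one (x := y) (by rw [abs_lt]; constructor <;> linarith)
      have := hs.summable.sum_le_tsum (Finset.range 2) (fun i _ => by positivity)
      rw [hs.tsum_eq] at this
      norm_num [Finset.sum_range_succ] at this
      linarith
    have := h1 (1 - t) (by linarith) (by linarith)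
    rw [sub_sub_cancel] at this
    linarith
  linarith

lemma IsHermitian.trace_mul_self_eq_sum {n : ℕ} {T : Matrix (Fin n) (Fin n) ℝ}
    (hT : T.IsHermitian) : trace (T * T) = ∑ i, hT.eigenvalues i ^ 2 := by
  have h := hT.spectral_theorem
  set U := hT.eigenvectorUnitary
  set D : Matrix (Fin n) (Fin n) ℝ := diagonal (RCLike.ofReal ∘ hT.eigenvalues) with hD
  rw [Unitary.conjStarAlgAut_apply] at h
  have h2 : T * T = (U : Matrix (Fin n) (Fin n) ℝ) * (D * D) * star (U : Matrix (Fin n) (Fin n) ℝ) := by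
    conv_lhs => rw [h]
    have := Unitary.coe_star_mul_self U
    calc _ = (U : Matrix (Fin n) (Fin n) ℝ) * D * (star (U : Matrix (Fin n) (Fin n) ℝ) * U) * D *
          star (U : Matrix (Fin n) (Fin n) ℝ) := by simp only [Matrix.mul_assoc]
      _ = _ := by rw [this]; simp only [Matrix.mul_assoc, Matrix.mul_one]
  rw [h2, Matrix.trace_mul_comm, ← Matrix.mul_assoc, Unitary.coe_star_mul_self, Matrix.one_mul, hD,
    diagonal_mul_diagonal, trace_diagonal]
  simp [pow_two]

/-- If `X⁻¹` is positive definite and bounded by the identity, the relative-entropy functional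
`log det X - tr (1 - X⁻¹)` dominates half the squared Frobenius norm of `1 - X⁻¹`. -/
lemma half_sum_sq_le_log_det_sub_trace {n : ℕ} {X : Matrix (Fin n) (Fin n) ℝ} (hX : X.PosDef)
    (hle : ∀ v : Fin n → ℝ, v ⬝ᵥ (X⁻¹ *ᵥ v) ≤ v ⬝ᵥ v) :
    (∑ i, ∑ j, (1 - X⁻¹) i j ^ 2) / 2 ≤ Real.log X.det - trace (1 - X⁻¹) := by
  have hT : (X⁻¹).IsHermitian := hX.inv.isHermitian
  set t := hT.eigenvalues with ht
  have ht0 : ∀ i, 0 < t i := fun i => hX.inv.eigenvalues_pos i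
  have ht1 : ∀ i, t i ≤ 1 := by
    intro i
    have h1 := hle (WithLp.ofLp (hT.eigenvectorBasis i))
    rw [hT.mulVec_eigenvectorBasis, dotProduct_smul, smul_eq_mul] at h1
    have h2 : WithLp.ofLp (hT.eigenvectorBasis i) ⬝ᵥ WithLp.ofLp (hT.eigenvectorBasis i) = 1 := by
      have h3 := real_inner_self_eq_norm_sq (hT.eigenvectorBasis i)
      rw [hT.eigenvectorBasis.orthonormal.1 i, EuclideanSpace.inner_eq_star_dotProduct] at h3
      simpa using h3
    rw [h2] at h1
    simpa using h1
  have hdet : Real.log X.det = ∑ i, -Real.log (t i) := by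
    have h1 : (X⁻¹).det = ∏ i, t i := by
      simpa using hT.det_eq_prod_eigenvalues
    rw [Matrix.det_nonsing_inv, Ring.inverse_eq_inv'] at h1
    have h2 : Real.log X.det = -Real.log (X.det⁻¹) := by rw [Real.log_inv, neg_neg]
    rw [h2, h1, Real.log_prod (fun i _ => (ht0 i).ne'), Finset.sum_neg_distrib]
  have htr : trace (X⁻¹) = ∑ i, t i := by simpa using hT.trace_eq_sum_eigenvalues
  have htr2 : trace (X⁻¹ * X⁻¹) = ∑ i, t i ^ 2 := IsHermitian.trace_mul_self_eq_sum hT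
  have hfro : ∑ i, ∑ j, (1 - X⁻¹) i j ^ 2 = ∑ i, (1 - t i) ^ 2 := by
    have h1 : ∑ i, ∑ j, (1 - X⁻¹) i j ^ 2 = trace ((1 - X⁻¹) * (1 - X⁻¹)) := by
      simp only [trace, diag_apply, Matrix.mul_apply]
      refine Finset.sum_congr rfl fun i _ => Finset.sum_congr rfl fun j _ => ?_
      have hs : (1 - X⁻¹) j i = (1 - X⁻¹) i j := by
        have h5 : (1 - X⁻¹).IsHermitian := Matrix.isHermitian_one.sub hT
        simpa using h5.apply i j
      rw [hs, pow_two]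
    have h2 : (1 - X⁻¹) * (1 - X⁻¹) = 1 - X⁻¹ - X⁻¹ + X⁻¹ * X⁻¹ := by noncomm_ring
    rw [h1, h2, trace_add, trace_sub, trace_sub, htr, htr2, trace_one]
    have h3 : ((Fintype.card (Fin n) : ℕ) : ℝ) = ∑ _i : Fin n, (1 : ℝ) := by simp
    rw [h3, ← Finset.sum_sub_distrib, ← Finset.sum_sub_distrib, ← Finset.sum_add_distrib]
    exact Finset.sum_congr rfl fun i _ => by ring
  have htr3 : trace (1 - X⁻¹) = ∑ i, (1 - t i) := by
    rw [trace_sub, htr, Finset.sum_sub_distrib]; simp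
  rw [hfro, hdet, htr3, ← Finset.sum_sub_distrib, Finset.sum_div]
  exact Finset.sum_le_sum fun i _ => half_sq_le_neg_log_sub (ht0 i) (ht1 i)

lemma regGram_half_sum_sq_le {ι : Type*} {n : ℕ} {s : Finset ι} {η : ι → ℝ}
    (hη : ∀ p ∈ s, 0 < η p) (b : ι → Fin n → ℝ) :
    (∑ i, ∑ j, (1 - (regGram s η b)⁻¹) i j ^ 2) / 2 ≤
      Real.log (regGram s η b).det - trace (1 - (regGram s η b)⁻¹) :=
  half_sum_sq_le_log_det_sub_trace (regGram_posDef (fun p hp => (hη p hp).le) b)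
    (dotProduct_regGram_inv_le_self hη b)

/-! ### Empirical means and events of high probability -/

section Empirical

variable {Ω : Type*}

/-- The empirical mean of `a` over the sample `x`. -/
noncomputable def empMean {n : ℕ} (a : Ω → ℝ) (x : Fin n → Ω) : ℝ := (∑ i, a (x i)) / n

lemma empMean_add {n : ℕ} (a b : Ω → ℝ) (x : Fin n → Ω) :
    empMean (fun z => a z + b z) x = empMean a x + empMean b x := by
  simp [empMean, Finset.sum_add_distrib, add_div]

lemma empMean_sum {ι : Type*} {n : ℕ} (s : Finset ι) (a : ι → Ω → ℝ) (x : Fin n → Ω) :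
    empMean (fun z => ∑ p ∈ s, a p z) x = ∑ p ∈ s, empMean (a p) x := by
  simp only [empMean]
  rw [Finset.sum_comm, Finset.sum_div]

lemma empMean_const_mul {n : ℕ} (c : ℝ) (a : Ω → ℝ) (x : Fin n → Ω) :
    empMean (fun z => c * a z) x = c * empMean a x := by
  simp [empMean, ← Finset.mul_sum, mul_div_assoc]

lemma empMean_mono {n : ℕ} {a b : Ω → ℝ} (h : ∀ z, a z ≤ b z) (x : Fin n → Ω) :
    empMean a x ≤ empMean b x := by
  unfold empMean
  gcongr
  exact h _

lemma empMean_nonneg {n : ℕ} {a : Ω → ℝ} (h : ∀ z, 0 ≤ a z) (x : Fin n → Ω) :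
    0 ≤ empMean a x :=
  div_nonneg (Finset.sum_nonneg fun _ _ => h _) (Nat.cast_nonneg n)

lemma empMean_le_of_le {n : ℕ} (hn : n ≠ 0) {a : Ω → ℝ} {K : ℝ} (h : ∀ z, a z ≤ K)
    (x : Fin n → Ω) : empMean a x ≤ K := by
  have hn' : (0 : ℝ) < n := by positivity
  rw [empMean, div_le_iff₀ hn']
  calc ∑ i, a (x i) ≤ ∑ _i : Fin n, K := Finset.sum_le_sum fun i _ => h _
    _ = K * n := by simp [mul_comm]

lemma sum_eq_mul_empMean {n : ℕ} (hn : n ≠ 0) (a : Ω → ℝ) (x : Fin n → Ω) :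
    ∑ i, a (x i) = n * empMean a x := by
  have hn' : (n : ℝ) ≠ 0 := by positivity
  rw [empMean]
  field_simp

lemma abs_empMean_le {n : ℕ} {a : Ω → ℝ} {K : ℝ} (hK0 : 0 ≤ K) (hK : ∀ z, |a z| ≤ K)
    (x : Fin n → Ω) : |empMean a x| ≤ K := by
  rcases eq_or_ne n 0 with rfl | hn
  · simpa [empMean] using hK0
  · rw [abs_le]
    constructor
    · have := empMean_le_of_le hn (a := fun z => (-1) * a z) (K := K)
        (fun z => by have := (abs_le.1 (hK z)).1; linarith) x
      rw [empMean_const_mul] at this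
      linarith
    · exact empMean_le_of_le hn (fun z => (abs_le.1 (hK z)).2) x

variable [MeasurableSpace Ω] (ρ : Measure Ω)

lemma integrable_of_abs_le [IsProbabilityMeasure ρ] {a : Ω → ℝ} (ha : Measurable a) (hb : ∃ K, ∀ z, |a z| ≤ K) :
    Integrable a ρ := by
  obtain ⟨K, hK⟩ := hb
  exact Integrable.of_bound ha.aestronglyMeasurable K (Filter.Eventually.of_forall hK)

lemma measurable_empMean {n : ℕ} {a : Ω → ℝ} (ha : Measurable a) :
    Measurable (fun x : Fin n → Ω => empMean a x) := by
  unfold empMean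
  fun_prop

lemma integral_empMean_sub_sq_le [IsProbabilityMeasure ρ] {n : ℕ} (hn : n ≠ 0) {a : Ω → ℝ} (ha : Measurable a)
    (hb : ∃ K, ∀ z, |a z| ≤ K) :
    ∫ x, (empMean a x - ∫ z, a z ∂ρ) ^ 2 ∂(Measure.pi fun _ : Fin n => ρ) ≤
      (∫ z, a z ^ 2 ∂ρ) / n := by
  have hn' : (0 : ℝ) < n := by positivity
  obtain ⟨K, hK⟩ := hb
  have hmem : MemLp a 2 ρ :=
    MemLp.of_bound ha.aestronglyMeasurable K (Filter.Eventually.of_forall hK)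
  have hvar := ProbabilityTheory.variance_sum_pi (μ := fun _ : Fin n => ρ)
    (X := fun _ : Fin n => a) (fun _ => hmem)
  have hsum : (∑ i : Fin n, fun ω : Fin n → Ω => a (ω i)) = fun ω => ∑ i, a (ω i) := by
    ext ω; simp
  have hmeas : Measurable (fun ω : Fin n → Ω => ∑ i, a (ω i)) :=
    Finset.measurable_sum _ fun i _ => ha.comp (measurable_pi_apply i)
  rw [hsum, ProbabilityTheory.variance_eq_integral hmeas.aemeasurable] at hvar
  have hmean : ∫ x, ∑ i, a (x i) ∂(Measure.pi fun _ : Fin n => ρ) = n * ∫ z, a z ∂ρ := by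
    rw [integral_finsetSum]
    · have : ∀ i : Fin n, ∫ x, a (x i) ∂(Measure.pi fun _ : Fin n => ρ) = ∫ z, a z ∂ρ :=
        fun i => integral_comp_eval (μ := fun _ : Fin n => ρ) (i := i) ha.aestronglyMeasurable
      simp [this]
    · intro i _
      exact integrable_comp_eval (μ := fun _ : Fin n => ρ) (integrable_of_abs_le ρ ha ⟨K, hK⟩)
  rw [hmean] at hvar
  have hle : ProbabilityTheory.variance a ρ ≤ ∫ z, a z ^ 2 ∂ρ :=
    ProbabilityTheory.variance_le_expectation_sq ha.aestronglyMeasurable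
  have heq : ∀ x : Fin n → Ω, (empMean a x - ∫ z, a z ∂ρ) ^ 2 =
      (∑ i, a (x i) - n * ∫ z, a z ∂ρ) ^ 2 / (n : ℝ) ^ 2 := by
    intro x
    rw [empMean]
    field_simp
  simp_rw [heq]
  rw [integral_div, hvar, div_le_div_iff₀ (by positivity) hn']
  simp only [Finset.sum_const, Finset.card_univ, Fintype.card_fin, nsmul_eq_mul]
  nlinarith [mul_le_mul_of_nonneg_left hle (sq_nonneg (n : ℝ))]

/-- Markov's inequality for weighted squared fluctuations of empirical means. -/
lemma measure_compl_fluctuation_le [IsProbabilityMeasure ρ] {ι : Type*} {n : ℕ} (hn : n ≠ 0) (s : Finset ι) {η : ι → ℝ}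
    (hη : ∀ p ∈ s, 0 ≤ η p) {a : ι → Ω → ℝ} (ha : ∀ p, Measurable (a p))
    (hb : ∀ p, ∃ K, ∀ z, |a p z| ≤ K) {B t : ℝ} (ht : 0 < t)
    (hB : ∑ p ∈ s, η p * ∫ z, a p z ^ 2 ∂ρ ≤ B) :
    (Measure.pi fun _ : Fin n => ρ)
      {x | ∑ p ∈ s, η p * (empMean (a p) x - ∫ z, a p z ∂ρ) ^ 2 ≤ t}ᶜ ≤
      ENNReal.ofReal (B / (n * t)) := by
  have hn' : (0 : ℝ) < n := by positivity
  set P := Measure.pi fun _ : Fin n => ρ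
  set F : (Fin n → Ω) → ℝ := fun x => ∑ p ∈ s, η p * (empMean (a p) x - ∫ z, a p z ∂ρ) ^ 2
  have hint : ∀ p, Integrable (fun x : Fin n → Ω => (empMean (a p) x - ∫ z, a p z ∂ρ) ^ 2) P := by
    intro p
    obtain ⟨K, hK⟩ := hb p
    have hK0 : 0 ≤ K := by
      obtain ⟨z⟩ : Nonempty Ω := ρ.nonempty_of_neZero
      exact (abs_nonneg _).trans (hK z)
    refine Integrable.of_bound (((measurable_empMean (ha p)).sub_const _).pow_const
      2).aestronglyMeasurable ((K + |∫ z, a p z ∂ρ|) ^ 2) (Filter.Eventually.of_forall fun x => ?_)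
    rw [Real.norm_eq_abs, abs_pow]
    gcongr
    exact (abs_sub _ _).trans (by gcongr; exact abs_empMean_le hK0 hK x)
  have hF : ∫ x, F x ∂P ≤ B / n := by
    simp only [F]
    rw [integral_finsetSum _ fun p _ => (hint p).const_mul _]
    calc ∑ p ∈ s, ∫ x, η p * (empMean (a p) x - ∫ z, a p z ∂ρ) ^ 2 ∂P
        ≤ ∑ p ∈ s, η p * ((∫ z, a p z ^ 2 ∂ρ) / n) := by
          refine Finset.sum_le_sum fun p hp => ?_
          rw [integral_const_mul]
          exact mul_le_mul_of_nonneg_left (integral_empMean_sub_sq_le ρ hn (ha p) (hb p)) (hη p hp)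
      _ = (∑ p ∈ s, η p * ∫ z, a p z ^ 2 ∂ρ) / n := by
          rw [Finset.sum_div]; exact Finset.sum_congr rfl fun p _ => by ring
      _ ≤ B / n := by gcongr
  have hmark := mul_meas_ge_le_integral_of_nonneg (μ := P) (f := F)
    (Filter.Eventually.of_forall fun x => Finset.sum_nonneg fun p hp =>
      mul_nonneg (hη p hp) (sq_nonneg _))
    (integrable_finsetSum _ fun p _ => (hint p).const_mul _) t
  have hsub : {x | F x ≤ t}ᶜ ⊆ {x | t ≤ F x} := fun x hx => by
    simp only [Set.mem_compl_iff, Set.mem_ofPred_eq, not_le] at hx ⊢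
    exact hx.le
  refine (measure_mono hsub).trans ?_
  rw [← ofReal_measureReal]
  refine ENNReal.ofReal_le_ofReal ?_
  rw [le_div_iff₀ (by positivity)]
  have : t * P.real {x | t ≤ F x} ≤ B / n := hmark.trans hF
  rw [le_div_iff₀ hn'] at this
  linarith

/-- The events `E n` fail with probability at most `δ` for all large sample sizes `n`. -/
def EventuallyProb (δ : ℝ) (E : ∀ n : ℕ, Set (Fin n → Ω)) : Prop :=
  ∀ᶠ n : ℕ in Filter.atTop, (Measure.pi fun _ : Fin n => ρ) (E n)ᶜ ≤ ENNReal.ofReal δ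

/-- The events `E n` hold with probability tending to one. -/
def HighProb (E : ∀ n : ℕ, Set (Fin n → Ω)) : Prop := ∀ δ : ℝ, 0 < δ → EventuallyProb ρ δ E

variable {ρ}

lemma EventuallyProb.inter {δ₁ δ₂ : ℝ} (h₁ : 0 ≤ δ₁) (h₂ : 0 ≤ δ₂)
    {E F : ∀ n : ℕ, Set (Fin n → Ω)} (hE : EventuallyProb ρ δ₁ E) (hF : EventuallyProb ρ δ₂ F) :
    EventuallyProb ρ (δ₁ + δ₂) (fun n => E n ∩ F n) := by
  filter_upwards [hE, hF] with n h1 h2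
  rw [Set.compl_inter, ENNReal.ofReal_add h₁ h₂]
  exact (measure_union_le _ _).trans (add_le_add h1 h2)

lemma EventuallyProb.mono {δ : ℝ} {E F : ∀ n : ℕ, Set (Fin n → Ω)} (hE : EventuallyProb ρ δ E)
    (h : ∀ᶠ n in Filter.atTop, E n ⊆ F n) : EventuallyProb ρ δ F := by
  filter_upwards [hE, h] with n h1 h2
  exact (measure_mono (Set.compl_subset_compl.2 h2)).trans h1

lemma HighProb.inter {E F : ∀ n : ℕ, Set (Fin n → Ω)} (hE : HighProb ρ E) (hF : HighProb ρ F) :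
    HighProb ρ (fun n => E n ∩ F n) := fun δ hδ => by
  have := (hE (δ / 2) (by linarith)).inter (by linarith) (by linarith) (hF (δ / 2) (by linarith))
  rwa [add_halves] at this

lemma HighProb.mono {E F : ∀ n : ℕ, Set (Fin n → Ω)} (hE : HighProb ρ E)
    (h : ∀ᶠ n in Filter.atTop, E n ⊆ F n) : HighProb ρ F := fun δ hδ => (hE δ hδ).mono h

lemma eventuallyProb_fluctuation [IsProbabilityMeasure ρ] {ι : Type*} {s : ℕ → Finset ι} {η : ℕ → ι → ℝ}
    (hη : ∀ n, ∀ p ∈ s n, 0 ≤ η n p) {a : ℕ → ι → Ω → ℝ} (ha : ∀ n p, Measurable (a n p))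
    (hb : ∀ n p, ∃ K, ∀ z, |a n p z| ≤ K) {t : ℕ → ℝ} {δ : ℝ}
    (hB : ∀ᶠ n in Filter.atTop, ∑ p ∈ s n, η n p * ∫ z, a n p z ^ 2 ∂ρ ≤ δ * (n * t n))
    (ht : ∀ᶠ n in Filter.atTop, 0 < t n) :
    EventuallyProb ρ δ (fun n =>
      {x | ∑ p ∈ s n, η n p * (empMean (a n p) x - ∫ z, a n p z ∂ρ) ^ 2 ≤ t n}) := by
  filter_upwards [hB, ht, Filter.eventually_ge_atTop 1] with n h1 h2 h3
  have hn : (0 : ℝ) < n := by exact_mod_cast h3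
  refine (measure_compl_fluctuation_le ρ (by omega) (s n) (hη n) (ha n) (hb n) h2 h1).trans
    (ENNReal.ofReal_le_ofReal ?_)
  rw [mul_div_assoc, div_self (by positivity), mul_one]

lemma highProb_fluctuation [IsProbabilityMeasure ρ] {ι : Type*} {s : ℕ → Finset ι} {η : ℕ → ι → ℝ}
    (hη : ∀ n, ∀ p ∈ s n, 0 ≤ η n p) {a : ℕ → ι → Ω → ℝ} (ha : ∀ n p, Measurable (a n p))
    (hb : ∀ n p, ∃ K, ∀ z, |a n p z| ≤ K) {g t : ℕ → ℝ}
    (hB : ∀ᶠ n in Filter.atTop, ∑ p ∈ s n, η n p * ∫ z, a n p z ^ 2 ∂ρ ≤ g n * (n * t n))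
    (ht : ∀ᶠ n in Filter.atTop, 0 < t n) (hg : Filter.Tendsto g Filter.atTop (nhds 0)) :
    HighProb ρ (fun n =>
      {x | ∑ p ∈ s n, η n p * (empMean (a n p) x - ∫ z, a n p z ∂ρ) ^ 2 ≤ t n}) :=
  fun δ hδ => eventuallyProb_fluctuation hη ha hb (by
    filter_upwards [hB, ht, hg.eventually_le_const hδ] with n h1 h2 h3
    refine h1.trans ?_
    gcongr) ht

lemma highProb_fluctuation_single [IsProbabilityMeasure ρ] {a : ℕ → Ω → ℝ} (ha : ∀ n, Measurable (a n))
    (hb : ∀ n, ∃ K, ∀ z, |a n z| ≤ K) {g t : ℕ → ℝ}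
    (hB : ∀ᶠ n in Filter.atTop, ∫ z, a n z ^ 2 ∂ρ ≤ g n * (n * t n ^ 2))
    (ht : ∀ᶠ n in Filter.atTop, 0 < t n) (hg : Filter.Tendsto g Filter.atTop (nhds 0)) :
    HighProb ρ (fun n => {x | |empMean (a n) x - ∫ z, a n z ∂ρ| ≤ t n}) := by
  have h := highProb_fluctuation (ρ := ρ) (s := fun _ => {()}) (η := fun _ _ => 1)
    (fun _ _ _ => zero_le_one) (a := fun n _ => a n) (fun n _ => ha n) (fun n _ => hb n)
    (g := g) (t := fun n => t n ^ 2) (by simpa using hB)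
    (ht.mono fun n h => pow_pos h 2) hg
  refine h.mono (ht.mono fun n hn x hx => ?_)
  simp only [Finset.sum_singleton, one_mul, Set.mem_ofPred_eq] at hx ⊢
  exact abs_le_of_sq_le_sq hx hn.le

end Empirical
/-! ### Power sums -/

section PowerSums

lemma sum_Icc_le_add_Ioc {f : ℕ → ℝ} (hf : ∀ p, 0 ≤ f p) (P R : ℕ) :
    ∑ p ∈ Finset.Icc 1 R, f p ≤ ∑ p ∈ Finset.Icc 1 P, f p + ∑ p ∈ Finset.Ioc P R, f p := by
  classical
  rw [← Finset.sum_union]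
  · refine Finset.sum_le_sum_of_subset_of_nonneg (fun p hp => ?_) fun p _ _ => hf p
    simp only [Finset.mem_Icc, Finset.mem_union, Finset.mem_Ioc] at hp ⊢
    omega
  · rw [Finset.disjoint_left]
    intro p hp hp'
    simp only [Finset.mem_Icc, Finset.mem_Ioc] at hp hp'
    omega

lemma min_mul_rpow_neg_le_sub {s : ℝ} (hs : s < 1) (p : ℕ) :
    min 1 (1 - s) * ((p + 1 : ℕ) : ℝ) ^ (-s) ≤
      ((p + 1 : ℕ) : ℝ) ^ (1 - s) - (p : ℝ) ^ (1 - s) := by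
  set q : ℝ := ((p + 1 : ℕ) : ℝ) with hq
  have hqp : 0 < q := by positivity
  have hq1 : 1 ≤ q := by rw [hq]; push_cast; linarith [(Nat.cast_nonneg p : (0:ℝ) ≤ p)]
  have hp : (p : ℝ) = q * (1 + -(1 / q)) := by rw [hq]; field_simp; push_cast; ring
  have hy1 : 1 / q ≤ 1 := by rw [div_le_one hqp]; exact hq1
  have hy0 : 0 ≤ 1 / q := by positivity
  have hkey : (1 + -(1 / q)) ^ (1 - s) ≤ 1 - min 1 (1 - s) * (1 / q) := by
    rcases le_total (1 - s) 1 with h | h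
    · rw [min_eq_right h]
      have := rpow_one_add_le_one_add_mul_self (s := -(1 / q)) (by linarith) (p := 1 - s)
        (by linarith) h
      linarith
    · rw [min_eq_left h]
      have := Real.rpow_le_rpow_of_exponent_ge' (x := 1 + -(1 / q)) (by linarith) (by linarith)
        zero_le_one h
      rw [Real.rpow_one] at this
      linarith
  rw [hp, Real.mul_rpow hqp.le (by linarith)]
  have h3 : q ^ (-s) = q ^ (1 - s) * (1 / q) := by
    rw [← Real.rpow_neg_one q |>.trans (one_div q).symm, ← Real.rpow_add hqp]
    congr 1; ring
  rw [h3]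
  nlinarith [mul_le_mul_of_nonneg_left hkey (Real.rpow_nonneg hqp.le (1 - s))]

lemma exists_sum_rpow_neg_le {s : ℝ} (hs : s < 1) :
    ∃ C : ℝ, 0 < C ∧ ∀ P : ℕ, ∑ p ∈ Finset.Icc 1 P, (p : ℝ) ^ (-s) ≤ C * (P : ℝ) ^ (1 - s) := by
  have hc : 0 < min 1 (1 - s) := lt_min one_pos (by linarith)
  refine ⟨(min 1 (1 - s))⁻¹, by positivity, fun P => ?_⟩
  rw [inv_mul_eq_div, le_div_iff₀ hc, mul_comm]
  induction P with
  | zero => simp [Real.zero_rpow (by linarith : 1 - s ≠ 0)]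
  | succ P ih =>
    rw [Finset.sum_Icc_succ_top (by omega), mul_add]
    linarith [min_mul_rpow_neg_le_sub hs P]

lemma sub_one_mul_rpow_neg_le {s : ℝ} (hs : 1 < s) {p : ℕ} (hp1 : 1 ≤ p) :
    (s - 1) * ((p + 1 : ℕ) : ℝ) ^ (-s) ≤
      (p : ℝ) ^ (1 - s) - ((p + 1 : ℕ) : ℝ) ^ (1 - s) := by
  set q : ℝ := ((p + 1 : ℕ) : ℝ) with hq
  have hqp : 0 < q := by positivity
  have hp0 : (0 : ℝ) < p := by exact_mod_cast hp1
  have hp : (p : ℝ) = q * (1 - 1 / q) := by rw [hq]; field_simp; push_cast; ring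
  have hy1 : 0 < 1 - 1 / q := by
    rw [hp] at hp0
    exact pos_of_mul_pos_right hp0 hqp.le
  have hkey : 1 + (s - 1) * (1 / q) ≤ (1 - 1 / q) ^ (1 - s) := by
    have h1 : Real.log (1 - 1 / q) ≤ -(1 / q) := by
      linarith [Real.log_le_sub_one_of_pos hy1]
    rw [Real.rpow_def_of_pos hy1]
    have h2 := Real.add_one_le_exp (Real.log (1 - 1 / q) * (1 - s))
    nlinarith
  rw [hp, Real.mul_rpow hqp.le hy1.le]
  have h3 : q ^ (-s) = q ^ (1 - s) * (1 / q) := by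
    rw [← Real.rpow_neg_one q |>.trans (one_div q).symm, ← Real.rpow_add hqp]
    congr 1; ring
  rw [h3]
  nlinarith [mul_le_mul_of_nonneg_left hkey (Real.rpow_nonneg hqp.le (1 - s))]

lemma sum_Ioc_rpow_neg_le {s : ℝ} (hs : 1 < s) {P : ℕ} (hP : 1 ≤ P) (R : ℕ) :
    ∑ p ∈ Finset.Ioc P R, (p : ℝ) ^ (-s) ≤ (s - 1)⁻¹ * (P : ℝ) ^ (1 - s) := by
  have hs' : 0 < s - 1 := by linarith
  have hP' : (0 : ℝ) ≤ (P : ℝ) ^ (1 - s) := by positivity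
  rcases le_total R P with h | h
  · rw [Finset.Ioc_eq_empty (by omega), Finset.sum_empty]
    positivity
  · have key : (s - 1) * ∑ p ∈ Finset.Ioc P R, (p : ℝ) ^ (-s) ≤
        (P : ℝ) ^ (1 - s) - (R : ℝ) ^ (1 - s) := by
      induction R, h using Nat.le_induction with
      | base => simp
      | succ R hR ih =>
        rw [Finset.sum_Ioc_succ_top hR, mul_add]
        linarith [sub_one_mul_rpow_neg_le hs (hP.trans hR)]
    rw [inv_mul_eq_div, le_div_iff₀ hs', mul_comm]
    have : (0 : ℝ) ≤ (R : ℝ) ^ (1 - s) := by positivity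
    linarith

lemma exists_sum_rpow_neg_le_const {s : ℝ} (hs : 1 < s) :
    ∃ C : ℝ, 0 < C ∧ ∀ P : ℕ, ∑ p ∈ Finset.Icc 1 P, (p : ℝ) ^ (-s) ≤ C := by
  have hsum : Summable fun p : ℕ => (p : ℝ) ^ (-s) := Real.summable_nat_rpow.2 (by linarith)
  have h0 : 0 ≤ ∑' p : ℕ, (p : ℝ) ^ (-s) := tsum_nonneg fun p => by positivity
  exact ⟨∑' p : ℕ, (p : ℝ) ^ (-s) + 1, by linarith, fun P =>
    (hsum.sum_le_tsum _ fun p _ => by positivity).trans (by linarith)⟩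

lemma exists_sum_Ioc_rpow_neg_le {s : ℝ} (hs : 1 < s) {ε : ℝ} (hε : 0 < ε) :
    ∃ L : ℕ, 1 ≤ L ∧ ∀ R : ℕ, ∑ p ∈ Finset.Ioc L R, (p : ℝ) ^ (-s) ≤ ε := by
  have h1 : Filter.Tendsto (fun L : ℕ => (s - 1)⁻¹ * (L : ℝ) ^ (1 - s)) Filter.atTop
      (nhds ((s - 1)⁻¹ * 0)) := by
    refine Filter.Tendsto.const_mul _ ?_
    have := (tendsto_rpow_neg_atTop (y := s - 1) (by linarith)).comp
      (tendsto_natCast_atTop_atTop (R := ℝ))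
    simpa [Function.comp_def] using this
  rw [mul_zero] at h1
  obtain ⟨L, hL, hL1⟩ := ((h1.eventually_le_const hε).and (Filter.eventually_ge_atTop 1)).exists
  exact ⟨L, hL1, fun R => (sum_Ioc_rpow_neg_le hs hL1 R).trans hL⟩

lemma log_one_add_le_rpow {x s : ℝ} (hx : 0 ≤ x) (hs0 : 0 < s) (hs1 : s ≤ 1) :
    Real.log (1 + x) ≤ x ^ s / s := by
  have h1 : (1 + x) ^ s ≤ 1 + x ^ s := by
    simpa using Real.rpow_add_le_add_rpow zero_le_one hx hs0.le hs1
  have h2 : s * Real.log (1 + x) ≤ x ^ s := by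
    rw [← Real.log_rpow (by linarith)]
    have := Real.log_le_sub_one_of_pos (x := (1 + x) ^ s) (by positivity)
    linarith
  rw [le_div_iff₀ hs0]
  linarith

lemma exists_sum_log_le {α C : ℝ} (hα : 1 < α) (hC : 0 < C) :
    ∃ C' : ℝ, 0 < C' ∧ ∀ N : ℝ, 1 ≤ N → ∀ R : ℕ,
      ∑ p ∈ Finset.Icc 1 R, Real.log (1 + C * N ^ α * (p : ℝ) ^ (-α)) ≤ C' * N := by
  obtain ⟨K, hK0, hK⟩ := exists_sum_rpow_neg_le (s := 1 / 2) (by norm_num)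
  set s : ℝ := 1 / (2 * α) with hs
  have hs0 : 0 < s := by positivity
  have hs1 : s ≤ 1 := by rw [hs, div_le_one (by positivity)]; linarith
  have hαs : α * s = 1 / 2 := by rw [hs]; field_simp
  have hα1 : 0 < α - 1 := by linarith
  refine ⟨C ^ s / s * K * 2 + C * (α - 1)⁻¹, by positivity, fun N hN R => ?_⟩
  have hN0 : 0 < N := by linarith
  set P := ⌈N⌉₊ with hP
  have hPN : N ≤ P := Nat.le_ceil N
  have hPN2 : (P : ℝ) ≤ 2 * N := by
    have := Nat.ceil_lt_add_one hN0.le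
    linarith
  have hP1 : 1 ≤ P := Nat.one_le_ceil_iff.2 hN0
  have h1 : ∑ p ∈ Finset.Icc 1 P, Real.log (1 + C * N ^ α * (p : ℝ) ^ (-α)) ≤
      C ^ s / s * K * 2 * N := by
    calc ∑ p ∈ Finset.Icc 1 P, Real.log (1 + C * N ^ α * (p : ℝ) ^ (-α))
        ≤ ∑ p ∈ Finset.Icc 1 P, C ^ s / s * N ^ (1 / 2 : ℝ) * (p : ℝ) ^ (-(1 / 2) : ℝ) := by
          refine Finset.sum_le_sum fun p _ => ?_
          refine (log_one_add_le_rpow (by positivity) hs0 hs1).trans (le_of_eq ?_)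
          rw [Real.mul_rpow (by positivity) (by positivity), Real.mul_rpow hC.le (by positivity),
            ← Real.rpow_mul hN0.le, ← Real.rpow_mul (Nat.cast_nonneg p), neg_mul, hαs]
          ring
      _ ≤ C ^ s / s * N ^ (1 / 2 : ℝ) * (K * (P : ℝ) ^ (1 - 1 / 2 : ℝ)) := by
          rw [← Finset.mul_sum]
          exact mul_le_mul_of_nonneg_left (hK P) (by positivity)
      _ ≤ C ^ s / s * (2 * N) ^ (1 / 2 : ℝ) * (K * (2 * N) ^ (1 / 2 : ℝ)) := by
          norm_num only
          gcongr
          linarith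
      _ = C ^ s / s * K * ((2 * N) ^ (1 / 2 : ℝ) * (2 * N) ^ (1 / 2 : ℝ)) := by ring
      _ = C ^ s / s * K * 2 * N := by
          rw [← Real.rpow_add (by positivity)]; norm_num; ring
  have h2 : ∑ p ∈ Finset.Ioc P R, Real.log (1 + C * N ^ α * (p : ℝ) ^ (-α)) ≤
      C * (α - 1)⁻¹ * N := by
    calc ∑ p ∈ Finset.Ioc P R, Real.log (1 + C * N ^ α * (p : ℝ) ^ (-α))
        ≤ ∑ p ∈ Finset.Ioc P R, C * N ^ α * (p : ℝ) ^ (-α) := by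
          refine Finset.sum_le_sum fun p _ => ?_
          have h0 : 0 ≤ C * N ^ α * (p : ℝ) ^ (-α) := by positivity
          linarith [Real.log_le_sub_one_of_pos (x := 1 + C * N ^ α * (p : ℝ) ^ (-α)) (by linarith)]
      _ ≤ C * N ^ α * ((α - 1)⁻¹ * (P : ℝ) ^ (1 - α)) := by
          rw [← Finset.mul_sum]
          exact mul_le_mul_of_nonneg_left (sum_Ioc_rpow_neg_le hα hP1 R) (by positivity)
      _ ≤ C * N ^ α * ((α - 1)⁻¹ * N ^ (1 - α)) := by
          gcongr C * N ^ α * ((α - 1)⁻¹ * ?_)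
          exact Real.rpow_le_rpow_of_nonpos hN0 hPN (by linarith)
      _ = C * (α - 1)⁻¹ * (N ^ α * N ^ (1 - α)) := by ring
      _ = C * (α - 1)⁻¹ * N := by rw [← Real.rpow_add hN0]; norm_num
  refine (sum_Icc_le_add_Ioc (fun p => Real.log_nonneg ?_) P R).trans ?_
  · have h0 : 0 ≤ C * N ^ α * (p : ℝ) ^ (-α) := by positivity
    linarith
  · linarith

end PowerSums

/-! ### Orthonormal systems with polynomially growing sup norms -/

section Orthonormal

variable {Ω : Type*} [MeasurableSpace Ω]

/-- Bounded measurable real functions. -/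
def BddMeas (a : Ω → ℝ) : Prop := Measurable a ∧ ∃ K, ∀ z, |a z| ≤ K

lemma BddMeas.const (c : ℝ) : BddMeas (fun _ : Ω => c) :=
  ⟨measurable_const, |c|, fun _ => le_rfl⟩

lemma BddMeas.mul {a b : Ω → ℝ} (ha : BddMeas a) (hb : BddMeas b) :
    BddMeas (fun z => a z * b z) := by
  obtain ⟨ha, K, hK⟩ := ha
  obtain ⟨hb, L, hL⟩ := hb
  refine ⟨ha.mul hb, K * L, fun z => ?_⟩
  rw [abs_mul]
  exact mul_le_mul (hK z) (hL z) (abs_nonneg _) ((abs_nonneg _).trans (hK z))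

lemma BddMeas.sq {a : Ω → ℝ} (ha : BddMeas a) : BddMeas (fun z => a z ^ 2) := by
  simpa only [_root_.sq] using ha.mul ha

lemma BddMeas.const_mul {a : Ω → ℝ} (ha : BddMeas a) (c : ℝ) : BddMeas (fun z => c * a z) :=
  (BddMeas.const c).mul ha

lemma BddMeas.add {a b : Ω → ℝ} (ha : BddMeas a) (hb : BddMeas b) :
    BddMeas (fun z => a z + b z) := by
  obtain ⟨ha, K, hK⟩ := ha
  obtain ⟨hb, L, hL⟩ := hb
  exact ⟨ha.add hb, K + L, fun z => (abs_add_le _ _).trans (add_le_add (hK z) (hL z))⟩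

lemma BddMeas.sum {ι : Type*} (s : Finset ι) {a : ι → Ω → ℝ} (ha : ∀ p, BddMeas (a p)) :
    BddMeas (fun z => ∑ p ∈ s, a p z) := by
  classical
  induction s using Finset.induction_on with
  | empty => simpa using BddMeas.const (Ω := Ω) 0
  | insert p s hp ih =>
    simp only [Finset.sum_insert hp]
    exact (ha p).add ih

lemma BddMeas.integrable {a : Ω → ℝ} (ha : BddMeas a) (ρ : Measure Ω) [IsProbabilityMeasure ρ] :
    Integrable a ρ := integrable_of_abs_le ρ ha.1 ha.2

lemma integral_le_of_le {ρ : Measure Ω} [IsProbabilityMeasure ρ] {a b : Ω → ℝ} (ha : BddMeas a)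
    (hb : BddMeas b) (h : ∀ z, a z ≤ b z) : ∫ z, a z ∂ρ ≤ ∫ z, b z ∂ρ :=
  integral_mono (ha.integrable ρ) (hb.integrable ρ) h

lemma integral_mul_sq_le {ρ : Measure Ω} [IsProbabilityMeasure ρ] {a b : Ω → ℝ} {K : ℝ}
    (ha : BddMeas a) (hb : BddMeas b) (h : ∀ z, |a z| ≤ K) :
    ∫ z, (a z * b z) ^ 2 ∂ρ ≤ K ^ 2 * ∫ z, b z ^ 2 ∂ρ := by
  rw [← integral_const_mul]
  refine integral_le_of_le (ha.mul hb).sq (hb.sq.const_mul _) fun z => ?_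
  rw [mul_pow]
  exact mul_le_mul_of_nonneg_right (sq_le_sq' (abs_le.1 (h z)).1 (abs_le.1 (h z)).2) (sq_nonneg _)

/-- The linear combination `∑ p ∈ s, w p • φ p`. -/
noncomputable def lincomb (φ : ℕ → Ω → ℝ) (s : Finset ℕ) (w : ℕ → ℝ) (z : Ω) : ℝ :=
  ∑ p ∈ s, w p * φ p z

/-- Orthonormal families whose `p`-th member is bounded by `Cφ * p ^ τ`. -/
structure OrthoSystem (ρ : Measure Ω) (φ : ℕ → Ω → ℝ) (Cφ τ : ℝ) : Prop where
  meas : ∀ p, Measurable (φ p)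
  orth : ∀ p q, ∫ z, φ p z * φ q z ∂ρ = if p = q then 1 else 0
  bound_zero : ∀ z, |φ 0 z| ≤ Cφ
  bound : ∀ p : ℕ, 1 ≤ p → ∀ z, |φ p z| ≤ Cφ * (p : ℝ) ^ τ
  const_pos : 0 < Cφ
  exponent_pos : 0 < τ

namespace OrthoSystem

variable {ρ : Measure Ω} {φ : ℕ → Ω → ℝ} {Cφ τ : ℝ}

lemma bddMeas (H : OrthoSystem ρ φ Cφ τ) (p : ℕ) : BddMeas (φ p) := by
  refine ⟨H.meas p, ?_⟩
  rcases Nat.eq_zero_or_pos p with rfl | hp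
  · exact ⟨_, H.bound_zero⟩
  · exact ⟨_, H.bound p hp⟩

lemma bddMeas_lincomb (H : OrthoSystem ρ φ Cφ τ) (s : Finset ℕ) (w : ℕ → ℝ) :
    BddMeas (lincomb φ s w) :=
  BddMeas.sum s fun p => (H.bddMeas p).const_mul (w p)

lemma integral_sq (H : OrthoSystem ρ φ Cφ τ) (p : ℕ) : ∫ z, φ p z ^ 2 ∂ρ = 1 := by
  simpa [_root_.sq] using H.orth p p

lemma integral_mul_lincomb [IsProbabilityMeasure ρ] (H : OrthoSystem ρ φ Cφ τ) (q : ℕ) (s : Finset ℕ) (w : ℕ → ℝ) :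
    ∫ z, φ q z * lincomb φ s w z ∂ρ = if q ∈ s then w q else 0 := by
  have : ∀ z, φ q z * lincomb φ s w z = ∑ p ∈ s, w p * (φ q z * φ p z) := fun z => by
    rw [lincomb, Finset.mul_sum]
    exact Finset.sum_congr rfl fun p _ => by ring
  simp only [this]
  rw [integral_finsetSum _ fun p _ =>
    (((H.bddMeas q).mul (H.bddMeas p)).const_mul _).integrable ρ]
  simp [integral_const_mul, H.orth]

lemma integral_lincomb_mul_lincomb [IsProbabilityMeasure ρ] (H : OrthoSystem ρ φ Cφ τ) {s t : Finset ℕ} (hts : t ⊆ s)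
    (v w : ℕ → ℝ) :
    ∫ z, lincomb φ s v z * lincomb φ t w z ∂ρ = ∑ p ∈ t, v p * w p := by
  have : ∀ z, lincomb φ s v z * lincomb φ t w z = ∑ p ∈ t, w p * (φ p z * lincomb φ s v z) :=
    fun z => by
      rw [lincomb.eq_1 φ t, Finset.mul_sum]
      exact Finset.sum_congr rfl fun p _ => by ring
  simp only [this]
  rw [integral_finsetSum _ fun p _ =>
    (((H.bddMeas p).mul (H.bddMeas_lincomb s v)).const_mul _).integrable ρ]
  refine Finset.sum_congr rfl fun p hp => ?_
  rw [integral_const_mul, H.integral_mul_lincomb, if_pos (hts hp), mul_comm]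

lemma integral_lincomb_sq [IsProbabilityMeasure ρ] (H : OrthoSystem ρ φ Cφ τ) (s : Finset ℕ) (w : ℕ → ℝ) :
    ∫ z, lincomb φ s w z ^ 2 ∂ρ = ∑ p ∈ s, w p ^ 2 := by
  simpa [_root_.sq] using H.integral_lincomb_mul_lincomb (Finset.Subset.refl s) w w

lemma abs_lincomb_le (H : OrthoSystem ρ φ Cφ τ) {s : Finset ℕ} (hs : ∀ p ∈ s, 1 ≤ p)
    {w : ℕ → ℝ} {D e : ℝ} (hw : ∀ p ∈ s, |w p| ≤ D * (p : ℝ) ^ e) (z : Ω) :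
    |lincomb φ s w z| ≤ Cφ * D * ∑ p ∈ s, (p : ℝ) ^ (e + τ) := by
  rw [lincomb, Finset.mul_sum]
  refine (Finset.abs_sum_le_sum_abs _ _).trans (Finset.sum_le_sum fun p hp => ?_)
  have hp0 : (0 : ℝ) < p := by exact_mod_cast hs p hp
  rw [abs_mul, Real.rpow_add hp0]
  calc |w p| * |φ p z| ≤ (D * (p : ℝ) ^ e) * (Cφ * (p : ℝ) ^ τ) :=
        mul_le_mul (hw p hp) (H.bound p (hs p hp) z) (abs_nonneg _) ((abs_nonneg _).trans (hw p hp))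
    _ = _ := by ring

lemma integral_mul_sq_le [IsProbabilityMeasure ρ] (H : OrthoSystem ρ φ Cφ τ) {p : ℕ} (hp : 1 ≤ p) {h : Ω → ℝ}
    (hh : BddMeas h) :
    ∫ z, (φ p z * h z) ^ 2 ∂ρ ≤ Cφ ^ 2 * (p : ℝ) ^ (2 * τ) * ∫ z, h z ^ 2 ∂ρ := by
  refine (_root_.integral_mul_sq_le (H.bddMeas p) hh (H.bound p hp)).trans_eq ?_
  rw [mul_pow, ← Real.rpow_natCast, ← Real.rpow_natCast, ← Real.rpow_mul (Nat.cast_nonneg p)]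
  norm_num [mul_comm]

end OrthoSystem

end Orthonormal

/-! ### The truncated terms as regularized sums of rank-one matrices -/

section Features

variable {Ω : Type*}

/-- The values of the feature `φ p` at the sample points. -/
def feat (φ : ℕ → Ω → ℝ) {n : ℕ} (x : Fin n → Ω) (p : ℕ) : Fin n → ℝ := fun i => φ p (x i)

lemma one_add_smul_KR (lam : ℕ → ℝ) (φ : ℕ → Ω → ℝ) {n : ℕ} (x : Fin n → Ω) (R : ℕ) (s2 : ℝ) :
    1 + s2⁻¹ • KR lam φ x R =
      regGram (Finset.Icc 1 R) (fun p => lam p / s2) (feat φ x) := by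
  rw [regGram]
  congr 1
  ext i j
  have h0 : ∀ k ∈ Finset.range (R + 1), k ∉ Finset.Icc 1 R →
      (φ k (x i) * (if k = 0 then 0 else lam k) * φ k (x j)) = 0 := by
    intro k hk hk'
    have : k = 0 := by
      simp only [Finset.mem_range, Finset.mem_Icc] at hk hk'
      omega
    simp [this]
  have h1 : KR lam φ x R i j =
      ∑ k ∈ Finset.Icc 1 R, (φ k (x i) * (if k = 0 then 0 else lam k) * φ k (x j)) := by
    rw [Finset.sum_subset (fun k hk => by
      simp only [Finset.mem_range, Finset.mem_Icc] at hk ⊢; omega) h0, Finset.sum_range]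
    simp [KR, Matrix.mul_apply, PhiR, lamR, Matrix.diagonal_apply]
  rw [Matrix.smul_apply, h1, Matrix.sum_apply, smul_eq_mul, Finset.mul_sum]
  refine Finset.sum_congr rfl fun k hk => ?_
  have : k ≠ 0 := by
    have := (Finset.mem_Icc.1 hk).1
    omega
  simp only [this, if_false, Matrix.smul_apply, vecMulVec_apply, feat, smul_eq_mul]
  ring

lemma feat_dotProduct_feat (φ : ℕ → Ω → ℝ) {n : ℕ} (hn : n ≠ 0) (x : Fin n → Ω) (p q : ℕ) :
    feat φ x p ⬝ᵥ feat φ x q = n * empMean (fun z => φ p z * φ q z) x := by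
  rw [← sum_eq_mul_empMean hn]
  rfl

end Features

/-! ### The noise term -/

section NoiseTerm

/-- Sequences of order `p ^ (-α)`. -/
structure PowerDecay (η : ℕ → ℝ) (c₁ c₂ α : ℝ) : Prop where
  const_pos : 0 < c₁
  lower : ∀ p : ℕ, 1 ≤ p → c₁ * (p : ℝ) ^ (-α) ≤ η p
  upper : ∀ p : ℕ, 1 ≤ p → η p ≤ c₂ * (p : ℝ) ^ (-α)

namespace PowerDecay

variable {η : ℕ → ℝ} {c₁ c₂ α : ℝ}

lemma pos (h : PowerDecay η c₁ c₂ α) {p : ℕ} (hp : 1 ≤ p) : 0 < η p := by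
  have hp0 : (0 : ℝ) < p := by exact_mod_cast hp
  exact (mul_pos h.const_pos (Real.rpow_pos_of_pos hp0 _)).trans_le (h.lower p hp)

lemma const_pos' (h : PowerDecay η c₁ c₂ α) : 0 < c₂ := by
  have := (h.pos le_rfl).trans_le (h.upper 1 le_rfl)
  simpa using this

lemma mul_rpow_le (h : PowerDecay η c₁ c₂ α) (e : ℝ) {p : ℕ} (hp : 1 ≤ p) :
    η p * (p : ℝ) ^ e ≤ c₂ * (p : ℝ) ^ (-(α - e)) := by
  have hp0 : (0 : ℝ) < p := by exact_mod_cast hp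
  have : (p : ℝ) ^ (-(α - e)) = (p : ℝ) ^ (-α) * (p : ℝ) ^ e := by
    rw [← Real.rpow_add hp0]; ring_nf
  rw [this, ← mul_assoc]
  exact mul_le_mul_of_nonneg_right (h.upper p hp) (Real.rpow_nonneg hp0.le _)

lemma exists_sum_mul_rpow_le (h : PowerDecay η c₁ c₂ α) {e : ℝ} (he : 1 < α - e) :
    ∃ K : ℝ, 0 < K ∧ ∀ R : ℕ, ∑ p ∈ Finset.Icc 1 R, η p * (p : ℝ) ^ e ≤ K := by
  obtain ⟨K, hK, hsum⟩ := exists_sum_rpow_neg_le_const he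
  refine ⟨c₂ * K, mul_pos h.const_pos' hK, fun R => ?_⟩
  calc ∑ p ∈ Finset.Icc 1 R, η p * (p : ℝ) ^ e
      ≤ ∑ p ∈ Finset.Icc 1 R, c₂ * (p : ℝ) ^ (-(α - e)) :=
        Finset.sum_le_sum fun p hp => h.mul_rpow_le e (Finset.mem_Icc.1 hp).1
    _ ≤ c₂ * K := by
        rw [← Finset.mul_sum]
        exact mul_le_mul_of_nonneg_left (hsum R) h.const_pos'.le

end PowerDecay

lemma log_one_add_mul_le {d g : ℝ} (hd : 0 ≤ d) (hg : 0 ≤ g) :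
    Real.log (1 + d * g) ≤ Real.log (1 + d) + d / (1 + d) * g := by
  have h1 : 1 + d * g ≤ (1 + d) * (1 + d / (1 + d) * g) := by
    field_simp
    nlinarith
  have h2 : 0 ≤ d / (1 + d) * g := by positivity
  calc Real.log (1 + d * g) ≤ Real.log ((1 + d) * (1 + d / (1 + d) * g)) :=
        Real.log_le_log (by positivity) h1
    _ = Real.log (1 + d) + Real.log (1 + d / (1 + d) * g) :=
        Real.log_mul (by positivity) (by positivity)
    _ ≤ _ := by
        have := Real.log_le_sub_one_of_pos (show 0 < 1 + d / (1 + d) * g by positivity)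
        linarith

lemma div_one_add_le_log {d : ℝ} (hd : 0 ≤ d) : d / (1 + d) ≤ Real.log (1 + d) := by
  have := Real.one_sub_inv_le_log_of_pos (show 0 < 1 + d by positivity)
  refine le_trans (le_of_eq ?_) this
  field_simp
  ring

variable {Ω : Type*} [MeasurableSpace Ω] {ρ : Measure Ω} [IsProbabilityMeasure ρ]
  {φ : ℕ → Ω → ℝ} {Cφ τ α c₁ c₂ : ℝ} {η : ℕ → ℝ}

lemma natCast_rpow_inv_rpow (n : ℕ) {α : ℝ} (hα : α ≠ 0) : ((n : ℝ) ^ (1 / α)) ^ α = n := by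
  rw [← Real.rpow_mul (Nat.cast_nonneg n), one_div_mul_cancel hα, Real.rpow_one]

lemma tendsto_natCast_rpow {e : ℝ} (he : 0 < e) :
    Filter.Tendsto (fun n : ℕ => (n : ℝ) ^ e) Filter.atTop Filter.atTop :=
  (tendsto_rpow_atTop he).comp tendsto_natCast_atTop_atTop

lemma tendsto_natCast_rpow_neg {e : ℝ} (he : e < 0) :
    Filter.Tendsto (fun n : ℕ => (n : ℝ) ^ e) Filter.atTop (nhds 0) := by
  have := (tendsto_rpow_neg_atTop (neg_pos.2 he)).comp
    (tendsto_natCast_atTop_atTop (R := ℝ))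
  simpa only [Function.comp_def, neg_neg] using this

theorem exists_highProb_log_det_le (H : OrthoSystem ρ φ Cφ τ) (hα : 1 < α)
    (hτ : τ < (α - 1) / 2) (hη : PowerDecay η c₁ c₂ α) (R : ℕ → ℕ) :
    ∃ C : ℝ, 0 < C ∧ HighProb ρ (fun n => {x |
      Real.log (regGram (Finset.Icc 1 (R n)) η (feat φ x)).det ≤ C * (n : ℝ) ^ (1 / α)}) := by
  have hα0 : α ≠ 0 := by positivity
  obtain ⟨C, hC, hlog⟩ := exists_sum_log_le hα hη.const_pos'
  obtain ⟨K, hK, hsum⟩ := hη.exists_sum_mul_rpow_le (e := 2 * τ) (by linarith)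
  set v : ℕ → ℕ → ℝ := fun n p => n * η p / (1 + n * η p)
  set a : ℕ → Ω → ℝ := fun n z => ∑ p ∈ Finset.Icc 1 (R n), v n p * φ p z ^ 2
  have hd : ∀ n : ℕ, ∀ p ∈ Finset.Icc 1 (R n), 0 ≤ n * η p := fun n p hp =>
    mul_nonneg (Nat.cast_nonneg n) (hη.pos (Finset.mem_Icc.1 hp).1).le
  have hv : ∀ n : ℕ, ∀ p ∈ Finset.Icc 1 (R n), 0 ≤ v n p := fun n p hp =>
    div_nonneg (hd n p hp) (by linarith [hd n p hp])
  have ha : ∀ n, BddMeas (a n) := fun n =>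
    BddMeas.sum _ fun p => (H.bddMeas p).sq.const_mul _
  have ha0 : ∀ n z, 0 ≤ a n z := fun n z =>
    Finset.sum_nonneg fun p hp => mul_nonneg (hv n p hp) (sq_nonneg _)
  have hlogN : ∀ n : ℕ, 1 ≤ n →
      ∑ p ∈ Finset.Icc 1 (R n), Real.log (1 + n * η p) ≤ C * (n : ℝ) ^ (1 / α) := fun n hn => by
    have h1 : (1 : ℝ) ≤ (n : ℝ) ^ (1 / α) :=
      Real.one_le_rpow (by exact_mod_cast hn) (by positivity)
    refine le_trans (Finset.sum_le_sum fun p hp => ?_) (hlog _ h1 (R n))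
    rw [natCast_rpow_inv_rpow n hα0]
    refine Real.log_le_log (by linarith [hd n p hp]) ?_
    have := mul_le_mul_of_nonneg_left (hη.upper p (Finset.mem_Icc.1 hp).1) (Nat.cast_nonneg (α := ℝ) n)
    linarith
  have hint : ∀ n : ℕ, 1 ≤ n → ∫ z, a n z ∂ρ ≤ C * (n : ℝ) ^ (1 / α) := fun n hn => by
    rw [integral_finsetSum _ fun p _ => ((H.bddMeas p).sq.const_mul _).integrable ρ]
    refine le_trans (Finset.sum_le_sum fun p hp => ?_) (hlogN n hn)
    rw [integral_const_mul, H.integral_sq, mul_one]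
    exact div_one_add_le_log (hd n p hp)
  have hsup : ∀ n z, a n z ≤ n * (Cφ ^ 2 * K) := fun n z => by
    calc a n z ≤ ∑ p ∈ Finset.Icc 1 (R n), n * (Cφ ^ 2 * (η p * (p : ℝ) ^ (2 * τ))) := by
          refine Finset.sum_le_sum fun p hp => ?_
          have hp1 := (Finset.mem_Icc.1 hp).1
          have h1 : v n p ≤ n * η p := div_le_self (hd n p hp) (by linarith [hd n p hp])
          have h2 : φ p z ^ 2 ≤ Cφ ^ 2 * (p : ℝ) ^ (2 * τ) := by
            have := pow_le_pow_left₀ (abs_nonneg _) (H.bound p hp1 z) 2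
            rw [sq_abs, mul_pow, ← Real.rpow_natCast ((p : ℝ) ^ τ),
              ← Real.rpow_mul (Nat.cast_nonneg p)] at this
            simpa [mul_comm τ] using this
          calc v n p * φ p z ^ 2 ≤ (n * η p) * (Cφ ^ 2 * (p : ℝ) ^ (2 * τ)) :=
                mul_le_mul h1 h2 (sq_nonneg _) (hd n p hp)
            _ = _ := by ring
      _ ≤ _ := by
          rw [← Finset.mul_sum, ← Finset.mul_sum]
          gcongr
          exact hsum _
  refine ⟨2 * C + 1, by positivity, ?_⟩
  have hfl := highProb_fluctuation_single (ρ := ρ) (fun n => (ha n).1) (fun n => (ha n).2)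
    (t := fun n : ℕ => (n : ℝ) ^ (1 / α))
    (g := fun n : ℕ => Cφ ^ 2 * K * C * (n : ℝ) ^ (-(1 / α)))
    (by
      filter_upwards [Filter.eventually_ge_atTop 1] with n hn
      have hn0 : (0 : ℝ) < n := by exact_mod_cast hn
      calc ∫ z, a n z ^ 2 ∂ρ ≤ ∫ z, n * (Cφ ^ 2 * K) * a n z ∂ρ :=
            integral_le_of_le (ha n).sq ((ha n).const_mul _) fun z => by
              rw [_root_.sq]
              exact mul_le_mul_of_nonneg_right (hsup n z) (ha0 n z)
        _ ≤ n * (Cφ ^ 2 * K) * (C * (n : ℝ) ^ (1 / α)) := by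
            rw [integral_const_mul]
            gcongr
            exact hint n hn
        _ = _ := by
            have h0 : (n : ℝ) ^ (1 / α) ≠ 0 := by positivity
            rw [Real.rpow_neg hn0.le]
            field_simp)
    (by
      filter_upwards [Filter.eventually_ge_atTop 1] with n hn
      have hn0 : (0 : ℝ) < n := by exact_mod_cast hn
      positivity)
    (by
      have := (tendsto_natCast_rpow_neg (e := -(1 / α)) (by
        rw [neg_lt_zero]; positivity)).const_mul (Cφ ^ 2 * K * C)
      simpa using this)
  refine hfl.mono ?_
  filter_upwards [Filter.eventually_ge_atTop 1] with n hn x hx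
  rw [Set.mem_ofPred_eq] at hx ⊢
  refine (log_det_regGram_le (fun p hp => hη.pos (Finset.mem_Icc.1 hp).1) _).trans ?_
  have h1 : ∑ p ∈ Finset.Icc 1 (R n), Real.log (1 + η p * (feat φ x p ⬝ᵥ feat φ x p)) ≤
      ∑ p ∈ Finset.Icc 1 (R n), Real.log (1 + n * η p) + empMean (a n) x := by
    rw [empMean_sum, ← Finset.sum_add_distrib]
    refine Finset.sum_le_sum fun p hp => ?_
    rw [feat_dotProduct_feat φ (by omega), empMean_const_mul, ← mul_assoc, mul_comm (η p)]
    simp only [← _root_.sq]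
    exact log_one_add_mul_le (hd n p hp) (empMean_nonneg (fun z => sq_nonneg _) x)
  have h2 := hlogN n hn
  have h3 := hint n hn
  have h4 := (abs_le.1 hx).2
  nlinarith

/-- A lower bound for the noise term by the dimension of a well-conditioned block of features. -/
lemma card_le_log_det_sub_trace {ι : Type*} [DecidableEq ι] {n : ℕ} (hn : n ≠ 0) {s S : Finset ι}
    (hS : S ⊆ s) {η : ι → ℝ} (hη : ∀ p ∈ s, 0 < η p) (hηS : ∀ p ∈ S, 1 ≤ n * η p)
    (b : ι → Fin n → ℝ)
    (hG : ∑ p ∈ S, ∑ q ∈ S, ((b p ⬝ᵥ b q) / n - if p = q then 1 else 0) ^ 2 ≤ (S.card : ℝ) / 9) :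
    (S.card : ℝ) / 96 ≤
      Real.log (regGram s η b).det - trace (1 - (regGram s η b)⁻¹) := by
  have hn0 : (0 : ℝ) < n := by positivity
  rcases S.eq_empty_or_nonempty with rfl | hne
  · have := regGram_half_sum_sq_le hη b
    refine le_trans ?_ this
    simp only [Finset.card_empty, Nat.cast_zero, zero_div]
    positivity
  have hm : (0 : ℝ) < S.card := by exact_mod_cast hne.card_pos
  set m : ℝ := (S.card : ℝ) with hmdef
  set G : ι → ι → ℝ := fun p q => (b p ⬝ᵥ b q) / n
  set T : Matrix (Fin n) (Fin n) ℝ := 1 - (regGram s η b)⁻¹ with hT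
  set Z : Fin n → Fin n → ℝ := fun i j => ∑ p ∈ S, b p i * b p j / n with hZ
  have hZsq : ∑ i, ∑ j, Z i j ^ 2 = ∑ p ∈ S, ∑ q ∈ S, G p q ^ 2 := by
    have h1 : ∀ i j, Z i j ^ 2 = ∑ p ∈ S, ∑ q ∈ S, (b p i * b q i / n) * (b p j * b q j / n) := by
      intro i j
      rw [_root_.sq, hZ, Finset.sum_mul_sum]
      exact Finset.sum_congr rfl fun p _ => Finset.sum_congr rfl fun q _ => by ring
    have h2 : ∀ p q, G p q ^ 2 = ∑ i, ∑ j, (b p i * b q i / n) * (b p j * b q j / n) := by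
      intro p q
      have h3 : G p q = ∑ i, b p i * b q i / n := by simp only [G, dotProduct, Finset.sum_div]
      rw [_root_.sq, h3, Finset.sum_mul_sum]
    simp only [h1, h2]
    rw [Finset.sum_congr rfl fun i _ => Finset.sum_comm, Finset.sum_comm]
    refine Finset.sum_congr rfl fun p _ => ?_
    rw [Finset.sum_congr rfl fun i _ => Finset.sum_comm, Finset.sum_comm]
  have hZle : ∑ p ∈ S, ∑ q ∈ S, G p q ^ 2 ≤ 3 * m := by
    have h1 : ∀ p ∈ S, ∑ q ∈ S, G p q ^ 2 ≤
        ∑ q ∈ S, 2 * (G p q - if p = q then 1 else 0) ^ 2 + 2 := fun p hp => by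
      have h2 : (2 : ℝ) = ∑ q ∈ S, 2 * (if p = q then 1 else 0) := by simp [hp]
      conv_rhs => rw [h2]
      rw [← Finset.sum_add_distrib]
      refine Finset.sum_le_sum fun q _ => ?_
      rw [← h2]
      split_ifs <;> nlinarith [sq_nonneg (G p q - 2)]
    refine (Finset.sum_le_sum h1).trans ?_
    rw [Finset.sum_add_distrib]
    simp only [← Finset.mul_sum, Finset.sum_const, nsmul_eq_mul]
    linarith
  have htr : m * (2 / 3) ≤ ∑ p ∈ S, G p p := by
    have h1 : ∑ p ∈ S, (G p p - 1) ^ 2 ≤ m / 9 := by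
      refine le_trans (Finset.sum_le_sum fun p hp => ?_) hG
      refine le_trans (le_of_eq ?_) (Finset.single_le_sum (fun q _ => sq_nonneg _) hp)
      simp [G]
    have h2 := sq_sum_le_card_mul_sum_sq (s := S) (f := fun p => G p p - 1)
    have h3 : (∑ p ∈ S, (G p p - 1)) = ∑ p ∈ S, G p p - m := by
      rw [Finset.sum_sub_distrib]; simp [m]
    rw [h3] at h2
    have h4 : (∑ p ∈ S, G p p - m) ^ 2 ≤ (m / 3) ^ 2 := by
      refine h2.trans ?_
      calc m * ∑ p ∈ S, (G p p - 1) ^ 2 ≤ m * (m / 9) := by gcongr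
        _ = (m / 3) ^ 2 := by ring
    have := (abs_le.1 (abs_le_of_sq_le_sq h4 (by positivity))).1
    linarith
  have hquad : ∀ p ∈ S, 3 / 4 * G p p - 1 / 4 ≤ (b p ⬝ᵥ (T *ᵥ b p)) / n := fun p hp => by
    have h1 := dotProduct_regGram_inv_le hη b (b p) (fun q => if q = p then 1 / 2 else 0)
    have h2 : (∑ q ∈ s, (if q = p then (1 / 2 : ℝ) else 0) • b q) = (1 / 2 : ℝ) • b p := by
      simp [hS hp]
    have h3 : ∑ q ∈ s, (if q = p then (1 / 2 : ℝ) else 0) ^ 2 / η q = (1 / 4) / η p := by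
      rw [Finset.sum_eq_single_of_mem p (hS hp) (fun q _ hq => by simp [hq])]
      norm_num
    have h4 : b p - (1 / 2 : ℝ) • b p = (1 / 2 : ℝ) • b p := by
      ext i; simp; ring
    rw [h2, h3, h4, dotProduct_smul, smul_dotProduct] at h1
    have h5 : b p ⬝ᵥ (T *ᵥ b p) = b p ⬝ᵥ b p - b p ⬝ᵥ ((regGram s η b)⁻¹ *ᵥ b p) := by
      rw [hT, sub_mulVec, one_mulVec, dotProduct_sub]
    have h6 : (1 / 4) / η p ≤ n * (1 / 4) := by
      rw [div_le_iff₀ (hη p (hS hp))]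
      nlinarith [hηS p hp]
    have h7 : b p ⬝ᵥ b p = n * G p p := by
      simp only [G]; field_simp
    rw [le_div_iff₀ hn0, h5]
    simp only [smul_eq_mul] at h1
    rw [h7] at h1 ⊢
    linarith
  have hTZ : ∑ i, ∑ j, T i j * Z i j = ∑ p ∈ S, (b p ⬝ᵥ (T *ᵥ b p)) / n := by
    have h1 : ∀ p, (b p ⬝ᵥ (T *ᵥ b p)) / n = ∑ i, ∑ j, T i j * (b p i * b p j / n) := fun p => by
      rw [dotProduct, Finset.sum_div]
      refine Finset.sum_congr rfl fun i _ => ?_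
      rw [mulVec, dotProduct, Finset.mul_sum, Finset.sum_div]
      exact Finset.sum_congr rfl fun j _ => by ring
    simp only [h1, hZ, Finset.mul_sum]
    rw [Finset.sum_congr rfl fun i _ => Finset.sum_comm, Finset.sum_comm]
  have hlow : m / 4 ≤ ∑ i, ∑ j, T i j * Z i j := by
    rw [hTZ]
    refine le_trans ?_ (Finset.sum_le_sum hquad)
    rw [Finset.sum_sub_distrib, ← Finset.mul_sum]
    simp only [Finset.sum_const, nsmul_eq_mul]
    linarith
  have hcs : (∑ i, ∑ j, T i j * Z i j) ^ 2 ≤ (∑ i, ∑ j, T i j ^ 2) * ∑ i, ∑ j, Z i j ^ 2 := by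
    have := Finset.sum_mul_sq_le_sq_mul_sq (Finset.univ : Finset (Fin n × Fin n))
      (fun ij => T ij.1 ij.2) (fun ij => Z ij.1 ij.2)
    simpa only [Fintype.sum_prod_type] using this
  have hhalf := regGram_half_sum_sq_le hη b
  rw [← hT] at hhalf
  refine le_trans ?_ hhalf
  have h1 : (m / 4) ^ 2 ≤ (∑ i, ∑ j, T i j ^ 2) * (3 * m) := by
    calc (m / 4) ^ 2 ≤ (∑ i, ∑ j, T i j * Z i j) ^ 2 := by gcongr
      _ ≤ _ := hcs
      _ ≤ _ := by
        rw [hZsq]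
        gcongr
  have h2 : m / 48 ≤ ∑ i, ∑ j, T i j ^ 2 := by
    have : m * (m / 48) ≤ m * ∑ i, ∑ j, T i j ^ 2 := by nlinarith
    exact le_of_mul_le_mul_left this hm
  linarith

end NoiseTerm

section NoiseTermLower

variable {Ω : Type*} [MeasurableSpace Ω] {ρ : Measure Ω} [IsProbabilityMeasure ρ]
  {φ : ℕ → Ω → ℝ} {Cφ τ α c₁ c₂ : ℝ} {η : ℕ → ℝ}

theorem exists_highProb_le_log_det (H : OrthoSystem ρ φ Cφ τ) (hα : 1 < α)
    (hτ : τ < (α - 1) / 2) (hη : PowerDecay η c₁ c₂ α) {R : ℕ → ℕ}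
    (hR : ∀ᶠ n : ℕ in Filter.atTop, (n : ℝ) ^ (1 / α) ≤ R n) :
    ∃ c : ℝ, 0 < c ∧ HighProb ρ (fun n => {x |
      c * (n : ℝ) ^ (1 / α) ≤ Real.log (regGram (Finset.Icc 1 (R n)) η (feat φ x)).det -
        trace (1 - (regGram (Finset.Icc 1 (R n)) η (feat φ x))⁻¹)}) := by
  have hα0 : 0 < α := by positivity
  have hc₁ := hη.const_pos
  have hτ0 := H.exponent_pos
  set ε : ℝ := min 1 (c₁ ^ (1 / α)) with hε
  have hε0 : 0 < ε := lt_min one_pos (by positivity)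
  have hε1 : ε ≤ 1 := min_le_left _ _
  have hεα : ε ^ α ≤ c₁ := by
    calc ε ^ α ≤ (c₁ ^ (1 / α)) ^ α := by gcongr; exact min_le_right _ _
      _ = c₁ := by rw [← Real.rpow_mul hc₁.le, one_div_mul_cancel hα0.ne', Real.rpow_one]
  set m : ℕ → ℕ := fun n => ⌊ε * (n : ℝ) ^ (1 / α)⌋₊
  have hmle : ∀ n, (m n : ℝ) ≤ ε * (n : ℝ) ^ (1 / α) := fun n =>
    Nat.floor_le (by positivity)
  have hmle' : ∀ n, (m n : ℝ) ≤ (n : ℝ) ^ (1 / α) := fun n =>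
    (hmle n).trans (mul_le_of_le_one_left (by positivity) hε1)
  have hlarge : ∀ᶠ n : ℕ in Filter.atTop, 2 ≤ ε * (n : ℝ) ^ (1 / α) :=
    ((tendsto_natCast_rpow (by positivity)).const_mul_atTop hε0).eventually_ge_atTop 2
  have hmge : ∀ᶠ n : ℕ in Filter.atTop, ε * (n : ℝ) ^ (1 / α) / 2 ≤ m n := by
    filter_upwards [hlarge] with n hn
    have := Nat.sub_one_lt_floor (ε * (n : ℝ) ^ (1 / α))
    linarith
  have hfl := highProb_fluctuation (ρ := ρ)
    (s := fun n => Finset.Icc 1 (m n) ×ˢ Finset.Icc 1 (m n))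
    (η := fun _ _ => 1) (fun _ _ _ => zero_le_one)
    (a := fun _ pq z => φ pq.1 z * φ pq.2 z)
    (fun _ pq => ((H.bddMeas pq.1).mul (H.bddMeas pq.2)).1)
    (fun _ pq => ((H.bddMeas pq.1).mul (H.bddMeas pq.2)).2)
    (g := fun n : ℕ => 9 * Cφ ^ 2 * (n : ℝ) ^ ((2 * τ + 1) / α - 1))
    (t := fun n => (m n : ℝ) / 9)
    (by
      filter_upwards [Filter.eventually_ge_atTop 1] with n hn
      have hn0 : (0 : ℝ) < n := by exact_mod_cast hn
      have h1 : ∀ pq ∈ Finset.Icc 1 (m n) ×ˢ Finset.Icc 1 (m n),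
          1 * ∫ z, (φ pq.1 z * φ pq.2 z) ^ 2 ∂ρ ≤ Cφ ^ 2 * (m n : ℝ) ^ (2 * τ) := fun pq hpq => by
        rw [Finset.mem_product, Finset.mem_Icc] at hpq
        have hp : (pq.1 : ℝ) ≤ m n := by exact_mod_cast hpq.1.2
        refine le_trans (le_of_eq (one_mul _))
          ((H.integral_mul_sq_le hpq.1.1 (H.bddMeas pq.2)).trans ?_)
        rw [H.integral_sq, mul_one]
        gcongr
      refine (Finset.sum_le_sum h1).trans ?_
      rw [Finset.sum_const, Finset.card_product, Nat.card_Icc, Nat.add_sub_cancel, nsmul_eq_mul]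
      push_cast
      have h2 : (m n : ℝ) * (m n : ℝ) ^ (2 * τ) ≤ n * (n : ℝ) ^ ((2 * τ + 1) / α - 1) := by
        have e1 : n * (n : ℝ) ^ ((2 * τ + 1) / α - 1) =
            (n : ℝ) ^ (1 / α) * ((n : ℝ) ^ (1 / α)) ^ (2 * τ) := by
          rw [← Real.rpow_mul hn0.le, ← Real.rpow_add hn0]
          nth_rewrite 1 [← Real.rpow_one (n : ℝ)]
          rw [← Real.rpow_add hn0]
          congr 1
          field_simp
          ring
        rw [e1]
        gcongr <;> exact hmle' n
      calc (m n : ℝ) * m n * (Cφ ^ 2 * (m n : ℝ) ^ (2 * τ))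
          = Cφ ^ 2 * m n * (m n * (m n : ℝ) ^ (2 * τ)) := by ring
        _ ≤ Cφ ^ 2 * m n * (n * (n : ℝ) ^ ((2 * τ + 1) / α - 1)) := by gcongr
        _ = _ := by ring)
    (by
      filter_upwards [hmge, hlarge] with n h1 h2
      linarith)
    (by
      have := (tendsto_natCast_rpow_neg (e := (2 * τ + 1) / α - 1) (by
        rw [sub_neg, div_lt_one hα0]; linarith)).const_mul (9 * Cφ ^ 2)
      simpa using this)
  refine ⟨ε / 192, by positivity, hfl.mono ?_⟩
  filter_upwards [hmge, hR, Filter.eventually_ge_atTop 1] with n h1 h2 hn x hx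
  rw [Set.mem_ofPred_eq] at hx ⊢
  have hn0 : (0 : ℝ) < n := by exact_mod_cast hn
  have hsub : Finset.Icc 1 (m n) ⊆ Finset.Icc 1 (R n) :=
    Finset.Icc_subset_Icc_right (by exact_mod_cast (hmle' n).trans h2)
  have hbig : ∀ p ∈ Finset.Icc 1 (m n), 1 ≤ n * η p := fun p hp => by
    rw [Finset.mem_Icc] at hp
    have hp0 : (0 : ℝ) < p := by exact_mod_cast hp.1
    have hpm : (p : ℝ) ≤ ε * (n : ℝ) ^ (1 / α) := le_trans (by exact_mod_cast hp.2) (hmle n)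
    have h3 : (p : ℝ) ^ α ≤ c₁ * n := by
      calc (p : ℝ) ^ α ≤ (ε * (n : ℝ) ^ (1 / α)) ^ α := by gcongr
        _ = ε ^ α * n := by
            rw [Real.mul_rpow hε0.le (by positivity), natCast_rpow_inv_rpow n hα0.ne']
        _ ≤ c₁ * n := by gcongr
    have h4 : 1 ≤ n * (c₁ * (p : ℝ) ^ (-α)) := by
      rw [Real.rpow_neg hp0.le]
      have : 0 < (p : ℝ) ^ α := by positivity
      rw [← div_eq_mul_inv, ← mul_div_assoc, le_div_iff₀ this]
      linarith
    exact h4.trans (mul_le_mul_of_nonneg_left (hη.lower p hp.1) hn0.le)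
  have hcard := card_le_log_det_sub_trace (by omega) hsub
    (fun p hp => hη.pos (Finset.mem_Icc.1 hp).1) hbig (feat φ x) (by
      rw [Nat.card_Icc, Nat.add_sub_cancel]
      refine le_trans (le_of_eq ?_) hx
      rw [Finset.sum_product]
      refine Finset.sum_congr rfl fun p _ => Finset.sum_congr rfl fun q _ => ?_
      rw [one_mul, H.orth, feat_dotProduct_feat φ (by omega), mul_div_cancel_left₀ _ hn0.ne'])
  rw [Nat.card_Icc, Nat.add_sub_cancel] at hcard
  refine le_trans ?_ hcard
  linarith

end NoiseTermLower

/-! ### The order of the signal term -/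

section SignalRate

/-- The order of magnitude of the signal term. -/
noncomputable def signalRate (α β : ℝ) (n : ℕ) : ℝ :=
  if α = 2 * β - 1 then Real.log n else (n : ℝ) ^ (max 0 (1 + (1 - 2 * β) / α))

variable {α β τ κ : ℝ}

lemma signalRate_of_eq (h : α = 2 * β - 1) (n : ℕ) : signalRate α β n = Real.log n := if_pos h

lemma signalRate_of_lt (hα : 0 < α) (h : 2 * β - 1 < α) (n : ℕ) :
    signalRate α β n = (n : ℝ) ^ (1 + (1 - 2 * β) / α) := by
  rw [signalRate, if_neg h.ne', max_eq_right]
  have : 0 ≤ (α + (1 - 2 * β)) / α := div_nonneg (by linarith) hα.le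
  rwa [add_div, div_self hα.ne'] at this

lemma one_add_div_neg (hα : 0 < α) (h : α < 2 * β - 1) : 1 + (1 - 2 * β) / α < 0 := by
  have : (α + (1 - 2 * β)) / α < 0 := div_neg_of_neg_of_pos (by linarith) hα
  rwa [add_div, div_self hα.ne'] at this

lemma signalRate_of_gt (hα : 0 < α) (h : α < 2 * β - 1) (n : ℕ) : signalRate α β n = 1 := by
  rw [signalRate, if_neg h.ne, max_eq_left (one_add_div_neg hα h).le, Real.rpow_zero]

lemma eventually_one_le_log : ∀ᶠ n : ℕ in Filter.atTop, 1 ≤ Real.log n :=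
  (Real.tendsto_log_atTop.comp (tendsto_natCast_atTop_atTop (R := ℝ))).eventually_ge_atTop 1

lemma eventually_one_le_signalRate (α β : ℝ) :
    ∀ᶠ n : ℕ in Filter.atTop, 1 ≤ signalRate α β n := by
  filter_upwards [eventually_one_le_log, Filter.eventually_ge_atTop 1] with n h1 h2
  rw [signalRate]
  split_ifs
  · exact h1
  · exact Real.one_le_rpow (by exact_mod_cast h2) (le_max_left _ _)

lemma eventually_rpow_le_signalRate (hα : 0 < α) :
    ∀ᶠ n : ℕ in Filter.atTop, (n : ℝ) ^ (1 + (1 - 2 * β) / α) ≤ signalRate α β n := by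
  filter_upwards [eventually_one_le_log, Filter.eventually_ge_atTop 1] with n h1 h2
  rw [signalRate]
  split_ifs with h
  · have : 1 + (1 - 2 * β) / α = 0 := by
      rw [show 1 - 2 * β = -α by linarith, neg_div, div_self hα.ne']; ring
    rw [this, Real.rpow_zero]
    exact h1
  · exact Real.rpow_le_rpow_of_exponent_le (by exact_mod_cast h2) (le_max_right _ _)

lemma sum_Icc_rpow_neg_one (P : ℕ) :
    ∑ p ∈ Finset.Icc 1 P, (p : ℝ) ^ (-1 : ℝ) = (harmonic P : ℝ) := by
  rw [harmonic_eq_sum_Icc]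
  push_cast
  simp only [Real.rpow_neg_one]

lemma ceil_natCast_rpow_le {e : ℝ} (he : 0 ≤ e) {n : ℕ} (hn : 1 ≤ n) :
    (⌈(n : ℝ) ^ e⌉₊ : ℝ) ≤ 2 * (n : ℝ) ^ e := by
  have h1 : 1 ≤ (n : ℝ) ^ e := Real.one_le_rpow (by exact_mod_cast hn) he
  have := Nat.ceil_lt_add_one (show 0 ≤ (n : ℝ) ^ e by positivity)
  linarith

lemma exists_sum_rpow_le_signalRate (hα : 1 < α) (β : ℝ) :
    ∃ C : ℝ, 0 < C ∧ ∀ᶠ n : ℕ in Filter.atTop,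
      ∑ p ∈ Finset.Icc 1 ⌈(n : ℝ) ^ (1 / α)⌉₊, (p : ℝ) ^ (-(2 * β - α)) ≤ C * signalRate α β n := by
  have hα0 : 0 < α := by positivity
  rcases lt_trichotomy (2 * β - 1) α with h | h | h
  · obtain ⟨C, hC, hsum⟩ := exists_sum_rpow_neg_le (s := 2 * β - α) (by linarith)
    refine ⟨C * 2 ^ (1 - (2 * β - α)), by positivity, ?_⟩
    filter_upwards [Filter.eventually_ge_atTop 1] with n hn
    have hn0 : (0 : ℝ) < n := by exact_mod_cast hn
    rw [signalRate_of_lt hα0 h]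
    refine (hsum _).trans ?_
    have h1 : (n : ℝ) ^ (1 + (1 - 2 * β) / α) = ((n : ℝ) ^ (1 / α)) ^ (1 - (2 * β - α)) := by
      rw [← Real.rpow_mul hn0.le]
      congr 1
      field_simp
      ring
    rw [h1, mul_assoc, ← Real.mul_rpow (by norm_num) (by positivity)]
    gcongr
    · linarith
    · exact ceil_natCast_rpow_le (by positivity) hn
  · refine ⟨3, by norm_num, ?_⟩
    filter_upwards [Filter.eventually_ge_atTop 1, eventually_one_le_log] with n hn hlog
    have hn0 : (0 : ℝ) < n := by exact_mod_cast hn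
    rw [signalRate_of_eq h.symm, show 2 * β - α = 1 by linarith, sum_Icc_rpow_neg_one]
    refine (harmonic_le_one_add_log _).trans ?_
    have h0 : 0 < ⌈(n : ℝ) ^ (1 / α)⌉₊ := Nat.ceil_pos.2 (by positivity)
    have h1 := Real.log_le_log (by exact_mod_cast h0)
      (ceil_natCast_rpow_le (e := 1 / α) (by positivity) hn)
    rw [Real.log_mul (by norm_num) (by positivity), Real.log_rpow hn0] at h1
    have h2 : 1 / α * Real.log n ≤ 1 * Real.log n := by
      gcongr
      rw [div_le_one hα0]
      exact hα.le
    have h3 := Real.log_two_lt_d9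
    linarith
  · obtain ⟨C, hC, hsum⟩ := exists_sum_rpow_neg_le_const (s := 2 * β - α) (by linarith)
    refine ⟨C, hC, Filter.Eventually.of_forall fun n => ?_⟩
    rw [signalRate_of_gt hα0 h, mul_one]
    exact hsum _

/-- The squared sup norm of the target is negligible compared with the signal term. -/
lemma tendsto_sum_rpow_sq_mul_div_signalRate_sq (hα : 1 < α) (hβ : 1 / 2 < β)
    (hτ : τ < (α - 1) / 2) (hκ0 : 0 < κ) (hκ : κ < (α - 1 - 2 * τ) / (2 * α ^ 2)) {R : ℕ → ℕ}
    (hR : ∀ᶠ n : ℕ in Filter.atTop, (R n : ℝ) ≤ 2 * (n : ℝ) ^ (1 / α + κ)) :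
    Filter.Tendsto (fun n : ℕ => (∑ p ∈ Finset.Icc 1 (R n), (p : ℝ) ^ (-β + τ)) ^ 2 *
      ((n : ℝ) ^ (1 + (1 - 2 * β) / α) / signalRate α β n ^ 2)) Filter.atTop (nhds 0) := by
  have hα0 : 0 < α := by positivity
  have hnonneg : ∀ n : ℕ, 0 ≤ ∑ p ∈ Finset.Icc 1 (R n), (p : ℝ) ^ (-β + τ) := fun n =>
    Finset.sum_nonneg fun p _ => by positivity
  rcases lt_or_ge (2 * β - 1) α with h | h
  · set e : ℝ := (α + 1) / 2 - β with he
    set ε : ℝ := (α - 1) / 2 - τ with hε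
    have he0 : 0 < e := by linarith
    have hε0 : 0 < ε := by linarith
    set e' : ℝ := max (e - ε) (e / (2 * (1 + α * κ))) with he'
    have he'0 : 0 < e' := lt_max_of_lt_right (by positivity)
    have hκα : α * κ * α < ε := by
      rw [lt_div_iff₀ (by positivity)] at hκ
      nlinarith
    have hkey : e' * (1 + α * κ) < e := by
      rw [← lt_div_iff₀ (by positivity), he', max_lt_iff]
      constructor
      · rw [lt_div_iff₀ (by positivity)]
        rcases le_or_gt (e - ε) 0 with h1 | h1
        · nlinarith [mul_pos hα0 hκ0]
        · have h2 : e - ε < α := by linarith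
          nlinarith [mul_pos hα0 hκ0]
      · gcongr
        nlinarith [mul_pos hα0 hκ0]
    obtain ⟨C, hC, hsum⟩ := exists_sum_rpow_neg_le (s := 1 - e') (by linarith)
    have hlim := (tendsto_natCast_rpow_neg (e := 2 * (e' * (1 + α * κ) - e) / α)
      (div_neg_of_neg_of_pos (by linarith) hα0)).const_mul ((C * 2 ^ e') ^ 2)
    rw [mul_zero] at hlim
    refine squeeze_zero' (Filter.Eventually.of_forall fun n => by positivity) ?_ hlim
    filter_upwards [hR, Filter.eventually_ge_atTop 1] with n hRn hn
    have hn0 : (0 : ℝ) < n := by exact_mod_cast hn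
    rw [signalRate_of_lt hα0 h]
    have h1 : ∑ p ∈ Finset.Icc 1 (R n), (p : ℝ) ^ (-β + τ) ≤
        C * 2 ^ e' * (n : ℝ) ^ ((1 / α + κ) * e') := by
      calc ∑ p ∈ Finset.Icc 1 (R n), (p : ℝ) ^ (-β + τ)
          ≤ ∑ p ∈ Finset.Icc 1 (R n), (p : ℝ) ^ (-(1 - e')) := by
            refine Finset.sum_le_sum fun p hp => ?_
            refine Real.rpow_le_rpow_of_exponent_le
              (by exact_mod_cast (Finset.mem_Icc.1 hp).1) ?_
            have := le_max_left (e - ε) (e / (2 * (1 + α * κ)))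
            linarith
        _ ≤ C * (R n : ℝ) ^ (1 - (1 - e')) := hsum _
        _ ≤ C * (2 * (n : ℝ) ^ (1 / α + κ)) ^ e' := by
            rw [sub_sub_cancel]
            gcongr
        _ = _ := by
            rw [Real.mul_rpow (by norm_num) (by positivity), ← Real.rpow_mul hn0.le, mul_assoc]
    have h2 : (n : ℝ) ^ (1 + (1 - 2 * β) / α) / ((n : ℝ) ^ (1 + (1 - 2 * β) / α)) ^ 2 =
        (n : ℝ) ^ (-(2 * e / α)) := by
      have : 1 + (1 - 2 * β) / α = 2 * e / α := by
        rw [he]; field_simp; ring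
      rw [this, Real.rpow_neg hn0.le]
      have : (n : ℝ) ^ (2 * e / α) ≠ 0 := by positivity
      field_simp
    rw [h2]
    calc (∑ p ∈ Finset.Icc 1 (R n), (p : ℝ) ^ (-β + τ)) ^ 2 * (n : ℝ) ^ (-(2 * e / α))
        ≤ (C * 2 ^ e' * (n : ℝ) ^ ((1 / α + κ) * e')) ^ 2 * (n : ℝ) ^ (-(2 * e / α)) := by
          gcongr
      _ = _ := by
          rw [mul_pow, mul_assoc, ← Real.rpow_natCast ((n : ℝ) ^ ((1 / α + κ) * e')),
            ← Real.rpow_mul hn0.le, ← Real.rpow_add hn0]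
          congr 2
          push_cast
          field_simp
          ring
  · obtain ⟨K, hK, hsum⟩ := exists_sum_rpow_neg_le_const (s := β - τ) (by linarith)
    have hlim : Filter.Tendsto (fun n : ℕ => (n : ℝ) ^ (1 + (1 - 2 * β) / α) /
        signalRate α β n ^ 2) Filter.atTop (nhds 0) := by
      rcases h.lt_or_eq with h | h
      · simp only [signalRate_of_gt hα0 h, one_pow, div_one]
        exact tendsto_natCast_rpow_neg (one_add_div_neg hα0 h)
      · have h0 : 1 + (1 - 2 * β) / α = 0 := by
          rw [show 1 - 2 * β = -α by linarith, neg_div, div_self hα0.ne']; ring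
        simp only [signalRate_of_eq h, h0, Real.rpow_zero]
        refine Filter.Tendsto.div_atTop tendsto_const_nhds ?_
        exact (Filter.tendsto_pow_atTop two_ne_zero).comp
          (Real.tendsto_log_atTop.comp (tendsto_natCast_atTop_atTop (R := ℝ)))
    have hlim' := hlim.const_mul (K ^ 2)
    rw [mul_zero] at hlim'
    refine squeeze_zero' (Filter.Eventually.of_forall fun n => by positivity)
      (Filter.Eventually.of_forall fun n => ?_) hlim'
    have h1 := hsum (R n)
    rw [show -(β - τ) = -β + τ by ring] at h1
    have h2 := hnonneg n
    gcongr

end SignalRate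

/-! ### Upper bound for the signal term -/

section SignalUpper

variable {Ω : Type*}

lemma feat_dotProduct_apply {n : ℕ} (hn : n ≠ 0) (φ : ℕ → Ω → ℝ) (a : Ω → ℝ) (x : Fin n → Ω)
    (p : ℕ) : feat φ x p ⬝ᵥ (fun i => a (x i)) = n * empMean (fun z => φ p z * a z) x := by
  rw [← sum_eq_mul_empMean hn]
  rfl

variable [MeasurableSpace Ω] {ρ : Measure Ω} [IsProbabilityMeasure ρ]
  {φ : ℕ → Ω → ℝ} {Cφ τ α β κ c₁ c₂ Cμ : ℝ} {η μ : ℕ → ℝ}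

lemma sum_Ioc_sq_le (hβ : 1 / 2 < β) (hμ : ∀ p : ℕ, 1 ≤ p → |μ p| ≤ Cμ * (p : ℝ) ^ (-β)) {P : ℕ}
    (hP : 1 ≤ P) (R : ℕ) :
    ∑ p ∈ Finset.Ioc P R, μ p ^ 2 ≤ Cμ ^ 2 * ((2 * β - 1)⁻¹ * (P : ℝ) ^ (1 - 2 * β)) := by
  refine le_trans ?_ (mul_le_mul_of_nonneg_left
    (sum_Ioc_rpow_neg_le (show 1 < 2 * β by linarith) hP R) (sq_nonneg Cμ))
  rw [Finset.mul_sum]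
  refine Finset.sum_le_sum fun p hp => ?_
  have h1 := pow_le_pow_left₀ (abs_nonneg _) (hμ p (by rw [Finset.mem_Ioc] at hp; omega)) 2
  rw [sq_abs, mul_pow, ← Real.rpow_natCast ((p : ℝ) ^ (-β)), ← Real.rpow_mul (Nat.cast_nonneg p)]
    at h1
  rwa [show -(2 * β) = -β * ((2 : ℕ) : ℝ) by push_cast; ring]

theorem exists_highProb_signal_le (H : OrthoSystem ρ φ Cφ τ) (hα : 1 < α)
    (hτ : τ < (α - 1) / 2) (hη : PowerDecay η c₁ c₂ α) (hβ : 1 / 2 < β) (hCμ : 0 < Cμ)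
    (hμ : ∀ p : ℕ, 1 ≤ p → |μ p| ≤ Cμ * (p : ℝ) ^ (-β))
    (hκ0 : 0 < κ) (hκ : κ < (α - 1 - 2 * τ) / (2 * α ^ 2)) {R : ℕ → ℕ}
    (hR : ∀ᶠ n : ℕ in Filter.atTop, (R n : ℝ) ≤ 2 * (n : ℝ) ^ (1 / α + κ)) :
    ∃ C : ℝ, 0 < C ∧ HighProb ρ (fun n => {x |
      (fun i => lincomb φ (Finset.Icc 1 (R n)) μ (x i)) ⬝ᵥ
        ((regGram (Finset.Icc 1 (R n)) η (feat φ x))⁻¹ *ᵥ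
          (fun i => lincomb φ (Finset.Icc 1 (R n)) μ (x i))) ≤ C * signalRate α β n}) := by
  have hα0 : 0 < α := by positivity
  have hc₁ := hη.const_pos
  have hβ0 : 0 < 2 * β - 1 := by linarith
  obtain ⟨D, hD, hbias⟩ := exists_sum_rpow_le_signalRate hα β
  set C₃ : ℝ := Cμ ^ 2 * (2 * β - 1)⁻¹ with hC₃
  set P : ℕ → ℕ := fun n => ⌈(n : ℝ) ^ (1 / α)⌉₊
  set r : ℕ → Ω → ℝ := fun n => lincomb φ (Finset.Ioc (P n) (R n)) μ with hr
  set M : ℕ → ℝ := fun n => Cφ * Cμ * ∑ p ∈ Finset.Icc 1 (R n), (p : ℝ) ^ (-β + τ) with hM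
  have hrb : ∀ n, BddMeas (r n) := fun n => H.bddMeas_lincomb _ _
  have hCφ := H.const_pos
  have hrM : ∀ n z, |r n z| ≤ M n := fun n z => by
    refine (H.abs_lincomb_le (fun p hp => by rw [Finset.mem_Ioc] at hp; omega)
      (fun p hp => hμ p (by rw [Finset.mem_Ioc] at hp; omega)) z).trans ?_
    refine mul_le_mul_of_nonneg_left ?_ (by positivity)
    refine Finset.sum_le_sum_of_subset_of_nonneg (fun p hp => ?_) fun p _ _ => by positivity
    rw [Finset.mem_Ioc] at hp
    rw [Finset.mem_Icc]
    omega
  have hint : ∀ n : ℕ, 1 ≤ n →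
      n * ∫ z, r n z ^ 2 ∂ρ ≤ C₃ * (n : ℝ) ^ (1 + (1 - 2 * β) / α) := fun n hn => by
    have hn0 : (0 : ℝ) < n := by exact_mod_cast hn
    have hP : 1 ≤ P n := Nat.one_le_iff_ne_zero.2 (Nat.ceil_pos.2 (by positivity)).ne'
    rw [hr, H.integral_lincomb_sq]
    have h1 : (P n : ℝ) ^ (1 - 2 * β) ≤ (n : ℝ) ^ ((1 - 2 * β) / α) := by
      calc (P n : ℝ) ^ (1 - 2 * β) ≤ ((n : ℝ) ^ (1 / α)) ^ (1 - 2 * β) :=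
            Real.rpow_le_rpow_of_nonpos (by positivity) (Nat.le_ceil _) (by linarith)
        _ = _ := by rw [← Real.rpow_mul hn0.le]; ring_nf
    calc n * ∑ p ∈ Finset.Ioc (P n) (R n), μ p ^ 2
        ≤ n * (Cμ ^ 2 * ((2 * β - 1)⁻¹ * (P n : ℝ) ^ (1 - 2 * β))) := by
          gcongr
          exact sum_Ioc_sq_le hβ hμ hP _
      _ ≤ n * (Cμ ^ 2 * ((2 * β - 1)⁻¹ * (n : ℝ) ^ ((1 - 2 * β) / α))) := by gcongr
      _ = _ := by rw [Real.rpow_add hn0, Real.rpow_one]; ring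
  have hfl := highProb_fluctuation_single (ρ := ρ) (a := fun n z => r n z ^ 2)
    (fun n => (hrb n).sq.1) (fun n => (hrb n).sq.2)
    (t := fun n : ℕ => signalRate α β n / n)
    (g := fun n : ℕ => C₃ * (Cφ * Cμ) ^ 2 *
      ((∑ p ∈ Finset.Icc 1 (R n), (p : ℝ) ^ (-β + τ)) ^ 2 *
        ((n : ℝ) ^ (1 + (1 - 2 * β) / α) / signalRate α β n ^ 2)))
    (by
      filter_upwards [Filter.eventually_ge_atTop 1, eventually_one_le_signalRate α β] with n hn ha
      have hn0 : (0 : ℝ) < n := by exact_mod_cast hn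
      have h1 : ∫ z, (r n z ^ 2) ^ 2 ∂ρ ≤ M n ^ 2 * ∫ z, r n z ^ 2 ∂ρ := by
        refine le_trans (le_of_eq ?_) (integral_mul_sq_le (hrb n) (hrb n) (hrM n))
        simp only [_root_.sq]
      refine h1.trans ?_
      have h2 : ∫ z, r n z ^ 2 ∂ρ ≤ C₃ * (n : ℝ) ^ (1 + (1 - 2 * β) / α) / n := by
        rw [le_div_iff₀ hn0]
        linarith [hint n hn]
      calc M n ^ 2 * ∫ z, r n z ^ 2 ∂ρ
          ≤ M n ^ 2 * (C₃ * (n : ℝ) ^ (1 + (1 - 2 * β) / α) / n) := by gcongr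
        _ = _ := by
            rw [hM]
            have : signalRate α β n ≠ 0 := by positivity
            field_simp)
    (by
      filter_upwards [Filter.eventually_ge_atTop 1, eventually_one_le_signalRate α β] with n hn ha
      have hn0 : (0 : ℝ) < n := by exact_mod_cast hn
      positivity)
    (by
      have := (tendsto_sum_rpow_sq_mul_div_signalRate_sq hα hβ hτ hκ0 hκ hR).const_mul
        (C₃ * (Cφ * Cμ) ^ 2)
      rwa [mul_zero] at this)
  refine ⟨C₃ + 1 + Cμ ^ 2 / c₁ * D, by positivity, hfl.mono ?_⟩
  filter_upwards [Filter.eventually_ge_atTop 1, eventually_rpow_le_signalRate (β := β) hα0, hbias]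
    with n hn hb hbn x hx
  rw [Set.mem_ofPred_eq] at hx ⊢
  have hn0 : (0 : ℝ) < n := by exact_mod_cast hn
  have hηpos : ∀ p ∈ Finset.Icc 1 (R n), 0 < η p := fun p hp => hη.pos (Finset.mem_Icc.1 hp).1
  set ν : ℕ → ℝ := fun p => if p ≤ P n then μ p else 0 with hν
  have hres : (fun i => lincomb φ (Finset.Icc 1 (R n)) μ (x i)) -
      ∑ p ∈ Finset.Icc 1 (R n), ν p • feat φ x p = fun i => r n (x i) := by
    ext i
    have hI : Finset.Ioc (P n) (R n) = (Finset.Icc 1 (R n)).filter fun p => ¬ p ≤ P n := by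
      ext p
      simp only [Finset.mem_Ioc, Finset.mem_filter, Finset.mem_Icc]
      omega
    simp only [hr]
    rw [Pi.sub_apply, Finset.sum_apply, hI, lincomb, lincomb, Finset.sum_filter,
      ← Finset.sum_sub_distrib]
    refine Finset.sum_congr rfl fun p _ => ?_
    simp only [hν, Pi.smul_apply, feat, smul_eq_mul]
    split_ifs <;> simp_all
  have hupper := dotProduct_regGram_inv_le hηpos (feat φ x)
    (fun i => lincomb φ (Finset.Icc 1 (R n)) μ (x i)) ν
  rw [hres] at hupper
  have h1 : (fun i => r n (x i)) ⬝ᵥ (fun i => r n (x i)) ≤ (C₃ + 1) * signalRate α β n := by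
    have e1 : (fun i => r n (x i)) ⬝ᵥ (fun i => r n (x i)) =
        n * empMean (fun z => r n z ^ 2) x := by
      rw [← sum_eq_mul_empMean (by omega)]
      simp only [dotProduct, _root_.sq]
    have h2 := (abs_le.1 hx).2
    have h3 := hint n hn
    rw [e1]
    calc n * empMean (fun z => r n z ^ 2) x
        ≤ n * (∫ z, r n z ^ 2 ∂ρ + signalRate α β n / n) := by gcongr; linarith
      _ = n * ∫ z, r n z ^ 2 ∂ρ + signalRate α β n := by field_simp
      _ ≤ C₃ * signalRate α β n + signalRate α β n :=
          add_le_add_left (h3.trans (mul_le_mul_of_nonneg_left hb (by positivity))) _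
      _ = _ := by ring
  have h2 : ∑ p ∈ Finset.Icc 1 (R n), ν p ^ 2 / η p ≤ Cμ ^ 2 / c₁ * D * signalRate α β n := by
    have hterm : ∀ p : ℕ, 1 ≤ p → μ p ^ 2 / η p ≤ Cμ ^ 2 / c₁ * (p : ℝ) ^ (-(2 * β - α)) := by
      intro p hp
      have hp0 : (0 : ℝ) < p := by exact_mod_cast hp
      have h3 : μ p ^ 2 ≤ (Cμ * (p : ℝ) ^ (-β)) ^ 2 := by
        rw [← sq_abs]
        exact pow_le_pow_left₀ (abs_nonneg _) (hμ p hp) 2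
      calc μ p ^ 2 / η p ≤ (Cμ * (p : ℝ) ^ (-β)) ^ 2 / (c₁ * (p : ℝ) ^ (-α)) :=
            div_le_div₀ (by positivity) h3 (by positivity) (hη.lower p hp)
        _ = Cμ ^ 2 / c₁ * ((p : ℝ) ^ (-β * (2 : ℕ)) / (p : ℝ) ^ (-α)) := by
            rw [Real.rpow_mul hp0.le, Real.rpow_natCast]
            field_simp
        _ = _ := by
            rw [← Real.rpow_sub hp0]
            congr 2
            push_cast
            ring
    calc ∑ p ∈ Finset.Icc 1 (R n), ν p ^ 2 / η p
        = ∑ p ∈ (Finset.Icc 1 (R n)).filter (fun p => p ≤ P n), μ p ^ 2 / η p := by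
          rw [Finset.sum_filter]
          refine Finset.sum_congr rfl fun p _ => ?_
          simp only [hν]
          split_ifs <;> simp
      _ ≤ ∑ p ∈ Finset.Icc 1 (P n), μ p ^ 2 / η p := by
          refine Finset.sum_le_sum_of_subset_of_nonneg (fun p hp => ?_) fun p hp _ => ?_
          · simp only [Finset.mem_filter, Finset.mem_Icc] at hp ⊢
            omega
          · exact div_nonneg (sq_nonneg _) (hη.pos (Finset.mem_Icc.1 hp).1).le
      _ ≤ ∑ p ∈ Finset.Icc 1 (P n), Cμ ^ 2 / c₁ * (p : ℝ) ^ (-(2 * β - α)) :=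
          Finset.sum_le_sum fun p hp => hterm p (Finset.mem_Icc.1 hp).1
      _ ≤ Cμ ^ 2 / c₁ * (D * signalRate α β n) := by
          rw [← Finset.mul_sum]
          gcongr
      _ = _ := by ring
  linarith

end SignalUpper

/-! ### Lower bound for the signal term: the saturated regime -/

section SignalLower

/-- Coefficients that are bounded below by `cμ * p ^ (-β)` along a sequence of indices `q` of
positive density. -/
structure DenseLower (μ : ℕ → ℝ) (cμ β : ℝ) (q : ℕ → ℕ) (D : ℕ) : Prop where
  const_pos : 0 < cμ
  strictMono : StrictMono q
  ge : ∀ i, i + 1 ≤ q i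
  le : ∀ i, q i ≤ D * (i + 1)
  coeff : ∀ i, cμ * (q i : ℝ) ^ (-β) ≤ |μ (q i)|

lemma denseLower_of_gap {μ : ℕ → ℝ} {cμ β : ℝ} {q : ℕ → ℕ} (hcμ : 0 < cμ) (hq : StrictMono q)
    (hq1 : ∀ i, 1 ≤ q i) {h : ℕ} (hgap : ∀ i, q (i + 1) - q i ≤ h)
    (hμ : ∀ i, cμ * (q i : ℝ) ^ (-β) ≤ |μ (q i)|) : DenseLower μ cμ β q (q 0 + h) where
  const_pos := hcμ
  strictMono := hq
  ge i := by
    induction i with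
    | zero => exact hq1 0
    | succ i ih =>
      have : q i < q (i + 1) := hq (Nat.lt_succ_self i)
      omega
  le i := by
    induction i with
    | zero => omega
    | succ i ih =>
      have h1 := hgap i
      have h2 : (q 0 + h) * (i + 1 + 1) = (q 0 + h) * (i + 1) + (q 0 + h) := by ring
      omega
  coeff := hμ

namespace DenseLower

variable {μ : ℕ → ℝ} {cμ β α : ℝ} {q : ℕ → ℕ} {D : ℕ}

lemma pos (h : DenseLower μ cμ β q D) : 0 < D := by
  have h1 := h.ge 0
  have h2 := h.le 0
  omega

lemma sq_le (h : DenseLower μ cμ β q D) (i : ℕ) :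
    cμ ^ 2 * (q i : ℝ) ^ (-(2 * β)) ≤ μ (q i) ^ 2 := by
  have := pow_le_pow_left₀ (mul_nonneg h.const_pos.le (by positivity)) (h.coeff i) 2
  rw [sq_abs, mul_pow, ← Real.rpow_natCast ((q i : ℝ) ^ (-β)),
    ← Real.rpow_mul (Nat.cast_nonneg _)] at this
  rwa [show -(2 * β) = -β * ((2 : ℕ) : ℝ) by push_cast; ring]

lemma sum_comp_le (h : DenseLower μ cμ β q D) {F : ℕ → ℝ} (hF : ∀ p, 0 ≤ F p) {J I : Finset ℕ}
    (hJ : ∀ i ∈ J, q i ∈ I) : ∑ i ∈ J, F (q i) ≤ ∑ p ∈ I, F p := by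
  classical
  rw [← Finset.sum_image (f := F) fun i _ j _ hij => h.strictMono.injective hij]
  refine Finset.sum_le_sum_of_subset_of_nonneg (fun p hp => ?_) fun p _ _ => hF p
  obtain ⟨i, hi, rfl⟩ := Finset.mem_image.1 hp
  exact hJ i hi

lemma sq_mul_rpow_ge (h : DenseLower μ cμ β q D) (i : ℕ) :
    cμ ^ 2 * (q i : ℝ) ^ (α - 2 * β) ≤ μ (q i) ^ 2 * (q i : ℝ) ^ α := by
  have hq : (0 : ℝ) < q i := by exact_mod_cast (Nat.succ_pos i).trans_le (h.ge i)
  calc cμ ^ 2 * (q i : ℝ) ^ (α - 2 * β) = cμ ^ 2 * (q i : ℝ) ^ (-(2 * β)) * (q i : ℝ) ^ α := by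
        rw [mul_assoc, ← Real.rpow_add hq]; ring_nf
    _ ≤ _ := by
        gcongr
        exact h.sq_le i

lemma exists_signalRate_le (h : DenseLower μ cμ β q D) (hα : 1 < α) (hβα : α ≤ 2 * β - 1) :
    ∃ c : ℝ, 0 < c ∧ ∀ᶠ n : ℕ in Filter.atTop, c * signalRate α β n ≤
      ∑ p ∈ Finset.Icc 1 ⌊(n : ℝ) ^ (1 / (4 * α))⌋₊, μ p ^ 2 * (p : ℝ) ^ α := by
  have hα0 : 0 < α := by positivity
  have hcμ := h.const_pos
  have hF : ∀ p : ℕ, 0 ≤ μ p ^ 2 * (p : ℝ) ^ α := fun p => by positivity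
  rcases hβα.lt_or_eq with hlt | heq
  · have hq : (0 : ℝ) < q 0 := by exact_mod_cast h.ge 0
    refine ⟨cμ ^ 2 * (q 0 : ℝ) ^ (α - 2 * β), by positivity, ?_⟩
    filter_upwards [(tendsto_natCast_rpow (e := 1 / (4 * α)) (by positivity)).eventually_ge_atTop
      (q 0 : ℝ)] with n hn
    rw [signalRate_of_gt hα0 hlt, mul_one]
    refine (h.sq_mul_rpow_ge 0).trans
      (Finset.single_le_sum (f := fun p : ℕ => μ p ^ 2 * (p : ℝ) ^ α) (fun p _ => hF p) ?_)
    exact Finset.mem_Icc.2 ⟨h.ge 0, Nat.le_floor hn⟩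
  · have hD : (0 : ℝ) < D := by exact_mod_cast h.pos
    refine ⟨cμ ^ 2 / D * (1 / (8 * α)), by positivity, ?_⟩
    have hlogt : Filter.Tendsto (fun n : ℕ => 1 / (8 * α) * Real.log n) Filter.atTop
        Filter.atTop :=
      (Real.tendsto_log_atTop.comp (tendsto_natCast_atTop_atTop (R := ℝ))).const_mul_atTop
        (by positivity)
    filter_upwards [hlogt.eventually_ge_atTop (Real.log D), Filter.eventually_ge_atTop 1]
      with n hlog hn
    have hn0 : (0 : ℝ) < n := by exact_mod_cast hn
    rw [signalRate_of_eq heq]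
    set P := ⌊(n : ℝ) ^ (1 / (4 * α))⌋₊ with hP
    set m := P / D with hm
    have h1 : ∑ i ∈ Finset.range m, μ (q i) ^ 2 * (q i : ℝ) ^ α ≤
        ∑ p ∈ Finset.Icc 1 P, μ p ^ 2 * (p : ℝ) ^ α := by
      refine h.sum_comp_le (F := fun p => μ p ^ 2 * (p : ℝ) ^ α) hF fun i hi => ?_
      refine Finset.mem_Icc.2 ⟨(Nat.le_add_left 1 i).trans (h.ge i), (h.le i).trans ?_⟩
      calc D * (i + 1) ≤ D * m := Nat.mul_le_mul_left _ (Finset.mem_range.1 hi)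
        _ ≤ P := Nat.mul_div_le P D
    refine le_trans ?_ h1
    have h2 : ∀ i ∈ Finset.range m, cμ ^ 2 / D * ((i : ℝ) + 1)⁻¹ ≤
        μ (q i) ^ 2 * (q i : ℝ) ^ α := fun i _ => by
      refine le_trans ?_ (h.sq_mul_rpow_ge i)
      rw [show α - 2 * β = -1 by linarith, Real.rpow_neg_one, div_eq_mul_inv, mul_assoc,
        ← mul_inv]
      have hq : (0 : ℝ) < q i := by exact_mod_cast (Nat.succ_pos i).trans_le (h.ge i)
      have hqle : (q i : ℝ) ≤ D * ((i : ℝ) + 1) := by exact_mod_cast h.le i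
      gcongr
    refine le_trans ?_ (Finset.sum_le_sum h2)
    have h3 : ∑ i ∈ Finset.range m, ((i : ℝ) + 1)⁻¹ = (harmonic m : ℝ) := by
      simp [harmonic]
    rw [← Finset.mul_sum, h3, mul_assoc]
    refine mul_le_mul_of_nonneg_left ?_ (by positivity)
    refine le_trans ?_ (log_add_one_le_harmonic m)
    have h4 : (n : ℝ) ^ (1 / (4 * α)) ≤ D * ((m + 1 : ℕ) : ℝ) := by
      have h5 : P + 1 ≤ D * (m + 1) := by
        have h' : P < D * (m + 1) := Nat.lt_mul_div_succ P h.pos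
        omega
      calc (n : ℝ) ^ (1 / (4 * α)) ≤ P + 1 := (Nat.lt_floor_add_one _).le
        _ ≤ _ := by exact_mod_cast h5
    have h6 := Real.log_le_log (by positivity) h4
    rw [Real.log_rpow hn0, Real.log_mul hD.ne' (by positivity)] at h6
    have h7 : 1 / (4 * α) * Real.log n = 1 / (8 * α) * Real.log n + 1 / (8 * α) * Real.log n := by
      field_simp
      ring
    linarith

end DenseLower

variable {Ω : Type*} [MeasurableSpace Ω] {ρ : Measure Ω} [IsProbabilityMeasure ρ]
  {φ : ℕ → Ω → ℝ} {Cφ τ α β c₁ c₂ Cμ cμ : ℝ} {η μ : ℕ → ℝ} {q : ℕ → ℕ} {D : ℕ}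

lemma exists_sum_sq_le (hβ : 1 / 2 < β) (hμ : ∀ p : ℕ, 1 ≤ p → |μ p| ≤ Cμ * (p : ℝ) ^ (-β)) :
    ∃ K : ℝ, 0 < K ∧ ∀ R : ℕ, ∑ p ∈ Finset.Icc 1 R, μ p ^ 2 ≤ K := by
  have hβ0 : 0 < 2 * β - 1 := by linarith
  refine ⟨μ 1 ^ 2 + Cμ ^ 2 * (2 * β - 1)⁻¹ + 1, by positivity, fun R => ?_⟩
  have h1 := sum_Icc_le_add_Ioc (f := fun p => μ p ^ 2) (fun p => sq_nonneg _) 1 R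
  have h2 := sum_Ioc_sq_le hβ hμ le_rfl R
  simp only [Finset.Icc_self, Finset.sum_singleton] at h1
  simp only [Nat.cast_one, Real.one_rpow, mul_one] at h2
  linarith

theorem exists_highProb_le_signal_of_le (H : OrthoSystem ρ φ Cφ τ) (hα : 1 < α)
    (hτ : τ < (α - 1) / 2) (hη : PowerDecay η c₁ c₂ α) (hβ : 1 / 2 < β)
    (hμ : ∀ p : ℕ, 1 ≤ p → |μ p| ≤ Cμ * (p : ℝ) ^ (-β)) (hq : DenseLower μ cμ β q D)
    (hβα : α ≤ 2 * β - 1) {R : ℕ → ℕ}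
    (hR : ∀ᶠ n : ℕ in Filter.atTop, (n : ℝ) ^ (1 / α) ≤ R n) :
    ∃ c : ℝ, 0 < c ∧ HighProb ρ (fun n => {x | c * signalRate α β n ≤
      (fun i => lincomb φ (Finset.Icc 1 (R n)) μ (x i)) ⬝ᵥ
        ((regGram (Finset.Icc 1 (R n)) η (feat φ x))⁻¹ *ᵥ
          (fun i => lincomb φ (Finset.Icc 1 (R n)) μ (x i)))}) := by
  have hα0 : 0 < α := by positivity
  have hCφ := H.const_pos
  have hc₂ := hη.const_pos'
  obtain ⟨s, hs, hS⟩ := hq.exists_signalRate_le hα hβα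
  obtain ⟨K, hK, hμsum⟩ := exists_sum_sq_le hβ hμ
  obtain ⟨L, hL, hηsum⟩ := hη.exists_sum_mul_rpow_le (e := 0) (by linarith)
  simp only [Real.rpow_zero, mul_one] at hηsum
  set P : ℕ → ℕ := fun n => ⌊(n : ℝ) ^ (1 / (4 * α))⌋₊
  set S : ℕ → ℝ := fun n => ∑ p ∈ Finset.Icc 1 (P n), μ p ^ 2 * (p : ℝ) ^ α
  set w : ℕ → ℝ := fun p => μ p * (p : ℝ) ^ α
  set f : ℕ → Ω → ℝ := fun n => lincomb φ (Finset.Icc 1 (R n)) μ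
  set h : ℕ → Ω → ℝ := fun n => lincomb φ (Finset.Icc 1 (P n)) w
  have hfb : ∀ n, BddMeas (f n) := fun n => H.bddMeas_lincomb _ _
  have hhb : ∀ n, BddMeas (h n) := fun n => H.bddMeas_lincomb _ _
  have hPR : ∀ᶠ n : ℕ in Filter.atTop, Finset.Icc 1 (P n) ⊆ Finset.Icc 1 (R n) := by
    filter_upwards [hR, Filter.eventually_ge_atTop 1] with n h1 hn
    refine Finset.Icc_subset_Icc_right ?_
    have h2 : (P n : ℝ) ≤ (n : ℝ) ^ (1 / (4 * α)) := Nat.floor_le (by positivity)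
    have h3 : (n : ℝ) ^ (1 / (4 * α)) ≤ (n : ℝ) ^ (1 / α) :=
      Real.rpow_le_rpow_of_exponent_le (by exact_mod_cast hn)
        (one_div_le_one_div_of_le hα0 (by linarith))
    exact_mod_cast (h2.trans h3).trans h1
  have hhle : ∀ n z, |h n z| ≤ Cφ * Cμ * (n : ℝ) ^ (1 / 4 : ℝ) := fun n z => by
    have hCμ : 0 ≤ Cμ := by simpa using (abs_nonneg _).trans (hμ 1 le_rfl)
    refine (H.abs_lincomb_le (D := Cμ) (e := α - β) (fun p hp => (Finset.mem_Icc.1 hp).1)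
      (fun p hp => ?_) z).trans ?_
    · have hp1 := (Finset.mem_Icc.1 hp).1
      have hp0 : (0 : ℝ) < p := by exact_mod_cast hp1
      rw [abs_mul, abs_of_nonneg (by positivity : 0 ≤ (p : ℝ) ^ α), sub_eq_neg_add,
        Real.rpow_add hp0, ← mul_assoc]
      exact mul_le_mul_of_nonneg_right (hμ p hp1) (by positivity)
    · refine mul_le_mul_of_nonneg_left ?_ (by positivity)
      calc ∑ p ∈ Finset.Icc 1 (P n), (p : ℝ) ^ (α - β + τ)
          ≤ ∑ _p ∈ Finset.Icc 1 (P n), (P n : ℝ) ^ (α - 1) := by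
            refine Finset.sum_le_sum fun p hp => ?_
            rw [Finset.mem_Icc] at hp
            calc (p : ℝ) ^ (α - β + τ) ≤ (p : ℝ) ^ (α - 1) :=
                  Real.rpow_le_rpow_of_exponent_le (by exact_mod_cast hp.1) (by linarith)
              _ ≤ _ := by
                  have : (p : ℝ) ≤ P n := by exact_mod_cast hp.2
                  gcongr
        _ = P n * (P n : ℝ) ^ (α - 1) := by simp
        _ = (P n : ℝ) ^ α := by
            rw [← Real.rpow_one_add' (Nat.cast_nonneg _) (by linarith)]
            ring_nf
        _ ≤ ((n : ℝ) ^ (1 / (4 * α))) ^ α := by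
            gcongr
            exact Nat.floor_le (by positivity)
        _ = _ := by
            rw [← Real.rpow_mul (Nat.cast_nonneg n)]
            congr 1
            field_simp
  set B : ℝ := (Cφ * Cμ) ^ 2
  have hsq : ∀ n : ℕ, 1 ≤ n →
      (Cφ * Cμ * (n : ℝ) ^ (1 / 4 : ℝ)) ^ 2 = B * (n : ℝ) ^ (-(1 / 2) : ℝ) * n := fun n hn => by
    have hn0 : (0 : ℝ) < n := by exact_mod_cast hn
    rw [mul_pow, ← Real.rpow_natCast ((n : ℝ) ^ (1 / 4 : ℝ)), ← Real.rpow_mul hn0.le, mul_assoc]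
    nth_rewrite 3 [← Real.rpow_one (n : ℝ)]
    rw [← Real.rpow_add hn0]
    norm_num [B]
  have hlim : ∀ C : ℝ, Filter.Tendsto (fun n : ℕ => C * (n : ℝ) ^ (-(1 / 2) : ℝ)) Filter.atTop
      (nhds 0) := fun C => by
    have := (tendsto_natCast_rpow_neg (e := -(1 / 2)) (by norm_num)).const_mul C
    rwa [mul_zero] at this
  have hSpos : ∀ᶠ n : ℕ in Filter.atTop, s ≤ S n := by
    filter_upwards [hS, eventually_one_le_signalRate α β] with n h1 h2
    nlinarith
  have hsignal := highProb_fluctuation_single (ρ := ρ) (a := fun n z => h n z * f n z)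
    (fun n => ((hhb n).mul (hfb n)).1) (fun n => ((hhb n).mul (hfb n)).2)
    (t := fun _ => s / 2) (g := fun n : ℕ => B * K * 4 / s ^ 2 * (n : ℝ) ^ (-(1 / 2) : ℝ))
    (by
      filter_upwards [Filter.eventually_ge_atTop 1] with n hn
      refine (integral_mul_sq_le (hhb n) (hfb n) (hhle n)).trans ?_
      rw [H.integral_lincomb_sq, hsq n hn]
      calc B * (n : ℝ) ^ (-(1 / 2) : ℝ) * n * ∑ p ∈ Finset.Icc 1 (R n), μ p ^ 2
          ≤ B * (n : ℝ) ^ (-(1 / 2) : ℝ) * n * K := by gcongr; exact hμsum _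
        _ = _ := by field_simp; ring)
    (Filter.Eventually.of_forall fun _ => by positivity) (hlim _)
  have hfeat := highProb_fluctuation (ρ := ρ) (s := fun n => Finset.Icc 1 (R n))
    (η := fun _ => η) (fun n p hp => (hη.pos (Finset.mem_Icc.1 hp).1).le)
    (a := fun n p z => φ p z * h n z)
    (fun n p => ((H.bddMeas p).mul (hhb n)).1) (fun n p => ((H.bddMeas p).mul (hhb n)).2)
    (t := fun _ => 1) (g := fun n : ℕ => L * B * (n : ℝ) ^ (-(1 / 2) : ℝ))
    (by
      filter_upwards [Filter.eventually_ge_atTop 1] with n hn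
      calc ∑ p ∈ Finset.Icc 1 (R n), η p * ∫ z, (φ p z * h n z) ^ 2 ∂ρ
          ≤ ∑ p ∈ Finset.Icc 1 (R n), η p * (B * (n : ℝ) ^ (-(1 / 2) : ℝ) * n) := by
            refine Finset.sum_le_sum fun p hp => mul_le_mul_of_nonneg_left ?_
              (hη.pos (Finset.mem_Icc.1 hp).1).le
            have := integral_mul_sq_le (ρ := ρ) (hhb n) (H.bddMeas p) (hhle n)
            rw [H.integral_sq, mul_one, hsq n hn] at this
            simpa only [mul_comm (φ p _)] using this
        _ ≤ L * (B * (n : ℝ) ^ (-(1 / 2) : ℝ) * n) := by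
            rw [← Finset.sum_mul]
            gcongr
            exact hηsum _
        _ = _ := by ring)
    (Filter.Eventually.of_forall fun _ => one_pos) (hlim _)
  set E : ℝ := (B + 2) / s + 2 * c₂ with hE
  have hE0 : 0 < E := by positivity
  refine ⟨s / (4 * E), by positivity, (hsignal.inter hfeat).mono ?_⟩
  filter_upwards [hS, hSpos, hPR, Filter.eventually_ge_atTop 1] with n hSn hsn hsub hn x hx
  obtain ⟨hx1, hx2⟩ := hx
  rw [Set.mem_ofPred_eq] at hx1 hx2 ⊢
  have hn0 : (0 : ℝ) < n := by exact_mod_cast hn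
  have hn1 : (1 : ℝ) ≤ n := by exact_mod_cast hn
  have hη0 : ∀ p ∈ Finset.Icc 1 (R n), 0 ≤ η p := fun p hp => (hη.pos (Finset.mem_Icc.1 hp).1).le
  set u : Fin n → ℝ := (n : ℝ)⁻¹ • fun i => h n (x i) with hu
  have hfu : S n / 2 ≤ (fun i => f n (x i)) ⬝ᵥ u := by
    have h1 : (fun i => f n (x i)) ⬝ᵥ u = empMean (fun z => h n z * f n z) x := by
      rw [hu, dotProduct_smul, smul_eq_mul, empMean, div_eq_inv_mul]
      simp only [dotProduct, mul_comm]
    have h2 : ∫ z, h n z * f n z ∂ρ = S n := by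
      simp only [mul_comm (h n _)]
      rw [H.integral_lincomb_mul_lincomb hsub]
      exact Finset.sum_congr rfl fun p _ => by simp only [w]; ring
    rw [h2] at hx1
    rw [h1]
    linarith [(abs_le.1 hx1).1]
  have huu : u ⬝ᵥ u ≤ B := by
    have h1 : u ⬝ᵥ u = (n : ℝ)⁻¹ * empMean (fun z => h n z ^ 2) x := by
      rw [hu, dotProduct_smul, smul_dotProduct, empMean, div_eq_inv_mul]
      simp only [dotProduct, smul_eq_mul, _root_.sq]
    have h2 : empMean (fun z => h n z ^ 2) x ≤ B * (n : ℝ) ^ (-(1 / 2) : ℝ) * n := by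
      refine empMean_le_of_le (by omega) (fun z => ?_) x
      rw [← hsq n hn, ← sq_abs]
      exact pow_le_pow_left₀ (abs_nonneg _) (hhle n z) 2
    have h3 : (n : ℝ) ^ (-(1 / 2) : ℝ) ≤ 1 := Real.rpow_le_one_of_one_le_of_nonpos hn1 (by norm_num)
    calc u ⬝ᵥ u ≤ (n : ℝ)⁻¹ * (B * (n : ℝ) ^ (-(1 / 2) : ℝ) * n) := by rw [h1]; gcongr
      _ = B * (n : ℝ) ^ (-(1 / 2) : ℝ) := by field_simp
      _ ≤ B := mul_le_of_le_one_right (by positivity) h3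
  have hbu : ∑ p ∈ Finset.Icc 1 (R n), η p * (feat φ x p ⬝ᵥ u) ^ 2 ≤ 2 + 2 * c₂ * S n := by
    have h1 : ∀ p, feat φ x p ⬝ᵥ u = empMean (fun z => φ p z * h n z) x := fun p => by
      rw [hu, dotProduct_smul, feat_dotProduct_apply (by omega), smul_eq_mul,
        inv_mul_cancel_left₀ hn0.ne']
    have h2 : ∀ p, ∫ z, φ p z * h n z ∂ρ = if p ∈ Finset.Icc 1 (P n) then w p else 0 := fun p =>
      H.integral_mul_lincomb p _ w
    simp only [h2] at hx2
    have h3 : ∑ p ∈ Finset.Icc 1 (R n), η p * (if p ∈ Finset.Icc 1 (P n) then w p else 0) ^ 2 ≤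
        c₂ * S n := by
      have h4 : ∑ p ∈ Finset.Icc 1 (R n), η p * (if p ∈ Finset.Icc 1 (P n) then w p else 0) ^ 2 =
          ∑ p ∈ Finset.Icc 1 (P n), η p * w p ^ 2 := by
        rw [← Finset.sum_subset hsub fun p _ hp => by simp only [if_neg hp]; ring]
        exact Finset.sum_congr rfl fun p hp => by rw [if_pos hp]
      rw [h4, Finset.mul_sum]
      refine Finset.sum_le_sum fun p hp => ?_
      have hp1 := (Finset.mem_Icc.1 hp).1
      have hp0 : (0 : ℝ) < p := by exact_mod_cast hp1
      calc η p * w p ^ 2 ≤ c₂ * (p : ℝ) ^ (-α) * w p ^ 2 := by gcongr; exact hη.upper p hp1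
        _ = c₂ * (μ p ^ 2 * (p : ℝ) ^ α) := by
            have h5 : (p : ℝ) ^ α ≠ 0 := by positivity
            rw [Real.rpow_neg hp0.le]
            simp only [w]
            field_simp
    have h6 : ∀ p ∈ Finset.Icc 1 (R n), η p * (feat φ x p ⬝ᵥ u) ^ 2 ≤
        2 * (η p * (empMean (fun z => φ p z * h n z) x -
          if p ∈ Finset.Icc 1 (P n) then w p else 0) ^ 2) +
        2 * (η p * (if p ∈ Finset.Icc 1 (P n) then w p else 0) ^ 2) := fun p hp => by
      rw [h1]
      set y := empMean (fun z => φ p z * h n z) x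
      set v := if p ∈ Finset.Icc 1 (P n) then w p else 0
      nlinarith [hη0 p hp, mul_nonneg (hη0 p hp) (sq_nonneg (y - 2 * v))]
    refine (Finset.sum_le_sum h6).trans ?_
    rw [Finset.sum_add_distrib, ← Finset.mul_sum, ← Finset.mul_sum]
    linarith
  have hSn0 : 0 < S n := hs.trans_le hsn
  have hB : u ⬝ᵥ u + ∑ p ∈ Finset.Icc 1 (R n), η p * (feat φ x p ⬝ᵥ u) ^ 2 ≤ E * S n := by
    have : B + 2 ≤ (B + 2) / s * S n := by
      rw [div_mul_eq_mul_div, le_div_iff₀ hs]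
      gcongr
    rw [hE, add_mul]
    linarith
  have hfinal := div_le_dotProduct_regGram_inv hη0 (feat φ x) (fun i => f n (x i)) u
    (by positivity : 0 ≤ S n / 2) (by positivity) hfu hB
  refine le_trans ?_ hfinal
  calc s / (4 * E) * signalRate α β n = s * signalRate α β n / (4 * E) := by ring
    _ ≤ S n / (4 * E) := by gcongr
    _ = (S n / 2) ^ 2 / (E * S n) := by field_simp; norm_num

end SignalLower

/-! ### Lower bound for the signal term: the growing regime -/

section SignalLowerGrowing

variable {Ω : Type*} {φ : ℕ → Ω → ℝ}

lemma empMean_mul_lincomb {n : ℕ} (a : Ω → ℝ) (s : Finset ℕ) (w : ℕ → ℝ) (x : Fin n → Ω) :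
    empMean (fun z => a z * lincomb φ s w z) x =
      ∑ p ∈ s, w p * empMean (fun z => φ p z * a z) x := by
  have h1 : (fun z => a z * lincomb φ s w z) = fun z => ∑ p ∈ s, w p * (φ p z * a z) := by
    funext z
    rw [lincomb, Finset.mul_sum]
    exact Finset.sum_congr rfl fun p _ => by ring
  rw [h1, empMean_sum]
  exact Finset.sum_congr rfl fun p _ => empMean_const_mul _ _ _

lemma lincomb_sq_le {s : Finset ℕ} {w : ℕ → ℝ} {Z G : ℝ} (hZ : ∑ p ∈ s, w p ^ 2 ≤ Z) {z : Ω}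
    (hG : ∑ p ∈ s, φ p z ^ 2 ≤ G) : lincomb φ s w z ^ 2 ≤ Z * G := by
  refine (Finset.sum_mul_sq_le_sq_mul_sq s w fun p => φ p z).trans ?_
  have h1 : 0 ≤ ∑ p ∈ s, φ p z ^ 2 := Finset.sum_nonneg fun p _ => sq_nonneg _
  have h2 : 0 ≤ ∑ p ∈ s, w p ^ 2 := Finset.sum_nonneg fun p _ => sq_nonneg _
  gcongr
  exact h2.trans hZ

/-- The feature `p` tested against a block function `h`, corrected by its empirical projection on
the first `L` features. -/
lemma sum_mul_empMean_corrected_sq_le {η μ : ℕ → ℝ} {n L R : ℕ} {x : Fin n → Ω} {I : Finset ℕ}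
    {h : Ω → ℝ} {Z Γ B V : ℝ} (hη : ∀ p ∈ Finset.Icc 1 R, 0 ≤ η p)
    (hI : I ⊆ Finset.Ioc L R)
    (hZ : ∑ q ∈ Finset.Icc 1 L, empMean (fun z => φ q z * h z) x ^ 2 ≤ Z)
    (hB : ∑ p ∈ Finset.Ioc L R, η p * (empMean (fun z => φ p z * h z) x -
      if p ∈ I then μ p else 0) ^ 2 ≤ B)
    (hV : ∑ p ∈ I, η p * μ p ^ 2 ≤ V)
    (hΓ : ∑ p ∈ Finset.Icc 1 R, η p * ∑ q ∈ Finset.Icc 1 L,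
      (empMean (fun z => φ p z * φ q z) x - if p = q then 1 else 0) ^ 2 ≤ Γ) :
    ∑ p ∈ Finset.Icc 1 R, η p * (empMean (fun z => φ p z * h z) x -
      ∑ q ∈ Finset.Icc 1 L, empMean (fun z => φ q z * h z) x *
        empMean (fun z => φ p z * φ q z) x) ^ 2 ≤ 3 * (B + V + Z * Γ) := by
  classical
  set y : ℕ → ℝ := fun q => empMean (fun z => φ q z * h z) x
  set d : ℕ → ℕ → ℝ := fun p q => empMean (fun z => φ p z * φ q z) x - if p = q then 1 else 0
  set v : ℕ → ℝ := fun p => if p ∈ I then μ p else 0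
  set r : ℕ → ℝ := fun p => if p ∈ Finset.Ioc L R then y p - v p else 0
  have hsub : Finset.Ioc L R ⊆ Finset.Icc 1 R := fun p hp => by
    rw [Finset.mem_Ioc] at hp
    rw [Finset.mem_Icc]
    omega
  have hdecomp : ∀ p ∈ Finset.Icc 1 R, y p - ∑ q ∈ Finset.Icc 1 L, y q *
      empMean (fun z => φ p z * φ q z) x = r p + v p - ∑ q ∈ Finset.Icc 1 L, y q * d p q := by
    intro p hp
    have h1 : ∑ q ∈ Finset.Icc 1 L, y q * d p q = ∑ q ∈ Finset.Icc 1 L, y q *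
        empMean (fun z => φ p z * φ q z) x - if p ∈ Finset.Icc 1 L then y p else 0 := by
      simp only [d, mul_sub, Finset.sum_sub_distrib, mul_ite, mul_one, mul_zero,
        Finset.sum_ite_eq]
    rw [h1]
    by_cases hpL : p ∈ Finset.Icc 1 L
    · have h2 : p ∉ Finset.Ioc L R := fun h3 =>
        absurd (Finset.mem_Icc.1 hpL).2 (Finset.mem_Ioc.1 h3).1.not_ge
      simp only [r, v, if_pos hpL, if_neg h2, if_neg fun h3 => h2 (hI h3)]
      ring
    · have h2 : p ∈ Finset.Ioc L R := by
        rw [Finset.mem_Icc] at hp hpL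
        rw [Finset.mem_Ioc]
        omega
      simp only [r, if_neg hpL, if_pos h2]
      ring
  have hterm : ∀ p ∈ Finset.Icc 1 R, η p * (y p - ∑ q ∈ Finset.Icc 1 L, y q *
      empMean (fun z => φ p z * φ q z) x) ^ 2 ≤
      3 * (η p * r p ^ 2 + η p * v p ^ 2 + Z * (η p * ∑ q ∈ Finset.Icc 1 L, d p q ^ 2)) := by
    intro p hp
    rw [hdecomp p hp]
    set e := ∑ q ∈ Finset.Icc 1 L, y q * d p q
    have h1 : e ^ 2 ≤ Z * ∑ q ∈ Finset.Icc 1 L, d p q ^ 2 :=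
      (Finset.sum_mul_sq_le_sq_mul_sq _ _ _).trans
        (mul_le_mul_of_nonneg_right hZ (Finset.sum_nonneg fun q _ => sq_nonneg _))
    have h2 : (r p + v p - e) ^ 2 ≤
        3 * (r p ^ 2 + v p ^ 2 + Z * ∑ q ∈ Finset.Icc 1 L, d p q ^ 2) := by
      nlinarith [sq_nonneg (r p - v p), sq_nonneg (r p + e), sq_nonneg (v p + e)]
    refine (mul_le_mul_of_nonneg_left h2 (hη p hp)).trans_eq ?_
    ring
  refine (Finset.sum_le_sum hterm).trans ?_
  rw [← Finset.mul_sum, Finset.sum_add_distrib, Finset.sum_add_distrib, ← Finset.mul_sum]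
  have hr : ∑ p ∈ Finset.Icc 1 R, η p * r p ^ 2 ≤ B := by
    rw [← Finset.sum_subset hsub fun p _ hp => by simp only [r, if_neg hp]; ring]
    refine le_of_eq_of_le (Finset.sum_congr rfl fun p hp => ?_) hB
    simp only [r, if_pos hp, y, v]
  have hv : ∑ p ∈ Finset.Icc 1 R, η p * v p ^ 2 ≤ V := by
    rw [← Finset.sum_subset (hI.trans hsub) fun p _ hp => by simp only [v, if_neg hp]; ring]
    refine le_of_eq_of_le (Finset.sum_congr rfl fun p hp => ?_) hV
    simp only [v, if_pos hp]
  have hZ0 : 0 ≤ Z := (Finset.sum_nonneg fun q _ => sq_nonneg _).trans hZ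
  have := mul_le_mul_of_nonneg_left hΓ hZ0
  linarith

lemma le_signal_of_empMean {η μ : ℕ → ℝ} {n L R : ℕ} (hn : 1 ≤ n) {x : Fin n → Ω} {I : Finset ℕ}
    {f h : Ω → ℝ} {W Z Y Γ G V A : ℝ} (hη : ∀ p ∈ Finset.Icc 1 R, 0 ≤ η p)
    (hI : I ⊆ Finset.Ioc L R) (hW : 0 < W) (hA : 0 ≤ A)
    (hfh : 3 / 4 * W ≤ empMean (fun z => f z * h z) x)
    (hhh : empMean (fun z => h z * h z) x ≤ 2 * W)
    (hZ : ∑ q ∈ Finset.Icc 1 L, empMean (fun z => φ q z * h z) x ^ 2 ≤ Z)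
    (hY : ∑ q ∈ Finset.Icc 1 L, empMean (fun z => φ q z * f z) x ^ 2 ≤ Y)
    (hB : ∑ p ∈ Finset.Ioc L R, η p * (empMean (fun z => φ p z * h z) x -
      if p ∈ I then μ p else 0) ^ 2 ≤ W / n)
    (hV : ∑ p ∈ I, η p * μ p ^ 2 ≤ V * (W / n))
    (hΓ : ∑ p ∈ Finset.Icc 1 R, η p * ∑ q ∈ Finset.Icc 1 L,
      (empMean (fun z => φ p z * φ q z) x - if p = q then 1 else 0) ^ 2 ≤ Γ)
    (hG : ∀ z, ∑ q ∈ Finset.Icc 1 L, φ q z ^ 2 ≤ G) (hV0 : 0 ≤ V)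
    (hZY : Z * Y ≤ (W / 4) ^ 2) (hZG : Z * G ≤ W) (hZΓ : Z * Γ ≤ A * (W / n)) :
    n * W / (4 * (9 + 3 * V + 3 * A)) ≤ (fun i => f (x i)) ⬝ᵥ
      ((regGram (Finset.Icc 1 R) η (feat φ x))⁻¹ *ᵥ (fun i => f (x i))) := by
  have hn0 : (0 : ℝ) < n := by exact_mod_cast hn
  set y : ℕ → ℝ := fun q => empMean (fun z => φ q z * h z) x
  set g : Ω → ℝ := lincomb φ (Finset.Icc 1 L) y
  set u : Fin n → ℝ := (n : ℝ)⁻¹ • fun i => h (x i) - g (x i) with hu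
  have hau : ∀ a : Ω → ℝ, (fun i => a (x i)) ⬝ᵥ u = empMean (fun z => a z * h z) x -
      ∑ q ∈ Finset.Icc 1 L, y q * empMean (fun z => φ q z * a z) x := fun a => by
    rw [← empMean_mul_lincomb, hu, dotProduct_smul, smul_eq_mul, empMean, empMean, ← sub_div,
      ← Finset.sum_sub_distrib, div_eq_inv_mul]
    simp only [dotProduct, mul_sub, g]
  have hfu : W / 2 ≤ (fun i => f (x i)) ⬝ᵥ u := by
    rw [hau]
    have h1 : (∑ q ∈ Finset.Icc 1 L, y q * empMean (fun z => φ q z * f z) x) ^ 2 ≤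
        (W / 4) ^ 2 := by
      refine (Finset.sum_mul_sq_le_sq_mul_sq _ _ _).trans (le_trans ?_ hZY)
      gcongr
      exact (Finset.sum_nonneg fun q _ => sq_nonneg (y q)).trans hZ
    have h2 := (abs_le.1 (abs_le_of_sq_le_sq h1 (by positivity))).2
    linarith
  have huu : u ⬝ᵥ u ≤ 6 * (W / n) := by
    have h1 : u ⬝ᵥ u = (n : ℝ)⁻¹ * empMean (fun z => (h z - g z) ^ 2) x := by
      rw [hu, dotProduct_smul, smul_dotProduct, empMean, div_eq_inv_mul]
      simp only [dotProduct, smul_eq_mul, _root_.sq]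
    have h2 : empMean (fun z => (h z - g z) ^ 2) x ≤
        2 * empMean (fun z => h z * h z) x + 2 * empMean (fun z => g z ^ 2) x := by
      rw [← empMean_const_mul, ← empMean_const_mul, ← empMean_add]
      exact empMean_mono (fun z => by nlinarith [sq_nonneg (h z + g z)]) x
    have h3 : empMean (fun z => g z ^ 2) x ≤ W :=
      (empMean_le_of_le (by omega) (fun z => lincomb_sq_le hZ (hG z)) x).trans hZG
    rw [h1, inv_mul_eq_div, ← mul_div_assoc]
    gcongr
    linarith
  have hbu := sum_mul_empMean_corrected_sq_le hη hI hZ hB hV hΓ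
  have hbu' : ∑ p ∈ Finset.Icc 1 R, η p * (feat φ x p ⬝ᵥ u) ^ 2 ≤
      3 * (W / n + V * (W / n) + Z * Γ) := by
    refine le_of_eq_of_le (Finset.sum_congr rfl fun p _ => ?_) hbu
    congr 2
    refine (hau (φ p)).trans ?_
    simp only [y, mul_comm (φ p _)]
  have hfinal := div_le_dotProduct_regGram_inv hη (feat φ x) (fun i => f (x i)) u
    (by positivity : 0 ≤ W / 2) (B := (9 + 3 * V + 3 * A) * (W / n)) (by positivity) hfu
    (by linarith)
  refine le_of_eq_of_le ?_ hfinal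
  field_simp
  norm_num

end SignalLowerGrowing

section SignalLowerGrowing

lemma DenseLower.exists_signalRate_le_block {μ : ℕ → ℝ} {cμ α β : ℝ} {q : ℕ → ℕ} {D : ℕ}
    (h : DenseLower μ cμ β q D) (hα : 1 < α) (hβ : 1 / 2 < β) (hβα : 2 * β - 1 < α) :
    ∃ c : ℝ, 0 < c ∧ ∀ᶠ n : ℕ in Filter.atTop, c * signalRate α β n ≤
      n * ∑ p ∈ Finset.Ioc ⌈(n : ℝ) ^ (1 / α)⌉₊ (2 * D * ⌈(n : ℝ) ^ (1 / α)⌉₊), μ p ^ 2 := by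
  have hα0 : 0 < α := by positivity
  have hcμ := h.const_pos
  have hD : (0 : ℝ) < D := by exact_mod_cast h.pos
  refine ⟨cμ ^ 2 * (2 * D : ℝ) ^ (-(2 * β)) * 2 ^ (1 - 2 * β), by positivity, ?_⟩
  filter_upwards [Filter.eventually_ge_atTop 1] with n hn
  have hn0 : (0 : ℝ) < n := by exact_mod_cast hn
  have hP0 : (0 : ℝ) < (⌈(n : ℝ) ^ (1 / α)⌉₊ : ℝ) := by
    exact_mod_cast Nat.ceil_pos.2 (by positivity)
  have hP2 := ceil_natCast_rpow_le (e := 1 / α) (by positivity) hn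
  set P := ⌈(n : ℝ) ^ (1 / α)⌉₊
  rw [signalRate_of_lt hα0 hβα]
  have h1 : ∑ i ∈ Finset.Ico P (2 * P), μ (q i) ^ 2 ≤ ∑ p ∈ Finset.Ioc P (2 * D * P), μ p ^ 2 := by
    refine h.sum_comp_le (F := fun p => μ p ^ 2) (fun p => sq_nonneg _) fun i hi => ?_
    rw [Finset.mem_Ico] at hi
    have h2 := h.ge i
    refine Finset.mem_Ioc.2 ⟨by omega, (h.le i).trans ?_⟩
    calc D * (i + 1) ≤ D * (2 * P) := Nat.mul_le_mul_left _ (by omega)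
      _ = 2 * D * P := by ring
  have h2 : ∀ i ∈ Finset.Ico P (2 * P), cμ ^ 2 * (2 * D * P : ℝ) ^ (-(2 * β)) ≤ μ (q i) ^ 2 := by
    intro i hi
    rw [Finset.mem_Ico] at hi
    refine le_trans ?_ (h.sq_le i)
    have hq0 : (0 : ℝ) < q i := by exact_mod_cast (Nat.succ_pos i).trans_le (h.ge i)
    have hq : (q i : ℝ) ≤ 2 * D * P := by
      have h3 : D * (i + 1) ≤ D * (2 * P) := Nat.mul_le_mul_left _ (by omega)
      have h4 : q i ≤ 2 * D * P := (h.le i).trans (h3.trans_eq (by ring))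
      exact_mod_cast h4
    exact mul_le_mul_of_nonneg_left
      (Real.rpow_le_rpow_of_nonpos hq0 hq (by linarith)) (by positivity)
  have h3 := (Finset.sum_le_sum h2).trans h1
  rw [Finset.sum_const, Nat.card_Ico, nsmul_eq_mul, show 2 * P - P = P by omega] at h3
  have h4 : (2 * (n : ℝ) ^ (1 / α)) ^ (1 - 2 * β) ≤ (P : ℝ) ^ (1 - 2 * β) :=
    Real.rpow_le_rpow_of_nonpos hP0 hP2 (by linarith)
  rw [Real.mul_rpow (by norm_num) (by positivity), ← Real.rpow_mul hn0.le] at h4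
  have h5 : (P : ℝ) * (cμ ^ 2 * (2 * D * P : ℝ) ^ (-(2 * β))) =
      cμ ^ 2 * (2 * D : ℝ) ^ (-(2 * β)) * (P : ℝ) ^ (1 - 2 * β) := by
    rw [Real.mul_rpow (by positivity) hP0.le, sub_eq_add_neg, Real.rpow_one_add' hP0.le]
    · ring
    · linarith
  rw [h5] at h3
  calc cμ ^ 2 * (2 * D : ℝ) ^ (-(2 * β)) * 2 ^ (1 - 2 * β) * (n : ℝ) ^ (1 + (1 - 2 * β) / α)
      = n * (cμ ^ 2 * (2 * D : ℝ) ^ (-(2 * β)) *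
          (2 ^ (1 - 2 * β) * (n : ℝ) ^ (1 / α * (1 - 2 * β)))) := by
        rw [Real.rpow_add hn0, Real.rpow_one, one_div_mul_eq_div]
        ring
    _ ≤ n * (cμ ^ 2 * (2 * D : ℝ) ^ (-(2 * β)) * (P : ℝ) ^ (1 - 2 * β)) := by gcongr
    _ ≤ _ := by gcongr

lemma eventually_two_mul_mul_ceil_le {α κ : ℝ} (hα : 0 < α) (hκ : 0 < κ) (D : ℕ) {R : ℕ → ℕ}
    (hR : ∀ᶠ n : ℕ in Filter.atTop, (n : ℝ) ^ (1 / α + κ) ≤ R n) :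
    ∀ᶠ n : ℕ in Filter.atTop, 2 * D * ⌈(n : ℝ) ^ (1 / α)⌉₊ ≤ R n := by
  filter_upwards [hR, Filter.eventually_ge_atTop 1,
    (tendsto_natCast_rpow hκ).eventually_ge_atTop (4 * D : ℝ)] with n h1 hn h2
  have hn0 : (0 : ℝ) < n := by exact_mod_cast hn
  have h3 := ceil_natCast_rpow_le (e := 1 / α) (by positivity) hn
  have : (2 * D * ⌈(n : ℝ) ^ (1 / α)⌉₊ : ℝ) ≤ R n := by
    calc (2 * D * ⌈(n : ℝ) ^ (1 / α)⌉₊ : ℝ) ≤ 2 * D * (2 * (n : ℝ) ^ (1 / α)) := by gcongr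
      _ = 4 * D * (n : ℝ) ^ (1 / α) := by ring
      _ ≤ (n : ℝ) ^ κ * (n : ℝ) ^ (1 / α) := by gcongr
      _ = (n : ℝ) ^ (1 / α + κ) := by rw [← Real.rpow_add hn0, add_comm]
      _ ≤ _ := h1
  exact_mod_cast this

end SignalLowerGrowing

section SignalLowerGrowing

variable {Ω : Type*} [MeasurableSpace Ω] {ρ : Measure Ω} [IsProbabilityMeasure ρ]
  {φ : ℕ → Ω → ℝ} {Cφ τ α β κ c₁ c₂ Cμ cμ : ℝ} {η μ : ℕ → ℝ} {q : ℕ → ℕ} {D : ℕ}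

lemma OrthoSystem.exists_low_mode_bound (H : OrthoSystem ρ φ Cφ τ) (L : ℕ) :
    ∃ G : ℝ, 0 ≤ G ∧ (∀ z, ∑ q ∈ Finset.Icc 1 L, φ q z ^ 2 ≤ G) ∧
      ∀ b : Ω → ℝ, BddMeas b →
        ∑ q ∈ Finset.Icc 1 L, ∫ z, (φ q z * b z) ^ 2 ∂ρ ≤ G * ∫ z, b z ^ 2 ∂ρ := by
  refine ⟨∑ q ∈ Finset.Icc 1 L, Cφ ^ 2 * (q : ℝ) ^ (2 * τ),
    Finset.sum_nonneg fun q _ => by positivity, fun z => ?_, fun b hb => ?_⟩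
  · refine Finset.sum_le_sum fun q hq => ?_
    have := pow_le_pow_left₀ (abs_nonneg _) (H.bound q (Finset.mem_Icc.1 hq).1 z) 2
    rwa [sq_abs, mul_pow, ← Real.rpow_natCast ((q : ℝ) ^ τ),
      ← Real.rpow_mul (Nat.cast_nonneg q), mul_comm τ] at this
  · rw [Finset.sum_mul]
    exact Finset.sum_le_sum fun q hq => H.integral_mul_sq_le (Finset.mem_Icc.1 hq).1 hb

lemma highProb_low_mode_fluctuation (H : OrthoSystem ρ φ Cφ τ) (L : ℕ) {b : ℕ → Ω → ℝ}
    (hb : ∀ n, BddMeas (b n)) {t : ℕ → ℝ} (ht : ∀ᶠ n in Filter.atTop, 0 < t n)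
    (hlim : Filter.Tendsto (fun n : ℕ => (∫ z, b n z ^ 2 ∂ρ) / (n * t n)) Filter.atTop (nhds 0)) :
    HighProb ρ (fun n => {x | ∑ q ∈ Finset.Icc 1 L,
      (empMean (fun z => φ q z * b n z) x - ∫ z, φ q z * b n z ∂ρ) ^ 2 ≤ t n}) := by
  obtain ⟨G, -, -, hG⟩ := H.exists_low_mode_bound L
  have := highProb_fluctuation (ρ := ρ) (s := fun _ => Finset.Icc 1 L)
    (η := fun _ _ => 1) (fun _ _ _ => zero_le_one) (a := fun n q z => φ q z * b n z)
    (fun n q => ((H.bddMeas q).mul (hb n)).1) (fun n q => ((H.bddMeas q).mul (hb n)).2)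
    (t := t) (g := fun n => G * ((∫ z, b n z ^ 2 ∂ρ) / (n * t n)))
    (by
      filter_upwards [ht, Filter.eventually_ge_atTop 1] with n htn hn
      simp only [one_mul]
      refine (hG _ (hb n)).trans_eq ?_
      field_simp)
    ht (by simpa using hlim.const_mul G)
  simpa only [one_mul] using this

lemma highProb_gram_fluctuation (H : OrthoSystem ρ φ Cφ τ) (hα : 1 < α)
    (hη : PowerDecay η c₁ c₂ α) (R : ℕ → ℕ) (L : ℕ) :
    HighProb ρ (fun n => {x | ∑ p ∈ Finset.Icc 1 (R n), η p * ∑ q ∈ Finset.Icc 1 L,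
      (empMean (fun z => φ p z * φ q z) x - if p = q then 1 else 0) ^ 2 ≤ 1 / √(n : ℝ)}) := by
  obtain ⟨G, hG0, -, hG⟩ := H.exists_low_mode_bound L
  obtain ⟨K, hK, hηsum⟩ := hη.exists_sum_mul_rpow_le (e := 0) (by linarith)
  simp only [Real.rpow_zero, mul_one] at hηsum
  have hη0 : ∀ n, ∀ p ∈ Finset.Icc 1 (R n), 0 ≤ η p :=
    fun n p hp => (hη.pos (Finset.mem_Icc.1 hp).1).le
  have := highProb_fluctuation (ρ := ρ)
    (s := fun n => Finset.Icc 1 (R n) ×ˢ Finset.Icc 1 L) (η := fun _ pq => η pq.1)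
    (fun n pq hpq => hη0 n _ (Finset.mem_product.1 hpq).1)
    (a := fun _ pq z => φ pq.1 z * φ pq.2 z)
    (fun n pq => ((H.bddMeas pq.1).mul (H.bddMeas pq.2)).1)
    (fun n pq => ((H.bddMeas pq.1).mul (H.bddMeas pq.2)).2)
    (t := fun n => 1 / √(n : ℝ)) (g := fun n : ℕ => K * G / √(n : ℝ))
    (by
      filter_upwards [Filter.eventually_ge_atTop 1] with n hn
      have h1 : √(n : ℝ) * √(n : ℝ) = n := Real.mul_self_sqrt (by positivity)
      have h2 : 0 < √(n : ℝ) := by positivity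
      rw [Finset.sum_product]
      calc ∑ p ∈ Finset.Icc 1 (R n), ∑ q ∈ Finset.Icc 1 L, η p * ∫ z, (φ p z * φ q z) ^ 2 ∂ρ
          ≤ ∑ p ∈ Finset.Icc 1 (R n), η p * G := by
            refine Finset.sum_le_sum fun p hp => ?_
            rw [← Finset.mul_sum]
            refine mul_le_mul_of_nonneg_left ?_ (hη0 n p hp)
            have h3 := hG _ (H.bddMeas p)
            rw [H.integral_sq, mul_one] at h3
            simpa only [mul_comm (φ p _)] using h3
        _ ≤ K * G := by
            rw [← Finset.sum_mul]
            exact mul_le_mul_of_nonneg_right (hηsum _) hG0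
        _ = K * G / √(n : ℝ) * (n * (1 / √(n : ℝ))) := by
            field_simp
            rw [_root_.sq, h1])
    (by
      filter_upwards [Filter.eventually_ge_atTop 1] with n hn
      positivity)
    ((Real.tendsto_sqrt_atTop.comp tendsto_natCast_atTop_atTop).const_div_atTop _)
  simpa only [H.orth, Finset.sum_product, Finset.mul_sum] using this

lemma exists_eventuallyProb_tail_fluctuation (H : OrthoSystem ρ φ Cφ τ)
    (hτ : τ < (α - 1) / 2) (hη : PowerDecay η c₁ c₂ α) {δ : ℝ} (hδ : 0 < δ) {b : ℕ → Ω → ℝ}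
    (hb : ∀ n, BddMeas (b n)) (hb0 : ∀ᶠ n in Filter.atTop, 0 < ∫ z, b n z ^ 2 ∂ρ) (R : ℕ → ℕ) :
    ∃ L : ℕ, 1 ≤ L ∧ EventuallyProb ρ δ (fun n => {x | ∑ p ∈ Finset.Ioc L (R n),
      η p * (empMean (fun z => φ p z * b n z) x - ∫ z, φ p z * b n z ∂ρ) ^ 2 ≤
        (∫ z, b n z ^ 2 ∂ρ) / n}) := by
  have hCφ := H.const_pos
  have hc₂ := hη.const_pos'
  obtain ⟨L, hL, htail⟩ := exists_sum_Ioc_rpow_neg_le (s := α - 2 * τ) (by linarith)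
    (ε := δ / (c₂ * Cφ ^ 2)) (by positivity)
  have hp1 : ∀ {n p}, p ∈ Finset.Ioc L (R n) → 1 ≤ p := fun hp =>
    hL.trans (Finset.mem_Ioc.1 hp).1.le
  refine ⟨L, hL, eventuallyProb_fluctuation (ρ := ρ) (s := fun n => Finset.Ioc L (R n))
    (η := fun _ => η) (fun n p hp => (hη.pos (hp1 hp)).le) (a := fun n p z => φ p z * b n z)
    (fun n p => ((H.bddMeas p).mul (hb n)).1) (fun n p => ((H.bddMeas p).mul (hb n)).2)
    (t := fun n => (∫ z, b n z ^ 2 ∂ρ) / n) ?_ ?_⟩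
  · filter_upwards [hb0, Filter.eventually_ge_atTop 1] with n hW hn
    rw [mul_div_cancel₀ _ (by positivity)]
    set W := ∫ z, b n z ^ 2 ∂ρ
    calc ∑ p ∈ Finset.Ioc L (R n), η p * ∫ z, (φ p z * b n z) ^ 2 ∂ρ
        ≤ ∑ p ∈ Finset.Ioc L (R n), Cφ ^ 2 * W * (c₂ * (p : ℝ) ^ (-(α - 2 * τ))) := by
          refine Finset.sum_le_sum fun p hp => ?_
          calc η p * ∫ z, (φ p z * b n z) ^ 2 ∂ρ
              ≤ η p * (Cφ ^ 2 * (p : ℝ) ^ (2 * τ) * W) :=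
                mul_le_mul_of_nonneg_left (H.integral_mul_sq_le (hp1 hp) (hb n))
                  (hη.pos (hp1 hp)).le
            _ = Cφ ^ 2 * W * (η p * (p : ℝ) ^ (2 * τ)) := by ring
            _ ≤ _ := mul_le_mul_of_nonneg_left (hη.mul_rpow_le _ (hp1 hp)) (by positivity)
      _ = Cφ ^ 2 * W * c₂ * ∑ p ∈ Finset.Ioc L (R n), (p : ℝ) ^ (-(α - 2 * τ)) := by
          rw [Finset.mul_sum]
          exact Finset.sum_congr rfl fun p _ => by ring
      _ ≤ Cφ ^ 2 * W * c₂ * (δ / (c₂ * Cφ ^ 2)) := by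
          gcongr
          exact htail _
      _ = δ * W := by field_simp
  · filter_upwards [hb0, Filter.eventually_ge_atTop 1] with n hW hn
    positivity

lemma highProb_mean_mul_fluctuation {a b : ℕ → Ω → ℝ} (ha : ∀ n, BddMeas (a n))
    (hb : ∀ n, BddMeas (b n)) {M W : ℕ → ℝ} (hM : ∀ᶠ n in Filter.atTop, ∀ z, |a n z| ≤ M n)
    (hbW : ∀ n, ∫ z, b n z ^ 2 ∂ρ = W n) (hW : ∀ᶠ n in Filter.atTop, 0 < W n)
    (hlim : Filter.Tendsto (fun n : ℕ => M n ^ 2 / (n * W n)) Filter.atTop (nhds 0)) {θ : ℝ}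
    (hθ : 0 < θ) :
    HighProb ρ (fun n => {x | |empMean (fun z => a n z * b n z) x - ∫ z, a n z * b n z ∂ρ| ≤
      θ * W n}) :=
  highProb_fluctuation_single (ρ := ρ) (a := fun n z => a n z * b n z)
    (fun n => ((ha n).mul (hb n)).1) (fun n => ((ha n).mul (hb n)).2)
    (t := fun n => θ * W n) (g := fun n => 1 / θ ^ 2 * (M n ^ 2 / (n * W n)))
    (by
      filter_upwards [hW, hM, Filter.eventually_ge_atTop 1] with n hWn hMn hn
      refine (integral_mul_sq_le (ha n) (hb n) hMn).trans_eq ?_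
      rw [hbW]
      field_simp)
    (hW.mono fun n hn => by positivity) (by
      have := hlim.const_mul (1 / θ ^ 2)
      rwa [mul_zero] at this)

lemma sq_div_sqrt_mul_inv_sqrt_le {W K n : ℝ} (hn : 0 < n) (hW : 0 < W) (hWK : W ≤ K) :
    W ^ 2 / √(n * W) * (1 / √n) ≤ √K * (W / n) := by
  have h2 : √n ^ 2 = n := Real.sq_sqrt hn.le
  have h3 : √W ^ 2 = W := Real.sq_sqrt hW.le
  have h5 : 0 < √W := Real.sqrt_pos.2 hW
  have h6 : 0 < √n := Real.sqrt_pos.2 hn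
  calc W ^ 2 / √(n * W) * (1 / √n) = (√W ^ 2) ^ 2 / (√n * √W) * (1 / √n) := by
        rw [Real.sqrt_mul hn.le, h3]
    _ = √W * (√W ^ 2 / √n ^ 2) := by field_simp
    _ = √W * (W / n) := by rw [h2, h3]
    _ ≤ √K * (W / n) := by gcongr

theorem exists_highProb_le_signal_of_lt (H : OrthoSystem ρ φ Cφ τ) (hα : 1 < α)
    (hτ : τ < (α - 1) / 2) (hη : PowerDecay η c₁ c₂ α) (hβ : 1 / 2 < β)
    (hμ : ∀ p : ℕ, 1 ≤ p → |μ p| ≤ Cμ * (p : ℝ) ^ (-β)) (hq : DenseLower μ cμ β q D)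
    (hκ0 : 0 < κ) (hκ : κ < (α - 1 - 2 * τ) / (2 * α ^ 2)) (hβα : 2 * β - 1 < α) {R : ℕ → ℕ}
    (hR : ∀ᶠ n : ℕ in Filter.atTop, (n : ℝ) ^ (1 / α + κ) ≤ R n)
    (hR' : ∀ᶠ n : ℕ in Filter.atTop, (R n : ℝ) ≤ 2 * (n : ℝ) ^ (1 / α + κ)) :
    ∃ c : ℝ, 0 < c ∧ HighProb ρ (fun n => {x | c * signalRate α β n ≤
      (fun i => lincomb φ (Finset.Icc 1 (R n)) μ (x i)) ⬝ᵥ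
        ((regGram (Finset.Icc 1 (R n)) η (feat φ x))⁻¹ *ᵥ
          (fun i => lincomb φ (Finset.Icc 1 (R n)) μ (x i)))}) := by
  classical
  have hα0 : 0 < α := by positivity
  have hCφ := H.const_pos
  have hc₂ := hη.const_pos'
  have hτ0 := H.exponent_pos
  obtain ⟨c, hc, hblock⟩ := hq.exists_signalRate_le_block hα hβ hβα
  obtain ⟨K, hK, hμsum⟩ := exists_sum_sq_le hβ hμ
  have hη0 : ∀ n, ∀ p ∈ Finset.Icc 1 (R n), 0 ≤ η p :=
    fun n p hp => (hη.pos (Finset.mem_Icc.1 hp).1).le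
  set P : ℕ → ℕ := fun n => ⌈(n : ℝ) ^ (1 / α)⌉₊ with hP
  set I : ℕ → Finset ℕ := fun n => Finset.Ioc (P n) (2 * D * P n)
  set W : ℕ → ℝ := fun n => ∑ p ∈ I n, μ p ^ 2
  set f : ℕ → Ω → ℝ := fun n => lincomb φ (Finset.Icc 1 (R n)) μ
  set h : ℕ → Ω → ℝ := fun n => lincomb φ (I n) μ
  set M : ℕ → ℝ := fun n => Cφ * Cμ * ∑ p ∈ Finset.Icc 1 (R n), (p : ℝ) ^ (-β + τ)
  have hfb : ∀ n, BddMeas (f n) := fun n => H.bddMeas_lincomb _ _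
  have hhb : ∀ n, BddMeas (h n) := fun n => H.bddMeas_lincomb _ _
  have hhsq : ∀ n, ∫ z, h n z ^ 2 ∂ρ = W n := fun n => H.integral_lincomb_sq _ _
  have hDP := eventually_two_mul_mul_ceil_le hα0 hκ0 D hR
  have hIR : ∀ᶠ n : ℕ in Filter.atTop, I n ⊆ Finset.Icc 1 (R n) := by
    filter_upwards [hDP] with n hn p hp
    rw [Finset.mem_Ioc] at hp
    rw [Finset.mem_Icc]
    exact ⟨by omega, hp.2.trans hn⟩
  have hWK : ∀ n, W n ≤ K := fun n =>
    (Finset.sum_le_sum_of_subset_of_nonneg (fun p hp => Finset.mem_Icc.2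
      ⟨by have := (Finset.mem_Ioc.1 hp).1; omega, (Finset.mem_Ioc.1 hp).2⟩)
      fun p _ _ => sq_nonneg (μ p)).trans (hμsum _)
  have hv1 : ∀ᶠ n : ℕ in Filter.atTop, c ≤ n * W n := by
    filter_upwards [hblock, eventually_one_le_signalRate α β] with n h1 h2
    exact (le_mul_of_one_le_right hc.le h2).trans h1
  have hWpos : ∀ᶠ n : ℕ in Filter.atTop, 0 < W n := by
    filter_upwards [hv1] with n h1
    exact pos_of_mul_pos_right (hc.trans_le h1) (Nat.cast_nonneg n)
  have hv : Filter.Tendsto (fun n : ℕ => n * W n) Filter.atTop Filter.atTop := by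
    have h1 : 0 < 1 + (1 - 2 * β) / α := by
      have : 0 < (α + (1 - 2 * β)) / α := div_pos (by linarith) hα0
      rwa [add_div, div_self hα0.ne'] at this
    refine Filter.tendsto_atTop_mono' _ ?_ ((tendsto_natCast_rpow h1).const_mul_atTop hc)
    filter_upwards [hblock] with n h2
    rwa [signalRate_of_lt hα0 hβα] at h2
  have hsv : Filter.Tendsto (fun n : ℕ => √(n * W n)) Filter.atTop Filter.atTop :=
    Real.tendsto_sqrt_atTop.comp hv
  have hM : Filter.Tendsto (fun n : ℕ => M n ^ 2 / (n * W n)) Filter.atTop (nhds 0) := by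
    have h1 := (tendsto_sum_rpow_sq_mul_div_signalRate_sq hα hβ hτ hκ0 hκ hR').const_mul
      ((Cφ * Cμ) ^ 2 / c)
    rw [mul_zero] at h1
    refine squeeze_zero' ?_ ?_ h1
    · filter_upwards [hWpos] with n hn
      positivity
    · filter_upwards [hblock, eventually_one_le_signalRate α β] with n h2 h3
      have h4 : 0 < signalRate α β n := one_pos.trans_le h3
      calc M n ^ 2 / (n * W n) ≤ M n ^ 2 / (c * signalRate α β n) := by gcongr
        _ = _ := by
          rw [← signalRate_of_lt hα0 hβα]
          simp only [M]
          field_simp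
  have hfM : ∀ n z, |f n z| ≤ M n := fun n z =>
    H.abs_lincomb_le (fun p hp => (Finset.mem_Icc.1 hp).1)
      (fun p hp => hμ p (Finset.mem_Icc.1 hp).1) z
  have hCμ : 0 ≤ Cμ := by simpa using (abs_nonneg _).trans (hμ 1 le_rfl)
  have hhM : ∀ᶠ n : ℕ in Filter.atTop, ∀ z, |h n z| ≤ M n := by
    filter_upwards [hIR] with n hn z
    refine (H.abs_lincomb_le (fun p hp => (Finset.mem_Icc.1 (hn hp)).1)
      (fun p hp => hμ p (Finset.mem_Icc.1 (hn hp)).1) z).trans ?_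
    exact mul_le_mul_of_nonneg_left
      (Finset.sum_le_sum_of_subset_of_nonneg hn fun p _ _ => by positivity) (by positivity)
  set E : ℝ := 9 + 3 * c₂ + 3 * √K
  refine ⟨c / (4 * E), by positivity, fun δ hδ => ?_⟩
  obtain ⟨L, -, htailh⟩ := exists_eventuallyProb_tail_fluctuation H hτ hη (half_pos hδ) hhb
    (by simpa only [hhsq] using hWpos) R
  obtain ⟨G, hG0, hG, -⟩ := H.exists_low_mode_bound L
  have hfh := highProb_mean_mul_fluctuation hfb hhb (Filter.Eventually.of_forall hfM) hhsq hWpos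
    hM (θ := 1 / 4) (by norm_num)
  have hhh := highProb_mean_mul_fluctuation hhb hhb hhM hhsq hWpos hM one_pos
  have hlowh := highProb_low_mode_fluctuation H L hhb (t := fun n => W n ^ 2 / √(n * W n))
    (by
      filter_upwards [hWpos, Filter.eventually_ge_atTop 1] with n hW hn
      positivity)
    (by
      refine (hsv.const_div_atTop 1).congr' ?_
      filter_upwards [hWpos, Filter.eventually_ge_atTop 1] with n hW hn
      have h1 : √(n * W n) * √(n * W n) = n * W n := Real.mul_self_sqrt (by positivity)
      have h2 : 0 < √(n * W n) := by positivity
      have hn0 : (0 : ℝ) < n := by positivity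
      rw [hhsq, eq_comm, div_eq_div_iff (by positivity) h2.ne', one_mul, mul_div_assoc',
        eq_div_iff h2.ne', mul_assoc, h1]
      ring)
  have hlowf := highProb_low_mode_fluctuation H L hfb (t := fun _ => 1)
    (Filter.Eventually.of_forall fun _ => one_pos)
    (by
      simp only [mul_one]
      refine squeeze_zero (fun n => ?_) (fun n => ?_)
        ((tendsto_natCast_atTop_atTop (R := ℝ)).const_div_atTop K)
      · exact div_nonneg (integral_nonneg fun z => sq_nonneg _) (Nat.cast_nonneg n)
      · rw [H.integral_lincomb_sq]
        gcongr
        exact hμsum _)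
  have hgram := highProb_gram_fluctuation H hα hη R L
  have hcomb := ((hfh.inter (hhh.inter (hlowh.inter (hlowf.inter hgram)))) (δ / 2)
    (by positivity)).inter (by positivity) (by positivity) htailh
  rw [add_halves] at hcomb
  have hLP : ∀ᶠ n : ℕ in Filter.atTop, L ≤ P n := by
    filter_upwards [(tendsto_natCast_rpow (e := 1 / α) (by positivity)).eventually_ge_atTop
      (L : ℝ)] with n hn
    exact_mod_cast hn.trans (Nat.le_ceil _)
  refine hcomb.mono ?_
  filter_upwards [hblock, hWpos, hDP, hIR, hLP, hsv.eventually_ge_atTop (16 * (2 + 2 * K)),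
    hsv.eventually_ge_atTop (K * G), Filter.eventually_ge_atTop 1]
    with n hbn hW hDPn hIRn hLPn hv16 hvG hn x hx
  obtain ⟨⟨hx1, hx2, hx3, hx4, hx5⟩, hx6⟩ := hx
  have hn0 : (0 : ℝ) < n := by exact_mod_cast hn
  simp only [Set.mem_ofPred_eq, one_mul] at hx1 hx2 hx3 hx4 hx5 hx6 ⊢
  have hsv0 : 0 < √(n * W n) := by positivity
  have hproj : ∀ p, ∫ z, φ p z * h n z ∂ρ = if p ∈ I n then μ p else 0 := fun p =>
    H.integral_mul_lincomb p _ _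
  have hfint : ∫ z, f n z * h n z ∂ρ = W n := by
    rw [H.integral_lincomb_mul_lincomb hIRn]
    exact Finset.sum_congr rfl fun p _ => (_root_.sq _).symm
  have hhint : ∫ z, h n z * h n z ∂ρ = W n := by
    simpa only [_root_.sq] using hhsq n
  have hIL : I n ⊆ Finset.Ioc L (R n) := fun p hp => by
    rw [Finset.mem_Ioc] at hp ⊢
    exact ⟨hLPn.trans_lt hp.1, hp.2.trans hDPn⟩
  rw [hfint] at hx1
  rw [hhint] at hx2
  simp only [hproj, hhsq] at hx3 hx6
  have hLR : L ≤ R n := by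
    refine hLPn.trans (le_trans ?_ hDPn)
    exact Nat.le_mul_of_pos_left _ (by have := hq.pos; omega)
  have hZ : ∑ q ∈ Finset.Icc 1 L, empMean (fun z => φ q z * h n z) x ^ 2 ≤
      W n ^ 2 / √(n * W n) := by
    refine le_of_eq_of_le (Finset.sum_congr rfl fun p hp => ?_) hx3
    rw [if_neg fun hpI => ?_, sub_zero]
    have h1 := (Finset.mem_Icc.1 hp).2
    have h2 := (Finset.mem_Ioc.1 hpI).1
    omega
  have hY : ∑ q ∈ Finset.Icc 1 L, empMean (fun z => φ q z * f n z) x ^ 2 ≤ 2 + 2 * K := by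
    have h1 : ∀ q ∈ Finset.Icc 1 L, ∫ z, φ q z * f n z ∂ρ = μ q := fun q hq => by
      rw [H.integral_mul_lincomb, if_pos (Finset.Icc_subset_Icc_right hLR hq)]
    have h2 : ∀ q ∈ Finset.Icc 1 L, empMean (fun z => φ q z * f n z) x ^ 2 ≤
        2 * (empMean (fun z => φ q z * f n z) x - ∫ z, φ q z * f n z ∂ρ) ^ 2 + 2 * μ q ^ 2 :=
      fun q hq => by
        rw [h1 q hq]
        nlinarith [sq_nonneg (empMean (fun z => φ q z * f n z) x - 2 * μ q)]
    refine (Finset.sum_le_sum h2).trans ?_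
    rw [Finset.sum_add_distrib, ← Finset.mul_sum, ← Finset.mul_sum]
    linarith [hμsum L]
  have hV : ∑ p ∈ I n, η p * μ p ^ 2 ≤ c₂ * (W n / n) := by
    rw [show c₂ * (W n / n) = c₂ * (n : ℝ)⁻¹ * W n by ring, Finset.mul_sum]
    refine Finset.sum_le_sum fun p hp => mul_le_mul_of_nonneg_right ?_ (sq_nonneg _)
    have hp1 := (Finset.mem_Icc.1 (hIRn hp)).1
    have hp0 : (0 : ℝ) < p := by exact_mod_cast hp1
    refine (hη.upper p hp1).trans ?_
    have h1 : (n : ℝ) ^ (1 / α) ≤ p :=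
      (Nat.le_ceil _).trans (by exact_mod_cast (Finset.mem_Ioc.1 hp).1.le)
    have h2 : (n : ℝ) ≤ (p : ℝ) ^ α := by
      rw [← natCast_rpow_inv_rpow n hα0.ne']
      gcongr
    rw [Real.rpow_neg hp0.le]
    gcongr
  have hfinal := le_signal_of_empMean (W := W n) (A := √K) (V := c₂) hn (hη0 n) hIL hW
    (Real.sqrt_nonneg K) (by linarith [(abs_le.1 hx1).1]) (by linarith [(abs_le.1 hx2).2])
    hZ hY hx6 hV hx5 hG hc₂.le
    (by
      rw [div_mul_eq_mul_div, div_le_iff₀ hsv0]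
      nlinarith [mul_le_mul_of_nonneg_left hv16 (sq_nonneg (W n))])
    (by
      rw [div_mul_eq_mul_div, div_le_iff₀ hsv0]
      have h1 : W n * G ≤ K * G := mul_le_mul_of_nonneg_right (hWK n) hG0
      nlinarith [mul_le_mul_of_nonneg_left (h1.trans hvG) hW.le])
    (sq_div_sqrt_mul_inv_sqrt_le hn0 hW (hWK n))
  refine le_trans ?_ hfinal
  calc c / (4 * E) * signalRate α β n = c * signalRate α β n / (4 * E) := by ring
    _ ≤ n * W n / (4 * E) := by gcongr

end SignalLowerGrowing

lemma T1R_eq_regGram {Ω : Type*} (lam : ℕ → ℝ) (φ : ℕ → Ω → ℝ) {n : ℕ} (x : Fin n → Ω) (R : ℕ)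
    (s2 : ℝ) : T1R lam φ x R s2 =
      1 / 2 * (Real.log (regGram (Finset.Icc 1 R) (fun p => lam p / s2) (feat φ x)).det -
        Matrix.trace (1 - (regGram (Finset.Icc 1 R) (fun p => lam p / s2) (feat φ x))⁻¹)) := by
  rw [T1R, one_add_smul_KR]
  ring

lemma T2R_eq_regGram {Ω : Type*} (lam μ : ℕ → ℝ) (φ : ℕ → Ω → ℝ) {n : ℕ} (x : Fin n → Ω) (R : ℕ)
    (s2 : ℝ) : T2R lam μ φ x R s2 = 1 / (2 * s2) *
      ((fun i => lincomb φ (Finset.Icc 1 R) μ (x i)) ⬝ᵥ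
        ((regGram (Finset.Icc 1 R) (fun p => lam p / s2) (feat φ x))⁻¹ *ᵥ
          (fun i => lincomb φ (Finset.Icc 1 R) μ (x i)))) := by
  rw [T2R, one_add_smul_KR]
  rfl

lemma HighProb.exists_forall_le {Ω : Type*} [MeasurableSpace Ω] {ρ : Measure Ω}
    [IsProbabilityMeasure ρ] {E : ∀ n : ℕ, Set (Fin n → Ω)} (hE : HighProb ρ E) {δ : ℝ}
    (hδ : 0 < δ) : ∃ N : ℕ, ∀ n : ℕ, N ≤ n →
      ENNReal.ofReal (1 - δ) ≤ (Measure.pi fun _ : Fin n => ρ) (E n) := by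
  obtain ⟨N, hN⟩ := Filter.eventually_atTop.1 (hE δ hδ)
  refine ⟨N, fun n hn => ?_⟩
  rw [ENNReal.ofReal_sub _ hδ.le, ENNReal.ofReal_one, tsub_le_iff_right]
  calc (1 : ENNReal) = (Measure.pi fun _ : Fin n => ρ) (E n ∪ (E n)ᶜ) := by
        rw [Set.union_compl_self, measure_univ]
    _ ≤ _ := (measure_union_le _ _).trans (by gcongr; exact hN n hn)

/-- **Asymptotics of the truncated terms of the stochastic complexity (Lemma D.3).**
With R = ⌈n^{1/α+κ}⌉, with high probability T_{1,R} is of order n^{1/α} and, if μ₀ = 0,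
T_{2,R} is of order n^{max{0, 1+(1−2β)/α}} (with an extra log n factor when α = 2β−1). -/
theorem statement_19
    {Ω : Type*} [MeasurableSpace Ω] (ρ : Measure Ω) [IsProbabilityMeasure ρ]
    -- capacity condition: power-law eigenvalues
    (α C₁ C₂ : ℝ) (hα : 1 < α) (hC₁ : 0 < C₁) (hC₁₂ : C₁ ≤ C₂)
    (lam : ℕ → ℝ) (hlampos : ∀ p : ℕ, 1 ≤ p → 0 < lam p)
    (hlam : ∀ p : ℕ, 1 ≤ p → C₁ * (p : ℝ) ^ (-α) ≤ lam p ∧ lam p ≤ C₂ * (p : ℝ) ^ (-α))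
    -- orthonormal, polynomially bounded eigenfunctions
    (Cφ τ : ℝ) (hCφ : 0 < Cφ) (hτ0 : 0 < τ) (hτ : τ < (α - 1) / 2)
    (φ : ℕ → Ω → ℝ) (hφmeas : ∀ p, Measurable (φ p))
    (horth : ∀ p q, ∫ z, φ p z * φ q z ∂ρ = if p = q then 1 else 0)
    (hφ0 : ∀ z, |φ 0 z| ≤ Cφ)
    (hφb : ∀ p : ℕ, 1 ≤ p → ∀ z, |φ p z| ≤ Cφ * (p : ℝ) ^ τ)
    -- source condition: power-law coefficients of the target function
    (β Cμ cμ : ℝ) (hβ : 1 / 2 < β) (hcμ : 0 < cμ) (hcCμ : cμ ≤ Cμ)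
    (μ : ℕ → ℝ) (hμ : ∀ p : ℕ, 1 ≤ p → |μ p| ≤ Cμ * (p : ℝ) ^ (-β))
    (pseq : ℕ → ℕ) (hpseq : StrictMono pseq) (hpseq1 : ∀ i, 1 ≤ pseq i)
    (hgap : ∃ h : ℕ, ∀ i, pseq (i + 1) - pseq i ≤ h)
    (hμlow : ∀ i, cμ * (pseq i : ℝ) ^ (-β) ≤ |μ (pseq i)|)
    -- fixed noise level and truncation exponent
    (σ : ℝ) (hσ : 0 < σ) (κ : ℝ) (hκ0 : 0 < κ) (hκ : κ < (α - 1 - 2 * τ) / (2 * α ^ 2)) :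
    ∃ c C : ℝ, 0 < c ∧ 0 < C ∧ ∀ δ : ℝ, 0 < δ → δ < 1 → ∃ N : ℕ, ∀ n : ℕ, N ≤ n →
      ENNReal.ofReal (1 - δ) ≤
        (Measure.pi fun _ : Fin n => ρ)
          {x : Fin n → Ω |
            (c * (n : ℝ) ^ (1 / α) ≤
                T1R lam φ x (Nat.ceil ((n : ℝ) ^ (1 / α + κ))) (σ ^ 2) ∧
              T1R lam φ x (Nat.ceil ((n : ℝ) ^ (1 / α + κ))) (σ ^ 2) ≤
                C * (n : ℝ) ^ (1 / α)) ∧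
            (μ 0 = 0 →
              c * (if α = 2 * β - 1 then Real.log n
                    else (n : ℝ) ^ (max 0 (1 + (1 - 2 * β) / α))) ≤
                T2R lam μ φ x (Nat.ceil ((n : ℝ) ^ (1 / α + κ))) (σ ^ 2) ∧
              T2R lam μ φ x (Nat.ceil ((n : ℝ) ^ (1 / α + κ))) (σ ^ 2) ≤
                C * (if α = 2 * β - 1 then Real.log n
                      else (n : ℝ) ^ (max 0 (1 + (1 - 2 * β) / α))))} := by
  have hs : 0 < σ ^ 2 := by positivity
  have hα0 : 0 < α := by positivity
  have H : OrthoSystem ρ φ Cφ τ := ⟨hφmeas, horth, hφ0, hφb, hCφ, hτ0⟩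
  have hη : PowerDecay (fun p => lam p / σ ^ 2) (C₁ / σ ^ 2) (C₂ / σ ^ 2) α :=
    ⟨by positivity,
      fun p hp => by rw [div_mul_eq_mul_div]; gcongr; exact (hlam p hp).1,
      fun p hp => by rw [div_mul_eq_mul_div]; gcongr; exact (hlam p hp).2⟩
  obtain ⟨g, hgap⟩ := hgap
  have hq := denseLower_of_gap hcμ hpseq hpseq1 hgap hμlow
  have hCμ : 0 < Cμ := hcμ.trans_le hcCμ
  set R : ℕ → ℕ := fun n => ⌈(n : ℝ) ^ (1 / α + κ)⌉₊
  have hR : ∀ᶠ n : ℕ in Filter.atTop, (n : ℝ) ^ (1 / α + κ) ≤ R n :=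
    Filter.Eventually.of_forall fun n => Nat.le_ceil _
  have hR' : ∀ᶠ n : ℕ in Filter.atTop, (R n : ℝ) ≤ 2 * (n : ℝ) ^ (1 / α + κ) := by
    filter_upwards [Filter.eventually_ge_atTop 1] with n hn
    exact ceil_natCast_rpow_le (by positivity) hn
  have hR₁ : ∀ᶠ n : ℕ in Filter.atTop, (n : ℝ) ^ (1 / α) ≤ R n := by
    filter_upwards [hR, Filter.eventually_ge_atTop 1] with n h1 hn
    exact (Real.rpow_le_rpow_of_exponent_le (by exact_mod_cast hn) (by linarith)).trans h1
  obtain ⟨a₁, ha₁, h₁⟩ := exists_highProb_le_log_det H hα hτ hη hR₁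
  obtain ⟨a₂, ha₂, h₂⟩ := exists_highProb_log_det_le H hα hτ hη R
  obtain ⟨a₃, ha₃, h₃⟩ : ∃ c : ℝ, 0 < c ∧ HighProb ρ (fun n => {x | c * signalRate α β n ≤
      (fun i => lincomb φ (Finset.Icc 1 (R n)) μ (x i)) ⬝ᵥ
        ((regGram (Finset.Icc 1 (R n)) (fun p => lam p / σ ^ 2) (feat φ x))⁻¹ *ᵥ
          (fun i => lincomb φ (Finset.Icc 1 (R n)) μ (x i)))}) := by
    rcases lt_or_ge (2 * β - 1) α with h | h
    · exact exists_highProb_le_signal_of_lt H hα hτ hη hβ hμ hq hκ0 hκ h hR hR'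
    · exact exists_highProb_le_signal_of_le H hα hτ hη hβ hμ hq h hR₁
  obtain ⟨a₄, ha₄, h₄⟩ := exists_highProb_signal_le H hα hτ hη hβ hCμ hμ hκ0 hκ hR'
  refine ⟨min (1 / 2 * a₁) (1 / (2 * σ ^ 2) * a₃), max (1 / 2 * a₂) (1 / (2 * σ ^ 2) * a₄),
    lt_min (by positivity) (by positivity), lt_max_of_lt_left (by positivity),
    fun δ hδ _ => HighProb.exists_forall_le ?_ hδ⟩
  refine ((h₁.inter h₂).inter (h₃.inter h₄)).mono ?_
  filter_upwards [eventually_one_le_signalRate α β] with n hn x hx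
  obtain ⟨⟨hx1, hx2⟩, hx3, hx4⟩ := hx
  rw [Set.mem_ofPred_eq] at hx1 hx2 hx3 hx4 ⊢
  have hrate : 0 ≤ (n : ℝ) ^ (1 / α) := by positivity
  have hrate' : 0 ≤ signalRate α β n := zero_le_one.trans hn
  have htrace := trace_one_sub_regGram_inv_nonneg
    (fun p hp => hη.pos (Finset.mem_Icc.1 hp).1 : ∀ p ∈ Finset.Icc 1 (R n), 0 < lam p / σ ^ 2)
    (feat φ x)
  rw [T1R_eq_regGram, T2R_eq_regGram]
  refine ⟨⟨?_, ?_⟩, fun _ => ⟨?_, ?_⟩⟩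
  · refine (mul_le_mul_of_nonneg_right (min_le_left _ _) hrate).trans ?_
    rw [mul_assoc]
    exact mul_le_mul_of_nonneg_left hx1 (by positivity)
  · refine le_trans ?_ (mul_le_mul_of_nonneg_right (le_max_left _ _) hrate)
    rw [mul_assoc]
    exact mul_le_mul_of_nonneg_left ((sub_le_self _ htrace).trans hx2) (by positivity)
  · refine (mul_le_mul_of_nonneg_right (min_le_right _ _) hrate').trans ?_
    rw [mul_assoc]
    exact mul_le_mul_of_nonneg_left hx3 (by positivity)
  · refine le_trans ?_ (mul_le_mul_of_nonneg_right (le_max_right _ _) hrate')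
    rw [mul_assoc]
    exact mul_le_mul_of_nonneg_left hx4 (by positivity)
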